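/- Let p > 2 and B_1 ⊂ ℝ². There exist constants λ_0 ∈ (0, 1/2) and δ_0 > 0, depending only on p, such that: if f ∈ L^∞(B_1) with ‖f‖_{L^∞(B_1)} ≤ δ_0, and u ∈ C¹(B_1) is a weak solution of -Δ_p u = f in B_1 with ‖u‖_{L^∞(B_1)} ≤ 1, then sup_{x ∈ B_{λ_0}} | u(x) − [ u(0) + ∇u(0)·x ] | ≤ λ_0^{p'}. -/

import Mathlib

open MeasureTheory Metric Real
open scoped RealInnerProductSpace ENNReal

noncomputable section

/-- The open ball of radius `r` centered at the origin of `ℝ^d`. -/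
abbrev B (d : ℕ) (r : ℝ) : Set (EuclideanSpace ℝ (Fin d)) := ball 0 r

/-- `u` is a weak solution of `-Δ_p u = f` in the ball `B_r ⊂ ℝ^d`. -/
def IsPLaplaceWeakSolution {d : ℕ} (p r : ℝ)
    (u f : EuclideanSpace ℝ (Fin d) → ℝ) : Prop :=
  ∀ φ : EuclideanSpace ℝ (Fin d) → ℝ, ContDiff ℝ (⊤ : ℕ∞) φ → HasCompactSupport φ →
    tsupport φ ⊆ B d r →
    ∫ x in B d r, ‖gradient u x‖ ^ (p - 2) * ⟪gradient u x, gradient φ x⟫ =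
      ∫ x in B d r, f x * φ x

theorem dol_wirtinger (X X' : ℝ → ℂ) (hX : ∀ x, HasDerivAt X (X' x) x) (hX' : Continuous X')
    (hper : X π = X (-π)) :
    ∫ x in (-π)..π, ‖X x‖ ^ 2 ≤ (∫ x in (-π)..π, ‖X' x‖ ^ 2)
      + 2 * π * ‖(1 / (2 * π) : ℝ) • ∫ x in (-π)..π, X x‖ ^ 2 := by
  have hab : (-π) < π := by linarith [pi_pos]
  have hXc : Continuous X := continuous_iff_continuousAt.2 fun x => (hX x).continuousAt
  have mem : ∀ f : ℝ → ℂ, Continuous f → MemLp f 2 (volume.restrict (Set.Ioc (-π) π)) := by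
    intro f hf
    have h1 : MemLp f ⊤ (volume.restrict (Set.Ioc (-π) π)) := by
      obtain ⟨C, hC⟩ := (isCompact_Icc (a := -π) (b := π)).exists_bound_of_continuousOn hf.continuousOn
      refine memLp_top_of_bound hf.aestronglyMeasurable C ?_
      refine (ae_restrict_iff' measurableSet_Ioc).2 (Filter.Eventually.of_forall fun x hx => hC x ⟨hx.1.le, hx.2⟩)
    exact h1.mono_exponent le_top
  have P1 := hasSum_sq_fourierCoeffOn hab (mem X hXc)
  have P2 := hasSum_sq_fourierCoeffOn hab (mem X' hX')
  have h0 : fourierCoeffOn hab X 0 = (1 / (2 * π) : ℝ) • ∫ x in (-π)..π, X x := by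
    rw [fourierCoeffOn_eq_integral]
    simp only [neg_zero, fourier_zero, one_smul]
    congr 2; ring
  have P3 : HasSum (fun i : ℤ => if i = 0 then ‖fourierCoeffOn hab X 0‖ ^ 2 else 0)
      (‖fourierCoeffOn hab X 0‖ ^ 2) := hasSum_ite_eq 0 _
  have key := hasSum_le (fun i => ?_) P1 (P2.add P3)
  · rw [h0] at key
    have e : (π - -π)⁻¹ = (2*π)⁻¹ := by ring
    simp only [smul_eq_mul, e] at key
    have hp : 0 < 2 * π := by positivity
    have := mul_le_mul_of_nonneg_left key hp.le
    rw [mul_add, ← mul_assoc, ← mul_assoc, mul_inv_cancel₀ hp.ne', one_mul, one_mul] at this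
    exact this
  · show ‖fourierCoeffOn hab X i‖ ^ 2 ≤ ‖fourierCoeffOn hab X' i‖ ^ 2 + _
    by_cases hi : i = 0
    · subst hi; simp
    · simp only [hi, if_false, add_zero]
      have := fourierCoeffOn_of_hasDerivAt hab hi (fun x _ => hX x) (hX'.intervalIntegrable _ _)
      rw [this, hper, sub_self, mul_zero, zero_sub]
      have e2 : (((π:ℝ):ℂ) - ((-π : ℝ):ℂ)) = 2 * π := by push_cast; ring
      rw [e2]
      have hpc : (π : ℂ) ≠ 0 := by exact_mod_cast pi_ne_zero
      have hic : (i : ℂ) ≠ 0 := by exact_mod_cast hi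
      have e3 : (1:ℂ) / (-2 * ↑π * Complex.I * ↑i) * -(2 * ↑π * fourierCoeffOn hab X' i)
          = (1 / (Complex.I * i)) * fourierCoeffOn hab X' i := by
        field_simp
      rw [e3, norm_mul, norm_div, norm_mul, Complex.norm_I, one_mul, norm_one, mul_pow]
      have : (1:ℝ) ≤ ‖(i:ℂ)‖ := by
        rw [Complex.norm_intCast]; exact_mod_cast Int.one_le_abs hi
      have : (1 / ‖(i:ℂ)‖)^2 ≤ 1 := by
        apply pow_le_one₀ (by positivity)
        rw [div_le_one (by linarith)]; exact this
      nlinarith [sq_nonneg ‖fourierCoeffOn hab X' i‖]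

theorem dol_trig (α β μ ν : ℝ) :
    ∫ θ in (-π)..π, (α * sin θ + β * cos θ + μ * sin (2*θ) + ν * cos (2*θ)) ^ 2
      = π * (α^2 + β^2 + μ^2 + ν^2) := by
  have hd : ∀ θ ∈ Set.uIcc (-π) π, HasDerivAt (fun θ : ℝ =>
      (α^2+β^2+μ^2+ν^2)*θ/2 + (β^2-α^2)*(sin θ * cos θ)/2 - α*β*(cos θ)^2
       + (ν^2-μ^2)*(sin (2*θ) * cos (2*θ))/4 - μ*ν*(cos (2*θ))^2/2
       + 2*(α*μ*(2*(sin θ)^3/3) + α*ν*(-2*(cos θ)^3/3 + cos θ) + β*μ*(-2*(cos θ)^3/3)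
         + β*ν*(sin θ - 2*(sin θ)^3/3)))
      ((α * sin θ + β * cos θ + μ * sin (2*θ) + ν * cos (2*θ)) ^ 2) θ := by
    intro θ _
    have hs := hasDerivAt_sin θ
    have hc := hasDerivAt_cos θ
    have hi : HasDerivAt (fun θ : ℝ => 2*θ) 2 θ := by simpa using (hasDerivAt_id θ).const_mul 2
    have hs2 := hi.sin
    have hc2 := hi.cos
    have h := (((((((((hasDerivAt_id θ).const_mul (α^2+β^2+μ^2+ν^2)).div_const 2).add
      (((hs.mul hc).const_mul (β^2-α^2)).div_const 2)).sub ((hc.pow 2).const_mul (α*β))).add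
      (((hs2.mul hc2).const_mul (ν^2-μ^2)).div_const 4)).sub
      (((hc2.pow 2).const_mul (μ*ν)).div_const 2)).add
      (((((((hs.pow 3).const_mul 2).div_const 3).const_mul (α*μ)).add
        (((((hc.pow 3).const_mul (-2)).div_const 3).add hc).const_mul (α*ν))).add
        ((((hc.pow 3).const_mul (-2)).div_const 3).const_mul (β*μ))).add
        ((hs.sub (((hs.pow 3).const_mul 2).div_const 3)).const_mul (β*ν)) |>.const_mul 2)))
    refine h.congr_deriv ?_
    have e1 : sin (2*θ) = 2 * sin θ * cos θ := sin_two_mul θ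
    have e2 : cos (2*θ) = 1 - 2 * (sin θ)^2 := by rw [cos_two_mul']; nlinarith [sin_sq_add_cos_sq θ]
    have e3 := sin_sq_add_cos_sq θ
    have e4 : (sin (2*θ))^2 + (cos (2*θ))^2 = 1 := sin_sq_add_cos_sq _
    push_cast
    simp only [Nat.reduceSub, pow_one, mul_one]
    have e5 : (cos θ)^2 = 1 - (sin θ)^2 := by linarith
    have e6 : (cos (2*θ))^2 = 1 - (sin (2*θ))^2 := by linarith
    have f1 : sin θ * sin (2*θ) = 2 * sin θ^2 * cos θ := by rw [e1]; ring
    have f2 : sin θ * cos (2*θ) = sin θ * (2 * cos θ^2 - 1) := by rw [e2, e5]; ring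
    have f3 : cos θ * sin (2*θ) = 2 * sin θ * cos θ^2 := by rw [e1]; ring
    have f4 : cos θ * cos (2*θ) = cos θ * (1 - 2 * sin θ^2) := by rw [e2]
    linear_combination (-α^2-β^2)/2 * e3 + (-μ^2-ν^2)/2 * e4
      + (-2*α*μ) * f1 - 2*α*ν*f2 - 2*β*μ*f3 - 2*β*ν*f4
  rw [intervalIntegral.integral_eq_sub_of_hasDerivAt hd
    ((by fun_prop : Continuous fun θ : ℝ => (α * sin θ + β * cos θ + μ * sin (2*θ) + ν * cos (2*θ)) ^ 2).intervalIntegrable _ _)]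
  have s2 : sin (2 * -π) = 0 := by rw [mul_neg, sin_neg, sin_two_pi, neg_zero]
  have c2 : cos (2 * -π) = 1 := by rw [mul_neg, cos_neg, cos_two_pi]
  simp [s2, c2]
  ring

theorem dol_cs (f : ℝ → ℝ) (hf : Continuous f) :
    (∫ x in (-π)..π, f x) ^ 2 ≤ 2 * π * ∫ x in (-π)..π, f x ^ 2 := by
  set m := (∫ x in (-π)..π, f x) / (2 * π) with hm
  have hp := pi_pos
  have h1 : 0 ≤ ∫ x in (-π)..π, (f x - m) ^ 2 :=
    intervalIntegral.integral_nonneg (by linarith) fun x _ => sq_nonneg _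
  have h2 : ∫ x in (-π)..π, (f x - m) ^ 2 =
      (∫ x in (-π)..π, f x ^ 2) - 2 * m * (∫ x in (-π)..π, f x) + 2 * π * m ^ 2 := by
    have : ∀ x, (f x - m) ^ 2 = f x ^ 2 - 2 * m * f x + m ^ 2 := fun x => by ring
    simp_rw [this]
    rw [intervalIntegral.integral_add, intervalIntegral.integral_sub,
      intervalIntegral.integral_const_mul, intervalIntegral.integral_const]
    · rw [smul_eq_mul]; ring
    all_goals exact Continuous.intervalIntegrable (by fun_prop) _ _
  have h3 : (∫ x in (-π)..π, f x) = 2 * π * m := by rw [hm]; field_simp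
  rw [h2, h3] at h1
  rw [h3]
  nlinarith

theorem dol_osc (R R' : ℝ → ℂ) (hR : ∀ x, HasDerivAt R (R' x) x) (hR' : Continuous R')
    (θ : ℝ) (hθ : θ ∈ Set.Icc (-π) π) :
    ‖R θ - (1 / (2 * π) : ℝ) • ∫ x in (-π)..π, R x‖ ^ 2 ≤ 2 * π * ∫ x in (-π)..π, ‖R' x‖ ^ 2 := by
  have hp := pi_pos
  have hRc : Continuous R := continuous_iff_continuousAt.2 fun x => (hR x).continuousAt
  set N := ∫ x in (-π)..π, ‖R' x‖ with hN
  have hN0 : 0 ≤ N := intervalIntegral.integral_nonneg (by linarith) fun x _ => norm_nonneg _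
  have h1 : ∀ φ ∈ Set.Icc (-π) π, ‖R θ - R φ‖ ≤ N := by
    intro φ hφ
    rw [← intervalIntegral.integral_eq_sub_of_hasDerivAt (fun x _ => hR x)
      (hR'.intervalIntegrable φ θ)]
    have := intervalIntegral.norm_integral_le_abs_integral_norm (f := R') (a := φ) (b := θ) (μ := volume)
    refine this.trans ?_
    refine le_trans ?_ (le_of_eq (abs_of_nonneg hN0))
    rw [hN]
    apply intervalIntegral.abs_integral_mono_interval
    · rw [Set.uIoc_of_le (by linarith : -π ≤ π)]
      intro x hx
      rw [Set.mem_uIoc] at hx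
      rcases hx with hx | hx
      · exact ⟨by linarith [hφ.1], by linarith [hθ.2]⟩
      · exact ⟨by linarith [hθ.1], by linarith [hφ.2]⟩
    · exact Filter.Eventually.of_forall fun x => norm_nonneg _
    · exact hR'.norm.intervalIntegrable _ _
  have h2 : R θ - (1 / (2 * π) : ℝ) • ∫ x in (-π)..π, R x
      = (1 / (2 * π) : ℝ) • ∫ x in (-π)..π, (R θ - R x) := by
    rw [intervalIntegral.integral_sub (by simp) (hRc.intervalIntegrable _ _),
      intervalIntegral.integral_const, smul_sub, smul_smul]
    congr 1
    have : 1 / (2 * π) * (π - -π) = 1 := by field_simp; ring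
    rw [this, one_smul]
  have h3 : ‖∫ x in (-π)..π, (R θ - R x)‖ ≤ N * (2 * π) := by
    have := intervalIntegral.norm_integral_le_of_norm_le_const (a := -π) (b := π)
      (f := fun x => R θ - R x) (C := N) (fun x hx => by
        rw [Set.uIoc_of_le (by linarith)] at hx
        exact h1 x ⟨hx.1.le, hx.2⟩)
    rwa [show |π - -π| = 2 * π by rw [abs_of_pos (by linarith)]; ring] at this
  have h4 : ‖R θ - (1 / (2 * π) : ℝ) • ∫ x in (-π)..π, R x‖ ≤ N := by
    rw [h2, norm_smul, Real.norm_of_nonneg (by positivity)]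
    calc _ ≤ 1 / (2 * π) * (N * (2 * π)) := by gcongr
      _ = N := by field_simp
  calc _ ≤ N ^ 2 := by gcongr
    _ ≤ _ := dol_cs _ hR'.norm

theorem dol_im_sq_le (z : ℂ) : z.im ^ 2 ≤ ‖z‖ ^ 2 := by
  rw [Complex.sq_norm, Complex.normSq_apply]; nlinarith [sq_nonneg z.re]

theorem dol_norm_exp (θ : ℝ) : ‖Complex.exp (θ * Complex.I)‖ = 1 := Complex.norm_exp_ofReal_mul_I θ

/-- the weight `cos²ω` -/
def dolW (Z : ℝ → ℂ) (θ : ℝ) : ℝ := (Z θ * Complex.exp (θ * Complex.I)).im ^ 2 / ‖Z θ‖ ^ 2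

theorem dolW_nonneg (Z : ℝ → ℂ) (θ : ℝ) : 0 ≤ dolW Z θ := by unfold dolW; positivity

theorem dolW_le_one (Z : ℝ → ℂ) (θ : ℝ) : dolW Z θ ≤ 1 := by
  unfold dolW
  apply div_le_one_of_le₀ _ (by positivity)
  have := dol_im_sq_le (Z θ * Complex.exp (θ * Complex.I))
  rwa [norm_mul, dol_norm_exp, mul_one] at this

theorem dolW_int (Z : ℝ → ℂ) (hZ : Continuous Z) (g : ℝ → ℝ) (hg : Continuous g) :
    IntervalIntegrable (fun θ => g θ * dolW Z θ) volume (-π) π := by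
  have hm : Measurable (dolW Z) := by
    unfold dolW
    apply Measurable.div
    · exact (Continuous.measurable (by fun_prop))
    · exact (Continuous.measurable (by fun_prop))
  refine (hg.intervalIntegrable (-π) π).mono_fun (hg.measurable.mul hm).aestronglyMeasurable
    (Filter.Eventually.of_forall fun x => ?_)
  show ‖g x * dolW Z x‖ ≤ _
  rw [norm_mul, Real.norm_of_nonneg (dolW_nonneg Z x)]
  nlinarith [norm_nonneg (g x), dolW_le_one Z x]

theorem dol_exp_deriv (k : ℂ) (x : ℝ) :
    HasDerivAt (fun t : ℝ => Complex.exp (k * t)) (k * Complex.exp (k * x)) x := by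
  have h1 : HasDerivAt (fun t : ℝ => (t : ℂ)) 1 x := Complex.ofRealCLM.hasDerivAt
  have := (h1.const_mul k).cexp
  simpa [mul_comm] using this

theorem dol_int_exp : ∫ x in (-π)..π, Complex.exp (Complex.I * x) = 0 := by
  have h := intervalIntegral.integral_eq_sub_of_hasDerivAt (a := -π) (b := π)
    (f := fun t : ℝ => -Complex.I * Complex.exp (Complex.I * t))
    (f' := fun t : ℝ => Complex.exp (Complex.I * t)) (fun x _ => by
      have := (dol_exp_deriv Complex.I x).const_mul (-Complex.I)
      have e : -Complex.I * (Complex.I * Complex.exp (Complex.I * x)) = Complex.exp (Complex.I * x) := by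
        rw [← mul_assoc]; simp
      rw [e] at this; exact this)
    (Continuous.intervalIntegrable (by fun_prop) _ _)
  rw [h]
  have e1 : Complex.exp (Complex.I * (π : ℂ)) = -1 := by rw [mul_comm]; exact Complex.exp_pi_mul_I
  have e2 : Complex.exp (Complex.I * ((-π : ℝ) : ℂ)) = -1 := by
    push_cast; rw [mul_neg, Complex.exp_neg, e1]; norm_num
  rw [e1, e2]; ring

theorem dol_norm_expI (θ : ℝ) : ‖Complex.exp (Complex.I * θ)‖ = 1 := by
  rw [mul_comm]; exact dol_norm_exp θ
theorem dol_norm_expnI (θ : ℝ) : ‖Complex.exp (-Complex.I * θ)‖ = 1 := by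
  have := dol_norm_exp (-θ)
  convert this using 3; push_cast; ring

theorem dol_sq_norm_sub (a b : ℂ) : ‖a - b‖^2 = ‖a‖^2 + ‖b‖^2 - 2 * (a * (starRingEnd ℂ) b).re := by
  simp only [Complex.sq_norm, Complex.normSq_apply, Complex.sub_re, Complex.sub_im, Complex.mul_re,
    Complex.conj_re, Complex.conj_im]
  ring

/-- basic facts on first Fourier mode -/
theorem dol_curve_fourier (Z Z' : ℝ → ℂ) (hZ : ∀ x, HasDerivAt Z (Z' x) x) (hZ' : Continuous Z')
    (hper : Z π = Z (-π)) : ∃ c0 c1 : ℂ, ∃ ϖ : ℝ, 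
    ϖ = (∫ θ in (-π)..π, ‖Z' θ - Complex.I * c1 * Complex.exp (Complex.I * θ)‖^2) ∧
    ϖ = (∫ θ in (-π)..π, ‖Z' θ‖^2) - 2 * π * ‖c1‖^2 ∧
    2 * (∫ θ in (-π)..π, ((starRingEnd ℂ) (Z θ) * Z' θ).im) ≤ 
      (∫ θ in (-π)..π, ‖Z' θ‖^2) + 2 * π * ‖c1‖^2 ∧
    ∀ θ ∈ Set.Icc (-π) π, ‖Z θ - c0 - c1 * Complex.exp (Complex.I * θ)‖^2 ≤ 2 * π * ϖ := by
  have hp := pi_pos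
  have hZc : Continuous Z := continuous_iff_continuousAt.2 fun x => (hZ x).continuousAt
  set c0 : ℂ := (1 / (2 * π) : ℝ) • ∫ x in (-π)..π, Z x with hc0
  set c1 : ℂ := (1 / (2 * π) : ℝ) • ∫ x in (-π)..π, Complex.exp (-Complex.I * x) * Z x with hc1
  have e1 : Complex.exp (-Complex.I * (π : ℂ)) = -1 := by
    rw [neg_mul, Complex.exp_neg, mul_comm, Complex.exp_pi_mul_I]; norm_num
  have e2 : Complex.exp (-Complex.I * ((-π : ℝ) : ℂ)) = -1 := by
    push_cast; rw [neg_mul_neg, mul_comm]; exact Complex.exp_pi_mul_I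
  have hX : ∀ x : ℝ, HasDerivAt (fun t : ℝ => Complex.exp (-Complex.I * t) * Z t)
      (-Complex.I * Complex.exp (-Complex.I * x) * Z x + Complex.exp (-Complex.I * x) * Z' x) x :=
    fun x => (dol_exp_deriv (-Complex.I) x).mul (hZ x)
  -- by parts
  have hbp : ∫ x in (-π)..π, Complex.exp (-Complex.I * x) * Z' x = Complex.I * (2 * π * c1) := by
    have h := intervalIntegral.integral_eq_sub_of_hasDerivAt (a := -π) (b := π)
      (fun x _ => hX x) (Continuous.intervalIntegrable (by fun_prop) _ _)
    rw [intervalIntegral.integral_add (Continuous.intervalIntegrable (by fun_prop) _ _)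
      (Continuous.intervalIntegrable (by fun_prop) _ _), e1, e2, hper, sub_self] at h
    have h' : ∫ x in (-π)..π, -Complex.I * Complex.exp (-Complex.I * x) * Z x =
       -Complex.I * ∫ x in (-π)..π, Complex.exp (-Complex.I * x) * Z x := by
      rw [← intervalIntegral.integral_const_mul]; congr 1; ext x; ring
    have h2 : (∫ x in (-π)..π, Complex.exp (-Complex.I * x) * Z x) = 2 * π * c1 := by
      rw [hc1, Complex.real_smul]; push_cast
      have : (π : ℂ) ≠ 0 := by exact_mod_cast hp.ne'
      field_simp
    rw [h', h2] at h
    linear_combination h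
  have hexpd : ∀ θ, ‖Z' θ - Complex.I * c1 * Complex.exp (Complex.I * θ)‖^2 = 
      ‖Z' θ‖^2 + ‖c1‖^2 - 2 * ((-Complex.I * (starRingEnd ℂ) c1) * (Complex.exp (-Complex.I * θ) * Z' θ)).re := by
    intro θ
    rw [dol_sq_norm_sub, norm_mul, norm_mul, dol_norm_expI]
    congr 1
    · simp
    · congr 2
      rw [map_mul, map_mul, ← Complex.exp_conj]; simp; ring
  have hϖ : (∫ θ in (-π)..π, ‖Z' θ - Complex.I * c1 * Complex.exp (Complex.I * θ)‖^2) =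
     (∫ θ in (-π)..π, ‖Z' θ‖^2) - 2 * π * ‖c1‖^2 := by
    simp_rw [hexpd]
    rw [intervalIntegral.integral_sub (Continuous.intervalIntegrable (by fun_prop) _ _)
      (Continuous.intervalIntegrable (by fun_prop) _ _),
      intervalIntegral.integral_add (Continuous.intervalIntegrable (by fun_prop) _ _)
      (Continuous.intervalIntegrable (by fun_prop) _ _), intervalIntegral.integral_const_mul,
      intervalIntegral.integral_const]
    have : (∫ x in (-π)..π, ((-Complex.I * (starRingEnd ℂ) c1) * (Complex.exp (-Complex.I * x) * Z' x)).re)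
        = 2 * π * ‖c1‖^2 := by
      have h := Complex.reCLM.intervalIntegral_comp_comm (a := -π) (b := π) (μ := volume)
        (f := fun x : ℝ => (-Complex.I * (starRingEnd ℂ) c1) * (Complex.exp (-Complex.I * x) * Z' x))
        (Continuous.intervalIntegrable (by fun_prop) _ _)
      simp only [Complex.reCLM_apply] at h
      rw [h, intervalIntegral.integral_const_mul, hbp]
      have : -Complex.I * (starRingEnd ℂ) c1 * (Complex.I * (2 * π * c1)) = ((2 * π * ‖c1‖^2 : ℝ) : ℂ) := by
        have h3 : (starRingEnd ℂ) c1 * c1 = ((‖c1‖^2 : ℝ) : ℂ) := by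
          rw [mul_comm, Complex.mul_conj, Complex.sq_norm]
        push_cast at h3 ⊢
        linear_combination (-(Complex.I^2) * 2 * π) * h3 - (2 * π * (‖c1‖:ℂ)^2) * Complex.I_sq
      rw [this, Complex.ofReal_re]
    rw [this, smul_eq_mul]; ring
  refine ⟨c0, c1, _, rfl, hϖ, ?_, ?_⟩
  · have h := dol_wirtinger _ _ hX (by fun_prop) (by simp only [e1, e2, hper])
    rw [← hc1] at h
    have n1 : ∀ x : ℝ, ‖Complex.exp (-Complex.I * x) * Z x‖^2 = ‖Z x‖^2 := fun x => by
      rw [norm_mul, dol_norm_expnI, one_mul]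
    have n2 : ∀ x : ℝ, ‖-Complex.I * Complex.exp (-Complex.I * x) * Z x + Complex.exp (-Complex.I * x) * Z' x‖^2
       = ‖Z' x‖^2 + ‖Z x‖^2 - 2 * ((starRingEnd ℂ) (Z x) * Z' x).im := fun x => by
      rw [show -Complex.I * Complex.exp (-Complex.I * x) * Z x + Complex.exp (-Complex.I * x) * Z' x = 
        Complex.exp (-Complex.I * x) * (Z' x - Complex.I * Z x) by ring, norm_mul, dol_norm_expnI, one_mul,
        dol_sq_norm_sub, norm_mul, Complex.norm_I, one_mul]
      congr 2
      simp; ring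
    simp_rw [n1, n2] at h
    rw [intervalIntegral.integral_sub (Continuous.intervalIntegrable (by fun_prop) _ _)
      (Continuous.intervalIntegrable (by fun_prop) _ _),
      intervalIntegral.integral_add (Continuous.intervalIntegrable (by fun_prop) _ _)
      (Continuous.intervalIntegrable (by fun_prop) _ _), intervalIntegral.integral_const_mul] at h
    linarith
  · intro θ hθ
    have h := dol_osc (fun t => Z t - c0 - c1 * Complex.exp (Complex.I * t))
      (fun t => Z' t - Complex.I * c1 * Complex.exp (Complex.I * t))
      (fun x => by
        have := ((hZ x).sub_const c0).sub ((dol_exp_deriv Complex.I x).const_mul c1)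
        rw [← mul_assoc, mul_comm c1] at this; exact this) (by fun_prop) θ hθ
    have h0 : ∫ x in (-π)..π, (Z x - c0 - c1 * Complex.exp (Complex.I * x)) = 0 := by
      rw [intervalIntegral.integral_sub (Continuous.intervalIntegrable (by fun_prop) _ _)
        (Continuous.intervalIntegrable (by fun_prop) _ _),
        intervalIntegral.integral_sub (Continuous.intervalIntegrable (by fun_prop) _ _)
        (Continuous.intervalIntegrable (by fun_prop) _ _), intervalIntegral.integral_const_mul, dol_int_exp,
        intervalIntegral.integral_const, hc0, Complex.real_smul, Complex.real_smul]
      have : (π : ℂ) ≠ 0 := by exact_mod_cast hp.ne'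
      push_cast
      field_simp; ring
    simp only [h0, smul_zero, sub_zero] at h
    exact h

theorem dol_trig_im (c0 c1 : ℂ) : ∫ θ in (-π)..π,
    ((c0 + c1 * Complex.exp (Complex.I * θ)) * Complex.exp (θ * Complex.I)).im ^ 2
      = π * (‖c0‖^2 + ‖c1‖^2) := by
  have h := dol_trig c0.re c0.im c1.re c1.im
  rw [Complex.sq_norm, Complex.sq_norm, Complex.normSq_apply, Complex.normSq_apply]
  rw [show π * (c0.re * c0.re + c0.im * c0.im + (c1.re * c1.re + c1.im * c1.im)) = 
    π * (c0.re ^ 2 + c0.im ^ 2 + c1.re ^ 2 + c1.im ^ 2) by ring, ← h]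
  congr 1; ext θ; congr 1
  rw [mul_comm Complex.I, Complex.exp_mul_I, ← Complex.ofReal_cos, ← Complex.ofReal_sin]
  simp [-Complex.ofReal_cos, -Complex.ofReal_sin]
  rw [Real.sin_two_mul, Real.cos_two_mul']
  ring

set_option maxHeartbeats 1000000 in
theorem dol_curve (ε1 : ℝ) (h0 : 0 < ε1) (h1 : ε1 ≤ 1) (Z Z' : ℝ → ℂ)
    (hZ : ∀ x, HasDerivAt Z (Z' x) x) (hZ' : Continuous Z') (hper : Z π = Z (-π)) :
    (∫ θ in (-π)..π, ((starRingEnd ℂ) (Z θ) * Z' θ).im) ≤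
      (1 - ε1 / 2000) * ∫ θ in (-π)..π, ‖Z' θ‖^2 * (1 + ε1 * dolW Z θ) := by
  have hp := pi_pos
  have hp3 := pi_gt_three
  have hp4 := pi_lt_d2
  have hZc : Continuous Z := continuous_iff_continuousAt.2 fun x => (hZ x).continuousAt
  obtain ⟨c0, c1, ϖ, hϖ, hϖ2, hIm, hR⟩ := dol_curve_fourier Z Z' hZ hZ' hper
  set Q := ∫ θ in (-π)..π, ‖Z' θ‖^2 with hQ
  set M := ∫ θ in (-π)..π, ((starRingEnd ℂ) (Z θ) * Z' θ).im
  set P := ∫ θ in (-π)..π, ‖Z' θ‖^2 * dolW Z θ with hP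
  have hi1 : IntervalIntegrable (fun θ => ‖Z' θ‖^2 * dolW Z θ) volume (-π) π :=
    dolW_int Z hZc _ (by fun_prop)
  have hi2 : IntervalIntegrable (fun θ => dolW Z θ) volume (-π) π := by
    simpa using dolW_int Z hZc (fun _ => 1) (by fun_prop)
  have hQP : ∫ θ in (-π)..π, ‖Z' θ‖^2 * (1 + ε1 * dolW Z θ) = Q + ε1 * P := by
    rw [hP, ← intervalIntegral.integral_const_mul, ← intervalIntegral.integral_add
      (Continuous.intervalIntegrable (by fun_prop) _ _) (hi1.const_mul _)]
    congr 1; ext θ; ring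
  rw [hQP]
  have hP0 : 0 ≤ P := intervalIntegral.integral_nonneg (by linarith)
    fun x _ => mul_nonneg (by positivity) (dolW_nonneg Z x)
  have hQ0 : 0 ≤ Q := intervalIntegral.integral_nonneg (by linarith) fun x _ => by positivity
  have hϖ0 : 0 ≤ ϖ := by
    rw [hϖ]; exact intervalIntegral.integral_nonneg (by linarith) fun x _ => by positivity
  have hprod : 0 ≤ ε1 * P := by positivity
  have hprod2 : 0 ≤ ε1 * (ε1 * P) := by positivity
  by_cases hcase : Q / 1000 ≤ ϖ
  · have : ε1 * (ε1 * P) ≤ 1 * (ε1 * P) := by gcongr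
    have : ε1 * Q ≤ 1 * Q := by gcongr
    nlinarith
  push Not at hcase
  by_cases hQ00 : Q = 0
  · linarith
  have hQpos : 0 < Q := lt_of_le_of_ne hQ0 (Ne.symm hQ00)
  set n1 := ‖c1‖^2 with hn1
  set n0 := ‖c0‖^2 with hn0
  have hn10 : 0 ≤ n1 := by positivity
  have hn00 : 0 ≤ n0 := by positivity
  have hn1pos : 0 < n1 := by
    by_contra hc
    have : n1 = 0 := le_antisymm (not_lt.1 hc) hn10
    rw [this] at hϖ2; linarith
  have hϖn : 2 * π * ϖ ≤ n1 / 12 := by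
    have : 999 * ϖ ≤ 2 * π * n1 := by linarith
    have hpp : π * π ≤ 3.15 * 3.15 := by gcongr <;> linarith
    have : 999 * ϖ * (2*π) ≤ 2 * π * n1 * (2*π) := by gcongr
    nlinarith
  set A : ℝ → ℝ := fun θ => ((c0 + c1 * Complex.exp (Complex.I * θ)) * Complex.exp (θ * Complex.I)).im ^ 2 with hA
  have hIA : ∫ θ in (-π)..π, A θ = π * (n0 + n1) := dol_trig_im c0 c1
  have hAc : Continuous A := by rw [hA]; fun_prop
  have hw : ∀ θ ∈ Set.Icc (-π) π, (A θ / 2 - n1 / 12) / (6 * (n0 + n1)) ≤ dolW Z θ := by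
    intro θ hθ
    have hr := (hR θ hθ).trans hϖn
    set r := Z θ - c0 - c1 * Complex.exp (Complex.I * θ) with hr_def
    have hZe : Z θ = (c0 + c1 * Complex.exp (Complex.I * θ)) + r := by rw [hr_def]; ring
    have hb := dol_im_sq_le (r * Complex.exp (θ * Complex.I))
    rw [norm_mul, dol_norm_exp, mul_one] at hb
    have hnum : A θ / 2 - n1 / 12 ≤ (Z θ * Complex.exp (θ * Complex.I)).im ^ 2 := by
      rw [hZe, add_mul, Complex.add_im]
      set α := ((c0 + c1 * Complex.exp (Complex.I * θ)) * Complex.exp (θ * Complex.I)).im with hα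
      have : A θ = α ^ 2 := rfl
      rw [this]
      nlinarith [sq_nonneg (α + 2 * (r * Complex.exp (θ * Complex.I)).im)]
    have hden : ‖Z θ‖^2 ≤ 6 * (n0 + n1) := by
      have h5 : ‖Z θ‖ ≤ ‖c0‖ + ‖c1‖ + ‖r‖ := by
        rw [hZe]
        refine (norm_add_le _ _).trans ?_
        gcongr
        refine (norm_add_le _ _).trans ?_
        rw [norm_mul, dol_norm_expI, mul_one]
      have h6 : ‖Z θ‖^2 ≤ (‖c0‖ + ‖c1‖ + ‖r‖)^2 := by gcongr
      nlinarith [sq_nonneg (‖c0‖ - ‖c1‖), sq_nonneg (‖c0‖ - ‖r‖), sq_nonneg (‖c1‖ - ‖r‖)]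
    unfold dolW
    by_cases hz : ‖Z θ‖^2 = 0
    · have hz' : Z θ = 0 := by simpa using hz
      rw [hz'] at hnum ⊢
      simp at hnum ⊢
      exact div_nonpos_of_nonpos_of_nonneg (by linarith) (by positivity)
    · have hz1 : 0 < ‖Z θ‖^2 := lt_of_le_of_ne (by positivity) (Ne.symm hz)
      rw [div_le_div_iff₀ (by positivity) hz1]
      have : (A θ / 2 - n1 / 12) * ‖Z θ‖^2 ≤ (Z θ * Complex.exp (θ * Complex.I)).im ^ 2 * ‖Z θ‖^2 := by gcongr
      refine this.trans ?_
      gcongr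
  have hIw : π / 18 ≤ ∫ θ in (-π)..π, dolW Z θ := by
    have h7 := intervalIntegral.integral_mono_on (by linarith : -π ≤ π)
      (Continuous.intervalIntegrable (by fun_prop) _ _) hi2 hw
    refine le_trans ?_ h7
    rw [intervalIntegral.integral_div, intervalIntegral.integral_sub
      (Continuous.intervalIntegrable (by fun_prop) _ _) (by simp), intervalIntegral.integral_div, hIA]
    simp only [intervalIntegral.integral_const, smul_eq_mul]
    rw [le_div_iff₀ (by positivity)]
    nlinarith
  have hPlow : n1 / 2 * (π / 18) - ϖ ≤ P := by
    have h8 : ∀ θ ∈ Set.Icc (-π) π, n1 / 2 * dolW Z θ - ‖Z' θ - Complex.I * c1 * Complex.exp (Complex.I * θ)‖^2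
        ≤ ‖Z' θ‖^2 * dolW Z θ := by
      intro θ _
      set r' := Z' θ - Complex.I * c1 * Complex.exp (Complex.I * θ) with hr'
      have h9 : ‖c1‖ ≤ ‖Z' θ‖ + ‖r'‖ := by
        have : ‖Complex.I * c1 * Complex.exp (Complex.I * θ)‖ = ‖c1‖ := by
          rw [norm_mul, norm_mul, dol_norm_expI, Complex.norm_I]; ring
        rw [← this, show Complex.I * c1 * Complex.exp (Complex.I * θ) = Z' θ - r' by rw [hr']; ring]
        exact norm_sub_le _ _
      have h10 : n1 ≤ (‖Z' θ‖ + ‖r'‖)^2 := by rw [hn1]; gcongr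
      have h11 : n1 / 2 ≤ ‖Z' θ‖^2 + ‖r'‖^2 := by nlinarith [sq_nonneg (‖Z' θ‖ - ‖r'‖)]
      have := mul_le_mul_of_nonneg_right h11 (dolW_nonneg Z θ)
      nlinarith [mul_le_mul_of_nonneg_left (dolW_le_one Z θ) (sq_nonneg ‖r'‖)]
    have h7 := intervalIntegral.integral_mono_on (by linarith : -π ≤ π)
      ((hi2.const_mul _).sub (Continuous.intervalIntegrable (by fun_prop) _ _)) hi1 h8
    rw [intervalIntegral.integral_sub (hi2.const_mul _) (Continuous.intervalIntegrable (by fun_prop) _ _),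
      intervalIntegral.integral_const_mul, ← hϖ] at h7
    have := mul_le_mul_of_nonneg_left hIw (by positivity : 0 ≤ n1 / 2)
    linarith
  have hPQ : Q / 100 ≤ P := by nlinarith
  have : ε1 * (Q / 100) ≤ ε1 * P := by gcongr
  have : ε1 * (ε1 * P) ≤ 1 * (ε1 * P) := by gcongr
  have : 0 ≤ ε1 * Q := by positivity
  nlinarith

theorem dol_quad (A B k a b : ℝ) (hA : 0 ≤ A) (hB : 0 ≤ B) (hk : 2 * k^2 ≤ A * B) :
    0 ≤ 0.71 * (A * a^2 + B * b^2) + 2 * k * (a * b) := by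
  have h0 : 0 ≤ 0.71 * (A * a^2 + B * b^2) := by positivity
  have : |2 * k * (a * b)| ≤ 0.71 * (A * a^2 + B * b^2) := by
    apply abs_le_of_sq_le_sq _ h0
    have h1 : 2 * k^2 * (a*b)^2 ≤ A * B * (a*b)^2 := by gcongr
    nlinarith [sq_nonneg (A * a^2 - B * b^2), mul_nonneg (mul_nonneg hA hB) (sq_nonneg (a*b)),
      sq_nonneg (A * a^2 + B * b^2)]
  linarith [neg_abs_le (2 * k * (a * b))]

def dolEps (q : ℝ) : ℝ := 0.29 * (q - 1) / q^2

set_option maxHeartbeats 1000000 in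
theorem dol_key (q θ a b c s : ℝ) (hq : 1 < q) (h1 : 1 ≤ θ) (h2 : θ ≤ q) (hcs : c^2 + s^2 = 1) :
    θ^2 * (a*c + b*s)^2 + (b*c - q*a*s)^2 ≤ (q - dolEps q * c^2) * θ * (q * a^2 + b^2) := by
  obtain ⟨x, hx⟩ : ∃ x, x = θ - 1 := ⟨_, rfl⟩
  obtain ⟨y, hy⟩ : ∃ y, y = q - θ := ⟨_, rfl⟩
  have hx0 : 0 ≤ x := by linarith
  have hy0 : 0 ≤ y := by linarith
  have hc0 : 0 ≤ c^2 := sq_nonneg c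
  have hc1 : c^2 ≤ 1 := by nlinarith [sq_nonneg s]
  set A := q^2 * x + c^2 * y * (q + θ) with hA
  set B' := θ * y + c^2 * x * (θ + 1) with hB
  have hA0 : 0 ≤ A := by positivity
  have hB0 : 0 ≤ B' := by positivity
  have hAc : c^2 * (q - 1) ≤ A := by
    have e1 : c^2 * x ≤ q^2 * x := mul_le_mul_of_nonneg_right (by nlinarith) hx0
    have e2 : c^2 * y * 1 ≤ c^2 * y * (q + θ) := by gcongr; linarith
    nlinarith
  have hBc : c^2 * (q - 1) ≤ B' := by
    have e1 : c^2 * y ≤ θ * y := by gcongr; linarith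
    have e2 : c^2 * x * 1 ≤ c^2 * x * (θ + 1) := by gcongr; linarith
    nlinarith
  have hk : 2 * (c * s * (y - θ * x))^2 ≤ A * B' := by
    have e0 : 2 * (c * s * (y - θ * x))^2 ≤ 2 * c^2 * (y^2 + θ^2 * x^2) := by
      have i1 : (y - θ * x)^2 ≤ y^2 + θ^2 * x^2 := by nlinarith [mul_nonneg hy0 (mul_nonneg (by linarith : 0 ≤ θ) hx0)]
      have i2 : s^2 * (y - θ*x)^2 ≤ 1 * (y^2 + θ^2 * x^2) := by
        apply mul_le_mul _ i1 (sq_nonneg _) zero_le_one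
        nlinarith
      nlinarith
    have e1 : 2 * c^2 * (y^2) ≤ c^2 * y^2 * (θ * (q + θ)) := by
      have : 2 ≤ θ * (q + θ) := by nlinarith
      have := mul_le_mul_of_nonneg_left this (by positivity : 0 ≤ c^2 * y^2)
      linarith
    have e2 : 2 * c^2 * (θ^2 * x^2) ≤ c^2 * x^2 * (q^2 * (θ+1)) := by
      have i3 : θ^2 * 2 ≤ q^2 * (θ+1) := by gcongr; linarith
      have := mul_le_mul_of_nonneg_left i3 (by positivity : 0 ≤ c^2 * x^2)
      linarith
    have e3 : A * B' = q^2*θ*(x*y) + c^2 * x^2 * (q^2 * (θ+1)) + c^2 * y^2 * (θ * (q + θ))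
        + c^2 * c^2 * (x*y) * ((q+θ) * (θ+1)) := by rw [hA, hB]; ring
    have e4 : 0 ≤ q^2*θ*(x*y) := by positivity
    have e5 : 0 ≤ c^2 * c^2 * (x*y) * ((q+θ) * (θ+1)) := by positivity
    linarith
  have hQ := dol_quad A B' _ a b hA0 hB0 hk
  have hid : q * θ * (q * a^2 + b^2) - (θ^2 * (a*c + b*s)^2 + (b*c - q*a*s)^2) =
      A * a^2 + B' * b^2 + 2 * (c * s * (y - θ * x)) * (a * b) := by
    have hs : s^2 = 1 - c^2 := by linarith
    rw [hA, hB, hx, hy]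
    linear_combination ((-θ^2) * b^2 - q^2*a^2) * hs
  have hε : dolEps q * c^2 * θ * (q * a^2 + b^2) ≤ 0.29 * (A * a^2 + B' * b^2) := by
    have i1 : dolEps q * θ * (q * a^2 + b^2) ≤ 0.29 * (q-1) * (a^2 + b^2) := by
      have j1 : 0 ≤ dolEps q := by unfold dolEps; apply div_nonneg <;> nlinarith
      have j2 : dolEps q * q^2 = 0.29 * (q-1) := by unfold dolEps; field_simp
      have j3 : dolEps q * θ * (q * a^2 + b^2) ≤ dolEps q * q * (q * a^2 + q * b^2) := by
        gcongr; nlinarith [sq_nonneg b]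
      have j4 : dolEps q * q * (q * a^2 + q * b^2) = (dolEps q * q^2) * (a^2+b^2) := by ring
      rw [j4, j2] at j3; exact j3
    have := mul_le_mul_of_nonneg_left i1 hc0
    have k1 := mul_le_mul_of_nonneg_right hAc (sq_nonneg a)
    have k2 := mul_le_mul_of_nonneg_right hBc (sq_nonneg b)
    linarith
  linarith

theorem dolEps_pos (q : ℝ) (hq : 1 < q) : 0 < dolEps q := by
  unfold dolEps; apply div_pos <;> nlinarith
theorem dolEps_le (q : ℝ) (hq : 1 < q) : dolEps q ≤ 1 := by
  unfold dolEps; rw [div_le_one (by positivity)]; nlinarith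

set_option maxHeartbeats 1000000 in
/-- pointwise inequality in the frame -/
theorem dol_frame (q θ a b τ c s y z κ : ℝ) (hq : 1 < q) (h1 : 1 ≤ θ) (h2 : θ ≤ q)
    (hcs : c^2 + s^2 = 1) (hy : 0 ≤ y) (hy1 : y ≤ 1) (hz : 0 ≤ z) (hz1 : z ≤ 1) (hκ : 0 < κ) :
    ((y*θ + z)^2 * (a*c + b*s)^2 + y^2 * (b*c + (τ - q*a)*s)^2) * (1 + dolEps q / q * c^2)
    ≤ (1+κ) * q * (y * (y*θ+z)) * (q*a^2+b^2) + 2 * (1+1/κ) * (y * (y*θ+z)) * τ^2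
      + 2 * (2*q+1) * z * (q*a^2+b^2) := by
  have hε := dolEps_pos q hq
  have hε1 := dolEps_le q hq
  set ε := dolEps q with hεd
  have hkey := dol_key q θ a b c s hq h1 h2 hcs
  rw [← hεd] at hkey
  have hc0 : 0 ≤ c^2 := sq_nonneg c
  have hc1 : c^2 ≤ 1 := by nlinarith [sq_nonneg s]
  have hs1 : s^2 ≤ 1 := by nlinarith [sq_nonneg c]
  set J := q*a^2+b^2 with hJ
  have hJ0 : 0 ≤ J := by positivity
  set U := (a*c+b*s)^2 with hU
  set V := b*c - q*a*s with hV
  have hU0 : 0 ≤ U := sq_nonneg _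
  have hUJ : U ≤ J := by
    have : U ≤ a^2 + b^2 := by
      have := sq_nonneg (a*s - b*c)
      have e : (a^2+b^2)*(c^2+s^2) = (a*c+b*s)^2 + (a*s-b*c)^2 := by ring
      rw [hcs] at e; linarith
    nlinarith [sq_nonneg a]
  have e1 : (y*θ+z)^2 ≤ y^2 * θ^2 + (2*q+1) * z := by
    have i1 : y*θ*z ≤ 1 * q * z := by gcongr
    nlinarith
  have e2 : (b*c + (τ - q*a)*s)^2 ≤ (1+κ) * V^2 + (1+1/κ) * τ^2 := by
    have : b*c + (τ - q*a)*s = V + τ * s := by rw [hV]; ring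
    rw [this]
    have i1 : (V + τ*s)^2 ≤ (1+κ) * V^2 + (1+1/κ) * (τ*s)^2 := by
      have j : 0 ≤ (κ * V - τ*s)^2 / κ := by positivity
      have : (κ * V - τ*s)^2 / κ = κ * V^2 - 2 * V * (τ*s) + (1/κ) * (τ*s)^2 := by field_simp; ring
      nlinarith
    have i2 : (τ*s)^2 ≤ τ^2 := by rw [mul_pow]; nlinarith [sq_nonneg τ]
    have i3 := mul_le_mul_of_nonneg_left i2 (by positivity : 0 ≤ 1 + 1/κ)
    linarith
  have hE : 0 ≤ 1 + ε / q * c^2 := by positivity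
  have hE2 : 1 + ε / q * c^2 ≤ 2 := by
    have : ε / q ≤ 1 := by rw [div_le_one (by linarith)]; linarith
    nlinarith
  have hE3 : (q - ε * c^2) * (1 + ε / q * c^2) ≤ q := by
    have : (q - ε * c^2) * (1 + ε / q * c^2) = q - (ε * c^2)^2 / q := by field_simp; ring
    rw [this]; have : 0 ≤ (ε * c^2)^2 / q := by positivity
    linarith
  have e3 : (y*θ + z)^2 * U + y^2 * (b*c + (τ - q*a)*s)^2 ≤ 
     (1+κ) * y^2 * ((q - ε * c^2) * θ * J) + (1+1/κ) * y^2 * τ^2 + (2*q+1) * z * J := by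
    have i1 := mul_le_mul_of_nonneg_right e1 hU0
    have i2 := mul_le_mul_of_nonneg_left e2 (sq_nonneg y)
    have i3 := mul_le_mul_of_nonneg_left hkey (by positivity : 0 ≤ (1+κ) * y^2)
    have i4 := mul_le_mul_of_nonneg_left hUJ (by positivity : 0 ≤ (2*q+1)*z)
    have i5 : 0 ≤ κ * (y^2 * (θ^2 * U)) := by positivity
    linarith
  have hyP : y^2 * θ ≤ y * (y*θ+z) := by nlinarith
  have hyP2 : y^2 ≤ y * (y*θ+z) := by
    have : y^2 * 1 ≤ y^2 * θ := by gcongr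
    linarith
  refine (mul_le_mul_of_nonneg_right e3 hE).trans ?_
  have f1 : (1+κ) * y^2 * ((q - ε * c^2) * θ * J) * (1 + ε / q * c^2) ≤ (1+κ) * q * (y * (y*θ+z)) * J := by
    have i1 := mul_le_mul_of_nonneg_left hE3 (by positivity : 0 ≤ (1+κ) * (y^2*θ) * J)
    have i2 := mul_le_mul_of_nonneg_left hyP (by positivity : 0 ≤ (1+κ) * q * J)
    linarith
  have f2 : (1+1/κ) * y^2 * τ^2 * (1 + ε / q * c^2) ≤ 2 * (1+1/κ) * (y * (y*θ+z)) * τ^2 := by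
    have i1 := mul_le_mul_of_nonneg_left hE2 (by positivity : 0 ≤ (1+1/κ) * y^2 * τ^2)
    have i2 := mul_le_mul_of_nonneg_left hyP2 (by positivity : 0 ≤ 2 * (1+1/κ) * τ^2)
    linarith
  have f3 : (2*q+1) * z * J * (1 + ε / q * c^2) ≤ 2 * (2*q+1) * z * J := by
    have i1 := mul_le_mul_of_nonneg_left hE2 (by positivity : 0 ≤ (2*q+1) * z * J)
    linarith
  rw [add_mul, add_mul]
  linarith

theorem dol_sT_deriv_bound : ∃ K : ℝ, 0 < K ∧ ∀ x, deriv smoothTransition x ≤ K := by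
  have hc : Continuous (deriv smoothTransition) :=
    (smoothTransition.contDiff (n := 1)).continuous_deriv (by simp)
  obtain ⟨K, hK⟩ := (isCompact_Icc (a := (-1:ℝ)) (b := 2)).exists_bound_of_continuousOn hc.continuousOn
  refine ⟨|K| + 1, by positivity, fun x => ?_⟩
  by_cases hx : x ∈ Set.Icc (-1:ℝ) 2
  · have := hK x hx
    rw [Real.norm_eq_abs] at this
    linarith [le_abs_self (deriv smoothTransition x), le_abs_self K]
  · have : deriv smoothTransition x = 0 := by
      rw [Set.mem_Icc, not_and_or] at hx
      rcases hx with hx | hx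
      · have : smoothTransition =ᶠ[nhds x] fun _ => 0 := by
          filter_upwards [Iio_mem_nhds (show x < 0 by linarith)] with y hy
          exact smoothTransition.zero_of_nonpos (le_of_lt hy)
        rw [this.deriv_eq]; simp
      · have : smoothTransition =ᶠ[nhds x] fun _ => 1 := by
          filter_upwards [Ioi_mem_nhds (show 1 < x by linarith)] with y hy
          exact smoothTransition.one_of_one_le (le_of_lt hy)
        rw [this.deriv_eq]; simp
    rw [this]; positivity

def dolK : ℝ := Classical.choose dol_sT_deriv_bound
theorem dolK_pos : 0 < dolK := (Classical.choose_spec dol_sT_deriv_bound).1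
theorem dolK_le (x : ℝ) : deriv smoothTransition x ≤ dolK := (Classical.choose_spec dol_sT_deriv_bound).2 x

def dolX (t x : ℝ) : ℝ := max x (t / 2)
def dolL (t ι x : ℝ) : ℝ := ι * log (dolX t x / t)
def dolY (t ι x : ℝ) : ℝ := smoothTransition (dolL t ι x)
def dolZ (t ι x : ℝ) : ℝ := 2 * ι * deriv smoothTransition (dolL t ι x)
def dolG (q s t x : ℝ) : ℝ := (dolX t x / (s^2 + dolX t x)) ^ ((q-1)/2)
def dolH (q s t x : ℝ) : ℝ := 1 + (q-1) * s^2 / (s^2 + dolX t x)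
def dolT (q s t ι x : ℝ) : ℝ := dolY t ι x * dolG q s t x
/-- derivative of `dolT` -/
def dolTd (q s t ι x : ℝ) : ℝ :=
  dolG q s t x * (dolY t ι x * (dolH q s t x - 1) + dolZ t ι x) / (2 * dolX t x)
/-- weight -/
def dolw (q s t ι x : ℝ) : ℝ :=
  dolG q s t x ^ 2 * (dolY t ι x * (dolY t ι x * dolH q s t x + dolZ t ι x))

section
variable {q s t ι : ℝ} (hq : 1 < q) (hs : 0 < s) (ht : 0 < t) (hι : 0 < ι)

theorem dolX_pos (ht : 0 < t) (x : ℝ) : 0 < dolX t x := lt_max_of_lt_right (by linarith)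
theorem dolX_cont (t : ℝ) : Continuous (dolX t) := by unfold dolX; fun_prop

theorem dolL_cont (ht : 0 < t) : Continuous (dolL t ι) := by
  unfold dolL
  refine continuous_const.mul (Continuous.log ((dolX_cont t).div_const _) fun x => ?_)
  have := dolX_pos ht x; positivity
theorem dolY_cont (ht : 0 < t) : Continuous (dolY t ι) :=
  smoothTransition.continuous.comp (dolL_cont ht)
theorem dolZ_cont (ht : 0 < t) : Continuous (dolZ t ι) := by
  have hc : Continuous (deriv smoothTransition) :=
    (smoothTransition.contDiff (n := 1)).continuous_deriv (by simp)
  exact continuous_const.mul (hc.comp (dolL_cont ht))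
theorem dolG_cont (hs : 0 < s) (ht : 0 < t) : Continuous (dolG q s t) := by
  unfold dolG
  refine Continuous.rpow_const ((dolX_cont t).div (by have := dolX_cont t; fun_prop) fun x => ?_) fun x => Or.inl ?_
  · have := dolX_pos ht x; positivity
  · have := dolX_pos ht x; positivity
theorem dolH_cont (hs : 0 < s) (ht : 0 < t) : Continuous (dolH q s t) := by
  unfold dolH
  refine continuous_const.add (continuous_const.div (by have := dolX_cont t; fun_prop) fun x => ?_)
  have := dolX_pos ht x; positivity
theorem dolw_cont (hs : 0 < s) (ht : 0 < t) : Continuous (dolw q s t ι) := by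
  have := dolG_cont (q := q) hs ht
  have := dolH_cont (q := q) hs ht
  have := dolY_cont (ι := ι) ht
  have := dolZ_cont (ι := ι) ht
  unfold dolw; fun_prop

theorem dolY_nonneg (x : ℝ) : 0 ≤ dolY t ι x := smoothTransition.nonneg _
theorem dolY_le (x : ℝ) : dolY t ι x ≤ 1 := smoothTransition.le_one _
theorem dolZ_nonneg (hι : 0 < ι) (x : ℝ) : 0 ≤ dolZ t ι x := by
  unfold dolZ
  have : 0 ≤ deriv smoothTransition (dolL t ι x) := smoothTransition.monotone.deriv_nonneg
  positivity
theorem dolZ_le (hι : 0 < ι) (x : ℝ) : dolZ t ι x ≤ 2 * ι * dolK := by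
  unfold dolZ; gcongr; exact dolK_le _
theorem dolG_pos (hs : 0 < s) (ht : 0 < t) (x : ℝ) : 0 < dolG q s t x := by
  have := dolX_pos ht x
  unfold dolG; positivity
theorem dolG_le (hq : 1 < q) (hs : 0 < s) (ht : 0 < t) (x : ℝ) : dolG q s t x ≤ 1 := by
  have := dolX_pos ht x
  unfold dolG
  apply rpow_le_one (by positivity) _ (by linarith)
  rw [div_le_one (by positivity)]; nlinarith
theorem dolH_ge (hq : 1 < q) (ht : 0 < t) (x : ℝ) : 1 ≤ dolH q s t x := by
  have := dolX_pos ht x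
  unfold dolH
  have : 0 ≤ (q-1) * s^2 / (s^2 + dolX t x) := div_nonneg (mul_nonneg (by linarith) (by positivity)) (by positivity)
  linarith
theorem dolH_le (hq : 1 < q) (hs : 0 < s) (ht : 0 < t) (x : ℝ) : dolH q s t x ≤ q := by
  have := dolX_pos ht x
  unfold dolH
  have : (q-1) * s^2 / (s^2 + dolX t x) ≤ q - 1 := by
    rw [div_le_iff₀ (by positivity)]
    have : 0 ≤ (q-1) * dolX t x := mul_nonneg (by linarith) this.le
    linarith
  linarith
theorem dolL_nonpos (ht : 0 < t) (hι : 0 < ι) {x : ℝ} (hx : x ≤ t) : dolL t ι x ≤ 0 := by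
  have h := dolX_pos ht x
  unfold dolL
  apply mul_nonpos_of_nonneg_of_nonpos hι.le
  apply log_nonpos (by positivity)
  rw [div_le_one ht]; unfold dolX; exact max_le hx (by linarith)
theorem dolY_zero (ht : 0 < t) (hι : 0 < ι) {x : ℝ} (hx : x ≤ t) : dolY t ι x = 0 :=
  smoothTransition.zero_of_nonpos (dolL_nonpos ht hι hx)
theorem dol_sTd_zero {x : ℝ} (hx : x ≤ 0) : deriv smoothTransition x = 0 := by
  -- minimum
  have : IsLocalMin smoothTransition x := by
    filter_upwards with y
    rw [smoothTransition.zero_of_nonpos hx]; exact smoothTransition.nonneg _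
  exact this.deriv_eq_zero
theorem dolZ_zero (ht : 0 < t) (hι : 0 < ι) {x : ℝ} (hx : x ≤ t) : dolZ t ι x = 0 := by
  unfold dolZ; rw [dol_sTd_zero (dolL_nonpos ht hι hx), mul_zero]
theorem dolY_one (ht : 0 < t) (hι : 0 < ι) {x : ℝ} (hx : t * exp (1/ι) ≤ x) : dolY t ι x = 1 := by
  apply smoothTransition.one_of_one_le
  have h1 : exp (1/ι) ≤ dolX t x / t := by
    rw [le_div_iff₀ ht]
    exact le_trans (by linarith) (le_max_left _ _)
  have h2 := log_le_log (exp_pos _) h1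
  rw [log_exp] at h2
  unfold dolL
  calc 1 = ι * (1/ι) := by field_simp
    _ ≤ _ := by gcongr

theorem dolT_zero (ht : 0 < t) (hι : 0 < ι) {x : ℝ} (hx : x ≤ t) : dolT q s t ι x = 0 := by
  unfold dolT; rw [dolY_zero ht hι hx, zero_mul]

theorem dolT_hasDerivAt (hs : 0 < s) (ht : 0 < t) (hι : 0 < ι) (x : ℝ) :
    HasDerivAt (dolT q s t ι) (dolTd q s t ι x) x := by
  rcases lt_or_ge x t with hx | hx
  · have : dolT q s t ι =ᶠ[nhds x] fun _ => 0 := by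
      filter_upwards [Iio_mem_nhds hx] with y hy
      exact dolT_zero ht hι (le_of_lt hy)
    have h0 : dolTd q s t ι x = 0 := by
      unfold dolTd; rw [dolY_zero ht hι hx.le, dolZ_zero ht hι hx.le]; simp
    rw [h0]
    exact (hasDerivAt_const x (0:ℝ)).congr_of_eventuallyEq this
  · have hx0 : 0 < x := by linarith
    have hxx : dolX t x = x := max_eq_left (by linarith)
    have he : ∀ᶠ y in nhds x, dolX t y = y := by
      filter_upwards [Ioi_mem_nhds (show t/2 < x by linarith)] with y hy
      exact max_eq_left (le_of_lt hy)
    have h1 : HasDerivAt (dolY t ι) (dolZ t ι x / (2 * x)) x := by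
      have e1 : dolY t ι =ᶠ[nhds x] fun y => smoothTransition (ι * log (y / t)) := by
        filter_upwards [he] with y hy
        unfold dolY dolL; rw [hy]
      have hl : HasDerivAt (fun y => ι * log (y/t)) (ι * ((1/t) / (x/t))) x :=
        (((hasDerivAt_id x).div_const t).log (by simp; constructor <;> positivity)).const_mul ι
      have hst : HasDerivAt smoothTransition (deriv smoothTransition (ι * log (x/t))) (ι * log (x/t)) :=
        ((smoothTransition.contDiff (n := 1)).differentiable (by simp) _).hasDerivAt
      have := (hst.comp x hl).congr_of_eventuallyEq e1
      refine this.congr_deriv ?_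
      unfold dolZ dolL; rw [hxx]; field_simp
    have h2 : HasDerivAt (dolG q s t) (dolG q s t x * (dolH q s t x - 1) / (2*x)) x := by
      have e1 : dolG q s t =ᶠ[nhds x] fun y => (y / (s^2 + y)) ^ ((q-1)/2) := by
        filter_upwards [he] with y hy
        unfold dolG; rw [hy]
      have hd : HasDerivAt (fun y => y / (s^2+y)) ((1 * (s^2 + x) - x * 1) / (s^2 + x)^2) x :=
        (hasDerivAt_id x).div ((hasDerivAt_id x).const_add (s^2)) (by simp; positivity)
      have := (hd.rpow_const (p := (q-1)/2) (Or.inl (by positivity))).congr_of_eventuallyEq e1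
      refine this.congr_deriv ?_
      unfold dolG dolH; rw [hxx, rpow_sub_one (by positivity)]; field_simp; ring
    have := h1.mul h2
    refine this.congr_deriv ?_
    unfold dolTd; rw [hxx]; field_simp; ring

theorem dolT_contDiff (hs : 0 < s) (ht : 0 < t) (hι : 0 < ι) : ContDiff ℝ 2 (dolT q s t ι) := by
  rw [contDiff_iff_contDiffAt]
  intro x
  rcases lt_or_ge x t with hx | hx
  · have : dolT q s t ι =ᶠ[nhds x] fun _ => 0 := by
      filter_upwards [Iio_mem_nhds hx] with y hy
      exact dolT_zero ht hι (le_of_lt hy)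
    exact contDiffAt_const.congr_of_eventuallyEq this
  · have hx0 : 0 < x := by linarith
    have he : ∀ᶠ y in nhds x, dolX t y = y := by
      filter_upwards [Ioi_mem_nhds (show t/2 < x by linarith)] with y hy
      exact max_eq_left (le_of_lt hy)
    have e1 : dolT q s t ι =ᶠ[nhds x] fun y => smoothTransition (ι * log (y / t)) * (y / (s^2 + y)) ^ ((q-1)/2) := by
      filter_upwards [he] with y hy
      unfold dolT dolY dolL dolG; rw [hy]
    refine ContDiffAt.congr_of_eventuallyEq ?_ e1
    apply ContDiffAt.mul
    · apply (smoothTransition.contDiff (n := 2)).contDiffAt.comp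
      exact contDiffAt_const.mul (ContDiffAt.log (contDiffAt_id.div_const _) (by simp; constructor <;> positivity))
    · exact ContDiffAt.rpow_const_of_ne (contDiffAt_id.div (contDiffAt_const.add contDiffAt_id) (by simp; positivity)) (by simp; constructor <;> positivity)

theorem dolTd_cont (hs : 0 < s) (ht : 0 < t) : Continuous (dolTd q s t ι) := by
  have := dolG_cont (q := q) hs ht
  have := dolH_cont (q := q) hs ht
  have := dolY_cont (ι := ι) ht
  have := dolZ_cont (ι := ι) ht
  have h := dolX_cont t
  unfold dolTd
  refine Continuous.div (by fun_prop) (by fun_prop) fun x => ?_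
  have := dolX_pos ht x; positivity
end

theorem dol_swap (F : ℝ × ℝ → ℝ) (hF : Continuous F) (a b c d : ℝ) :
    ∫ x in a..b, ∫ y in c..d, F (x, y) = ∫ y in c..d, ∫ x in a..b, F (x, y) := by
  apply intervalIntegral_intervalIntegral_swap (F := fun x y => F (x, y))
  have : IntegrableOn F (Set.uIcc a b ×ˢ Set.uIcc c d) (volume.prod volume) :=
    hF.continuousOn.integrableOn_compact (isCompact_uIcc.prod isCompact_uIcc)
  exact this.mono_set (Set.prod_mono Set.uIoc_subset_uIcc Set.uIoc_subset_uIcc)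

theorem dol_par_cont (F : ℝ × ℝ → ℝ) (hF : Continuous F) (c d : ℝ) :
    Continuous (fun x => ∫ y in c..d, F (x, y)) :=
  intervalIntegral.continuous_parametric_intervalIntegral_of_continuous' (f := fun x y => F (x,y)) 
   (by simpa [Function.uncurry_def] using hF) _ _

theorem dol_dr (u : ℝ × ℝ → ℝ) (hu : Differentiable ℝ u) (r θ : ℝ) :
    HasDerivAt (fun r => u (r, θ)) (fderiv ℝ u (r, θ) (1, 0)) r := by
  have h1 : HasDerivAt (fun r : ℝ => (r, θ)) (1, 0) r := (hasDerivAt_id r).prodMk (hasDerivAt_const r θ)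
  exact (hu (r, θ)).hasFDerivAt.comp_hasDerivAt r h1
theorem dol_dth (u : ℝ × ℝ → ℝ) (hu : Differentiable ℝ u) (r θ : ℝ) :
    HasDerivAt (fun θ => u (r, θ)) (fderiv ℝ u (r, θ) (0, 1)) θ := by
  have h1 : HasDerivAt (fun θ : ℝ => (r, θ)) (0, 1) θ := (hasDerivAt_const θ r).prodMk (hasDerivAt_id θ)
  exact (hu (r, θ)).hasFDerivAt.comp_hasDerivAt θ h1

theorem dol_stokes (u w : ℝ × ℝ → ℝ) (hu : ContDiff ℝ 2 u) (hw : ContDiff ℝ 2 w)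
    (pu : ∀ r, u (r, π) = u (r, -π)) (pw : ∀ r, w (r, π) = w (r, -π))
    (ur ut wr wt : ℝ × ℝ → ℝ)
    (hur : ∀ r θ, HasDerivAt (fun r => u (r, θ)) (ur (r, θ)) r)
    (hut : ∀ r θ, HasDerivAt (fun θ => u (r, θ)) (ut (r, θ)) θ)
    (hwr : ∀ r θ, HasDerivAt (fun r => w (r, θ)) (wr (r, θ)) r)
    (hwt : ∀ r θ, HasDerivAt (fun θ => w (r, θ)) (wt (r, θ)) θ) (R : ℝ) :
    (∫ θ in (-π)..π, (w (R, θ) * ut (R, θ) - u (R, θ) * wt (R, θ)))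
     - (∫ θ in (-π)..π, (w (0, θ) * ut (0, θ) - u (0, θ) * wt (0, θ)))
    = ∫ r in (0:ℝ)..R, ∫ θ in (-π)..π, 2 * (wr (r, θ) * ut (r, θ) - ur (r, θ) * wt (r, θ)) := by
  have hud : Differentiable ℝ u := hu.differentiable (by simp)
  have hwd : Differentiable ℝ w := hw.differentiable (by simp)
  have eur : ur = fun p => fderiv ℝ u p (1, 0) := by
    ext ⟨r, θ⟩; exact (hur r θ).unique (dol_dr u hud r θ)
  have eut : ut = fun p => fderiv ℝ u p (0, 1) := by
    ext ⟨r, θ⟩; exact (hut r θ).unique (dol_dth u hud r θ)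
  have ewr : wr = fun p => fderiv ℝ w p (1, 0) := by
    ext ⟨r, θ⟩; exact (hwr r θ).unique (dol_dr w hwd r θ)
  have ewt : wt = fun p => fderiv ℝ w p (0, 1) := by
    ext ⟨r, θ⟩; exact (hwt r θ).unique (dol_dth w hwd r θ)
  have hu1 : ContDiff ℝ 1 (fderiv ℝ u) := hu.fderiv_right (by norm_num)
  have hw1 : ContDiff ℝ 1 (fderiv ℝ w) := hw.fderiv_right (by norm_num)
  have cur : ContDiff ℝ 1 ur := by rw [eur]; exact hu1.clm_apply contDiff_const
  have cut : ContDiff ℝ 1 ut := by rw [eut]; exact hu1.clm_apply contDiff_const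
  have cwr : ContDiff ℝ 1 wr := by rw [ewr]; exact hw1.clm_apply contDiff_const
  have cwt : ContDiff ℝ 1 wt := by rw [ewt]; exact hw1.clm_apply contDiff_const
  have mixed : ∀ (v : ℝ × ℝ → ℝ), ContDiff ℝ 2 v → ∀ p, 
      fderiv ℝ (fun p => fderiv ℝ v p (0, 1)) p (1, 0) = fderiv ℝ (fun p => fderiv ℝ v p (1, 0)) p (0, 1) := by
    intro v hv p
    have hv1 : ContDiff ℝ 1 (fderiv ℝ v) := hv.fderiv_right (by norm_num)
    have hd := (hv1.differentiable (by simp)) p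
    have hsym : IsSymmSndFDerivAt ℝ v p := hv.contDiffAt.isSymmSndFDerivAt (by simp)
    rw [fderiv_clm_apply hd (by fun_prop), fderiv_clm_apply hd (by fun_prop)]
    simp
    exact hsym _ _
  have mu := mixed u hu
  have mw := mixed w hw
  rw [← eur, ← eut] at mu
  rw [← ewr, ← ewt] at mw
  have d1 : ∀ r θ, HasDerivAt (fun r => w (r, θ) * ut (r, θ) - u (r, θ) * wt (r, θ))
      (wr (r, θ) * ut (r, θ) + w (r, θ) * fderiv ℝ ut (r, θ) (1, 0)
        - (ur (r, θ) * wt (r, θ) + u (r, θ) * fderiv ℝ wt (r, θ) (1, 0))) r := fun r θ =>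
    ((hwr r θ).mul (dol_dr ut (cut.differentiable (by simp)) r θ)).sub
      ((hur r θ).mul (dol_dr wt (cwt.differentiable (by simp)) r θ))
  have d2 : ∀ r θ, HasDerivAt (fun θ => w (r, θ) * ur (r, θ) - u (r, θ) * wr (r, θ))
      (wt (r, θ) * ur (r, θ) + w (r, θ) * fderiv ℝ ur (r, θ) (0, 1)
        - (ut (r, θ) * wr (r, θ) + u (r, θ) * fderiv ℝ wr (r, θ) (0, 1))) θ := fun r θ =>
    ((hwt r θ).mul (dol_dth ur (cur.differentiable (by simp)) r θ)).sub
      ((hut r θ).mul (dol_dth wr (cwr.differentiable (by simp)) r θ))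
  have c1 := hud.continuous
  have c2 := hwd.continuous
  have c3 := cur.continuous
  have c4 := cut.continuous
  have c5 := cwr.continuous
  have c6 := cwt.continuous
  have c7 : Continuous (fun p => fderiv ℝ ut p (1, 0)) := (cut.continuous_fderiv (by simp)).clm_apply continuous_const
  have c8 : Continuous (fun p => fderiv ℝ wt p (1, 0)) := (cwt.continuous_fderiv (by simp)).clm_apply continuous_const
  have c9 : Continuous (fun p => fderiv ℝ ur p (0, 1)) := (cur.continuous_fderiv (by simp)).clm_apply continuous_const
  have c10 : Continuous (fun p => fderiv ℝ wr p (0, 1)) := (cwr.continuous_fderiv (by simp)).clm_apply continuous_const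
  rw [← intervalIntegral.integral_sub (Continuous.intervalIntegrable (by fun_prop) _ _)
    (Continuous.intervalIntegrable (by fun_prop) _ _)]
  set D : ℝ × ℝ → ℝ := fun p => wr p * ut p + w p * fderiv ℝ ut p (1, 0)
        - (ur p * wt p + u p * fderiv ℝ wt p (1, 0)) with hD
  have cD : Continuous D := by rw [hD]; fun_prop
  have i1 : ∀ θ, (w (R, θ) * ut (R, θ) - u (R, θ) * wt (R, θ)) - (w (0, θ) * ut (0, θ) - u (0, θ) * wt (0, θ))
     = ∫ r in (0:ℝ)..R, D (r, θ) := fun θ => by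
    rw [intervalIntegral.integral_eq_sub_of_hasDerivAt (fun r _ => d1 r θ)]
    exact Continuous.intervalIntegrable (by fun_prop) _ _
  simp_rw [i1]
  rw [← dol_swap D cD]
  apply intervalIntegral.integral_congr
  intro r _
  show ∫ θ in (-π)..π, D (r, θ) = _
  have i2 : ∫ θ in (-π)..π, (wt (r, θ) * ur (r, θ) + w (r, θ) * fderiv ℝ ur (r, θ) (0, 1)
        - (ut (r, θ) * wr (r, θ) + u (r, θ) * fderiv ℝ wr (r, θ) (0, 1))) = 0 := by
    rw [intervalIntegral.integral_eq_sub_of_hasDerivAt (fun θ _ => d2 r θ)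
      (Continuous.intervalIntegrable (by fun_prop) _ _)]
    have e1 : ur (r, π) = ur (r, -π) := by
      have h := hur r π
      simp_rw [pu] at h
      exact h.unique (hur r (-π))
    have e2 : wr (r, π) = wr (r, -π) := by
      have h := hwr r π
      simp_rw [pw] at h
      exact h.unique (hwr r (-π))
    rw [e1, e2, pu, pw, sub_self]
  rw [← sub_zero (∫ θ in (-π)..π, D (r, θ)), ← i2, ← intervalIntegral.integral_sub
    (Continuous.intervalIntegrable (by fun_prop) _ _) (Continuous.intervalIntegrable (by fun_prop) _ _)]
  congr 1; ext θ
  simp only [hD, mu, mw]; ring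

def dolaN (f g A B C : ℝ) : ℝ := f^2*A + 2*f*g*B + g^2*C
def dolbN (f g A B C : ℝ) : ℝ := f*g*(C-A) + (f^2-g^2)*B
def dolJ (q m f g A B C : ℝ) : ℝ := (q * dolaN f g A B C^2 + dolbN f g A B C^2) / dolX m (f^2+g^2)^2
def dolTau (q m f g A B C : ℝ) : ℝ := A + C + (q-1) * dolaN f g A B C / dolX m (f^2+g^2)
def dolA (m f g A B C : ℝ) : ℝ := dolaN f g A B C / dolX m (f^2+g^2)
/-- derivative components of `Y = Θ(|F|²) F` given derivative `(df,dg)` of `F` -/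
def dolD1 (q s t ι f g df dg : ℝ) : ℝ :=
  dolT q s t ι (f^2+g^2) * df + dolTd q s t ι (f^2+g^2) * (2*(f*df+g*dg)) * f
def dolD2 (q s t ι f g df dg : ℝ) : ℝ :=
  dolT q s t ι (f^2+g^2) * dg + dolTd q s t ι (f^2+g^2) * (2*(f*df+g*dg)) * g

theorem dolJ_nonneg {q m : ℝ} (hq : 1 < q) (f g A B C : ℝ) : 0 ≤ dolJ q m f g A B C := by
  unfold dolJ; positivity

theorem dolA_sq_le {q m : ℝ} (hq : 1 < q) (f g A B C : ℝ) : dolA m f g A B C ^ 2 ≤ dolJ q m f g A B C := by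
  unfold dolJ dolA
  rw [div_pow]
  gcongr
  nlinarith [sq_nonneg (dolaN f g A B C), sq_nonneg (dolbN f g A B C)]

theorem dolw_nonneg {q s t ι : ℝ} (hq : 1 < q) (ht : 0 < t) (hι : 0 < ι) (x : ℝ) : 0 ≤ dolw q s t ι x := by
  have h1 := dolY_nonneg (t := t) (ι := ι) x
  have h2 := dolZ_nonneg (t := t) hι x
  have h3 := dolH_ge (s := s) hq ht x
  unfold dolw; positivity

theorem dolTd_zero {q s t ι : ℝ} (ht : 0 < t) (hι : 0 < ι) {x : ℝ} (hx : x ≤ t) : dolTd q s t ι x = 0 := by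
  unfold dolTd; rw [dolY_zero ht hι hx, dolZ_zero ht hι hx]; simp
theorem dolw_zero {q s t ι : ℝ} (ht : 0 < t) (hι : 0 < ι) {x : ℝ} (hx : x ≤ t) : dolw q s t ι x = 0 := by
  unfold dolw; rw [dolY_zero ht hι hx]; simp
theorem dolX_eq {t x : ℝ} (ht : 0 < t) (hx : t ≤ x) : dolX t x = x := max_eq_left (by linarith)

theorem dolT_add {q s t ι : ℝ} (ht : 0 < t) {x : ℝ} (hx : t ≤ x) :
    dolT q s t ι x + 2 * x * dolTd q s t ι x = dolG q s t x * (dolY t ι x * dolH q s t x + dolZ t ι x) := by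
  have hx0 : 0 < x := by linarith
  unfold dolT dolTd; rw [dolX_eq ht hx]; field_simp; ring

theorem dol_det {q s t ι m : ℝ} (hm : 0 < m) (hmt : m ≤ t) (hι : 0 < ι)
    (f g A B C r c0 s0 : ℝ) (hcs : c0^2 + s0^2 = 1) :
    dolD2 q s t ι f g (A*c0+B*s0) (B*c0+C*s0) * dolD1 q s t ι f g (r*(-A*s0+B*c0)) (r*(-B*s0+C*c0))
    - dolD1 q s t ι f g (A*c0+B*s0) (B*c0+C*s0) * dolD2 q s t ι f g (r*(-A*s0+B*c0)) (r*(-B*s0+C*c0))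
    = r * (dolw q s t ι (f^2+g^2) * (dolJ q m f g A B C - dolA m f g A B C * dolTau q m f g A B C)) := by
  have ht : 0 < t := by linarith
  rcases le_or_gt (f^2+g^2) t with hx | hx
  · unfold dolD1 dolD2
    rw [dolT_zero ht hι hx, dolTd_zero ht hι hx, dolw_zero ht hι hx]; ring
  · have h1 := dolT_add (q := q) (s := s) (ι := ι) ht hx.le
    have e1 : dolw q s t ι (f^2+g^2) = dolT q s t ι (f^2+g^2) * (dolT q s t ι (f^2+g^2) + 2 * (f^2+g^2) * dolTd q s t ι (f^2+g^2)) := by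
      rw [h1]; unfold dolw dolT; ring
    have e2 : dolJ q m f g A B C - dolA m f g A B C * dolTau q m f g A B C = B^2 - A*C := by
      unfold dolJ dolA dolTau
      rw [dolX_eq hm (by linarith)]
      have : f^2+g^2 ≠ 0 := by linarith
      field_simp
      unfold dolaN dolbN; ring
    rw [e1, e2]
    unfold dolD1 dolD2
    generalize dolT q s t ι (f^2+g^2) = T
    generalize dolTd q s t ι (f^2+g^2) = T'
    linear_combination (r * T * (T + 2 * (f^2+g^2) * T') * (B^2 - A*C)) * hcs

theorem dol_tang {q s t ι m κ : ℝ} (hq : 1 < q) (hs : 0 < s) (hm : 0 < m) (hmt : m ≤ t) (hι : 0 < ι)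
    (hιK : 2 * ι * dolK ≤ 1) (hκ : 0 < κ)
    (f g A B C r c0 s0 : ℝ) (hcs : c0^2 + s0^2 = 1) :
    ((dolD1 q s t ι f g (r*(-A*s0+B*c0)) (r*(-B*s0+C*c0)))^2 + (dolD2 q s t ι f g (r*(-A*s0+B*c0)) (r*(-B*s0+C*c0)))^2)
     * (1 + dolEps q / q * ((dolT q s t ι (f^2+g^2) * f * s0 - dolT q s t ι (f^2+g^2) * g * c0)^2 / 
          ((dolT q s t ι (f^2+g^2) * f)^2 + (dolT q s t ι (f^2+g^2) * g)^2)))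
    ≤ r^2 * ((1+κ) * q * (dolw q s t ι (f^2+g^2) * dolJ q m f g A B C)
        + 2 * (1+1/κ) * (dolw q s t ι (f^2+g^2) * dolTau q m f g A B C^2)
        + 2 * (2*q+1) * (dolG q s t (f^2+g^2)^2 * dolZ t ι (f^2+g^2) * dolJ q m f g A B C)) := by
  have ht : 0 < t := by linarith
  rcases le_or_gt (f^2+g^2) t with hx | hx
  · unfold dolD1 dolD2
    rw [dolT_zero ht hι hx, dolTd_zero ht hι hx, dolw_zero ht hι hx, dolZ_zero ht hι hx]; simp
  · have hX0 : 0 < f^2+g^2 := by linarith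
    set ρ := √(f^2+g^2) with hρ
    have hρ0 : 0 < ρ := sqrt_pos.2 hX0
    have hρ2 : ρ^2 = f^2+g^2 := sq_sqrt hX0.le
    obtain ⟨e1, he1⟩ : ∃ e1, e1 = f/ρ := ⟨_, rfl⟩
    obtain ⟨e2, he2⟩ : ∃ e2, e2 = g/ρ := ⟨_, rfl⟩
    have hf : f = ρ*e1 := by rw [he1]; field_simp
    have hg : g = ρ*e2 := by rw [he2]; field_simp
    have hN : e1^2+e2^2 = 1 := by rw [he1, he2]; field_simp; linarith
    set y := dolY t ι (f^2+g^2) with hy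
    set z := dolZ t ι (f^2+g^2) with hz
    set θ := dolH q s t (f^2+g^2) with hθ
    set G := dolG q s t (f^2+g^2) with hG
    have hy0 : 0 < y := by
      apply smoothTransition.pos_of_pos
      unfold dolL; rw [dolX_eq ht hx.le]
      apply mul_pos hι (log_pos _); rw [one_lt_div ht]; exact hx
    have hG0 : 0 < G := dolG_pos hs ht _
    set a := e1^2*A + 2*e1*e2*B + e2^2*C with ha
    set b := e1*e2*(C-A) + (e1^2-e2^2)*B with hb
    set τ := A + C + (q-1)*a with hτ
    have hXm : dolX m (f^2+g^2) = ρ^2 := by rw [hρ2]; exact dolX_eq hm (by linarith)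
    have haN : dolaN f g A B C = ρ^2*a := by unfold dolaN; rw [hf, hg, ha]; ring
    have hbN : dolbN f g A B C = ρ^2*b := by unfold dolbN; rw [hf, hg, hb]; ring
    have hJ : dolJ q m f g A B C = q*a^2+b^2 := by
      unfold dolJ; rw [hXm, haN, hbN]; field_simp
    have hT : dolTau q m f g A B C = τ := by
      unfold dolTau; rw [hXm, haN, hτ]; field_simp
    set c := -e1*s0 + e2*c0 with hc
    set sn := e2*s0 + e1*c0 with hsn
    have hcsn : c^2+sn^2 = 1 := by
      rw [hc, hsn]
      linear_combination (c0^2+s0^2)*hN + hcs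
    have hfr := dol_frame q θ a b τ c sn y z κ hq (dolH_ge hq ht _) (dolH_le hq hs ht _) hcsn hy0.le
      (dolY_le _) (dolZ_nonneg hι _) ((dolZ_le hι _).trans hιK) hκ
    have hTG : dolT q s t ι (f^2+g^2) = y*G := rfl
    have hTG2 : y*G + 2*ρ^2*dolTd q s t ι (f^2+g^2) = G*(y*θ+z) := by
      rw [hρ2, ← hTG]; exact dolT_add ht hx.le
    have hcc : (dolT q s t ι (f^2+g^2) * f * s0 - dolT q s t ι (f^2+g^2) * g * c0)^2 / 
          ((dolT q s t ι (f^2+g^2) * f)^2 + (dolT q s t ι (f^2+g^2) * g)^2) = c^2 := by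
      have : (dolT q s t ι (f^2+g^2) * f)^2 + (dolT q s t ι (f^2+g^2) * g)^2 = (y*G*ρ)^2 := by
        rw [hTG]; linear_combination (-(y*G)^2)*hρ2
      rw [this, hTG, hf, hg, hc]
      field_simp; ring
    rw [hcc, hJ, hT]
    have hw : dolw q s t ι (f^2+g^2) = G^2*(y*(y*θ+z)) := rfl
    have hnorm : (dolD1 q s t ι f g (r*(-A*s0+B*c0)) (r*(-B*s0+C*c0)))^2 + (dolD2 q s t ι f g (r*(-A*s0+B*c0)) (r*(-B*s0+C*c0)))^2
       = r^2 * (G^2 * ((y*θ + z)^2 * (a*c + b*sn)^2 + y^2 * (b*c + (τ - q*a)*sn)^2)) := by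
      have k1 : a*c+b*sn = e1*(-A*s0+B*c0) + e2*(-B*s0+C*c0) := by
        rw [ha, hb, hc, hsn]; linear_combination (e1*(-A*s0+B*c0) + e2*(-B*s0+C*c0))*hN
      have k2 : b*c+(τ-q*a)*sn = -e2*(-A*s0+B*c0) + e1*(-B*s0+C*c0) := by
        have : τ - q*a = e2^2*A - 2*e1*e2*B+e1^2*C := by
          rw [hτ, ha]; linear_combination (-A - C)*hN
        rw [this, hb, hc, hsn]; linear_combination (-e2*(-A*s0+B*c0) + e1*(-B*s0+C*c0))*hN
      rw [k1, k2]
      rw [show G^2 * ((y*θ + z)^2 * (e1*(-A*s0+B*c0) + e2*(-B*s0+C*c0))^2 + y^2 * (-e2*(-A*s0+B*c0) + e1*(-B*s0+C*c0))^2)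
        = (G*(y*θ + z))^2 * (e1*(-A*s0+B*c0) + e2*(-B*s0+C*c0))^2 + (y*G)^2 * (-e2*(-A*s0+B*c0) + e1*(-B*s0+C*c0))^2 by ring, ← hTG2]
      unfold dolD1 dolD2
      rw [hTG]
      generalize dolTd q s t ι (f^2+g^2) = T'
      rw [hf, hg]
      generalize -A*s0+B*c0 = h1
      generalize -B*s0+C*c0 = h2
      generalize y*G = T
      have hd : e2^2 = 1 - e1^2 := by linarith
      have hc3 : e1^2 = 1 - e2^2 := by linarith
      linear_combination (4*r^2*T'^2*ρ^4*(e1*h1+e2*h2)^2 - r^2*T^2*(h1^2+h2^2)) * hN 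
    rw [hnorm, hw]
    have := mul_le_mul_of_nonneg_left hfr (by positivity : 0 ≤ r^2 * G^2)
    refine le_trans (le_of_eq ?_) (this.trans (le_of_eq ?_)) <;> ring

/-- gradient field and Hessian entries in polar coordinates -/
structure DolPD where
  f : ℝ × ℝ → ℝ
  g : ℝ × ℝ → ℝ
  A : ℝ × ℝ → ℝ
  B' : ℝ × ℝ → ℝ
  C : ℝ × ℝ → ℝ
  hf : ContDiff ℝ 2 f
  hg : ContDiff ℝ 2 g
  hA : Continuous A
  hB : Continuous B'
  hC : Continuous C
  fr : ∀ r θ, HasDerivAt (fun r => f (r, θ)) (A (r, θ) * cos θ + B' (r, θ) * sin θ) r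
  ft : ∀ r θ, HasDerivAt (fun θ => f (r, θ)) (r * (-A (r, θ) * sin θ + B' (r, θ) * cos θ)) θ
  gr : ∀ r θ, HasDerivAt (fun r => g (r, θ)) (B' (r, θ) * cos θ + C (r, θ) * sin θ) r
  gt : ∀ r θ, HasDerivAt (fun θ => g (r, θ)) (r * (-B' (r, θ) * sin θ + C (r, θ) * cos θ)) θ
  pf : ∀ r, f (r, π) = f (r, -π)
  pg : ∀ r, g (r, π) = g (r, -π)

namespace DolPD
variable (D : DolPD) (q s m ι t κ : ℝ)

def X (p : ℝ × ℝ) : ℝ := D.f p ^ 2 + D.g p ^ 2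
def J (p : ℝ × ℝ) : ℝ := dolJ q m (D.f p) (D.g p) (D.A p) (D.B' p) (D.C p)
def tau (p : ℝ × ℝ) : ℝ := dolTau q m (D.f p) (D.g p) (D.A p) (D.B' p) (D.C p)
def a (p : ℝ × ℝ) : ℝ := dolA m (D.f p) (D.g p) (D.A p) (D.B' p) (D.C p)
def w (p : ℝ × ℝ) : ℝ := dolw q s t ι (D.X p)
def Y1 (p : ℝ × ℝ) : ℝ := dolT q s t ι (D.X p) * D.f p
def Y2 (p : ℝ × ℝ) : ℝ := dolT q s t ι (D.X p) * D.g p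
def Y1r (p : ℝ × ℝ) : ℝ := dolD1 q s t ι (D.f p) (D.g p) (D.A p * cos p.2 + D.B' p * sin p.2)
  (D.B' p * cos p.2 + D.C p * sin p.2)
def Y2r (p : ℝ × ℝ) : ℝ := dolD2 q s t ι (D.f p) (D.g p) (D.A p * cos p.2 + D.B' p * sin p.2)
  (D.B' p * cos p.2 + D.C p * sin p.2)
def Y1t (p : ℝ × ℝ) : ℝ := dolD1 q s t ι (D.f p) (D.g p) (p.1 * (-D.A p * sin p.2 + D.B' p * cos p.2))
  (p.1 * (-D.B' p * sin p.2 + D.C p * cos p.2))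
def Y2t (p : ℝ × ℝ) : ℝ := dolD2 q s t ι (D.f p) (D.g p) (p.1 * (-D.A p * sin p.2 + D.B' p * cos p.2))
  (p.1 * (-D.B' p * sin p.2 + D.C p * cos p.2))
/-- the upper bound density -/
def psi (p : ℝ × ℝ) : ℝ := (1+κ) * q * (D.w q s ι t p * D.J q m p)
  + 2 * (1+1/κ) * (D.w q s ι t p * D.tau q m p ^ 2)
  + 2 * (2*q+1) * (dolG q s t (D.X p)^2 * dolZ t ι (D.X p) * D.J q m p)
def I (r : ℝ) : ℝ := ∫ θ in (-π)..π, (D.Y2 q s ι t (r,θ) * D.Y1t q s ι t (r,θ) - D.Y1 q s ι t (r,θ) * D.Y2t q s ι t (r,θ))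

variable {q s m ι t κ}
theorem f_cont : Continuous D.f := D.hf.continuous
theorem g_cont : Continuous D.g := D.hg.continuous
theorem X_cont : Continuous D.X := by
  have := D.f_cont; have := D.g_cont; unfold X; fun_prop
theorem aN_cont : Continuous (fun p => dolaN (D.f p) (D.g p) (D.A p) (D.B' p) (D.C p)) := by
  have := D.f_cont; have := D.g_cont; have := D.hA; have := D.hB; have := D.hC
  unfold dolaN; fun_prop
theorem bN_cont : Continuous (fun p => dolbN (D.f p) (D.g p) (D.A p) (D.B' p) (D.C p)) := by
  have := D.f_cont; have := D.g_cont; have := D.hA; have := D.hB; have := D.hC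
  unfold dolbN; fun_prop
theorem Xm_cont (m : ℝ) : Continuous (fun p => dolX m (D.f p ^ 2 + D.g p ^ 2)) := (dolX_cont m).comp D.X_cont
theorem J_cont (hm : 0 < m) : Continuous (D.J q m) := by
  have := D.aN_cont; have := D.bN_cont; have := D.Xm_cont m
  unfold J dolJ
  exact Continuous.div (by fun_prop) (by fun_prop) fun p => by have := dolX_pos hm (D.f p ^ 2 + D.g p ^ 2); positivity
theorem tau_cont (hm : 0 < m) : Continuous (D.tau q m) := by
  have := D.aN_cont; have := D.Xm_cont m; have := D.hA; have := D.hC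
  unfold tau dolTau
  exact Continuous.add (by fun_prop) (Continuous.div (by fun_prop) (by fun_prop) fun p => by have := dolX_pos hm (D.f p ^ 2 + D.g p ^ 2); positivity)
theorem a_cont (hm : 0 < m) : Continuous (D.a m) := by
  have := D.aN_cont; have := D.Xm_cont m
  unfold a dolA
  exact (Continuous.div (by fun_prop) (by fun_prop) fun p => by have := dolX_pos hm (D.f p ^ 2 + D.g p ^ 2); positivity)
theorem w_cont (hs : 0 < s) (ht : 0 < t) : Continuous (D.w q s ι t) := (dolw_cont hs ht).comp D.X_cont
theorem T_cont (hs : 0 < s) (ht : 0 < t) (hι : 0 < ι) : Continuous (fun p => dolT q s t ι (D.f p ^ 2 + D.g p ^ 2)) :=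
  (dolT_contDiff hs ht hι).continuous.comp D.X_cont
theorem Td_cont (hs : 0 < s) (ht : 0 < t) : Continuous (fun p => dolTd q s t ι (D.f p ^ 2 + D.g p ^ 2)) :=
  (dolTd_cont hs ht).comp D.X_cont
theorem Y_cd (hs : 0 < s) (ht : 0 < t) (hι : 0 < ι) :
    ContDiff ℝ 2 (D.Y1 q s ι t) ∧ ContDiff ℝ 2 (D.Y2 q s ι t) := by
  have h1 : ContDiff ℝ 2 D.X := (D.hf.pow 2).add (D.hg.pow 2)
  have h2 := (dolT_contDiff (q := q) hs ht hι).comp h1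
  exact ⟨h2.mul D.hf, h2.mul D.hg⟩
theorem Yd_cont (hs : 0 < s) (ht : 0 < t) (hι : 0 < ι) :
    Continuous (D.Y1r q s ι t) ∧ Continuous (D.Y2r q s ι t) ∧ Continuous (D.Y1t q s ι t) ∧ Continuous (D.Y2t q s ι t) := by
  have := D.T_cont (q := q) hs ht hι; have := D.Td_cont (q := q) (ι := ι) hs ht
  have := D.f_cont; have := D.g_cont; have := D.hA; have := D.hB; have := D.hC
  refine ⟨?_, ?_, ?_, ?_⟩
  · unfold Y1r dolD1; fun_prop
  · unfold Y2r dolD2; fun_prop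
  · unfold Y1t dolD1; fun_prop
  · unfold Y2t dolD2; fun_prop
theorem psi_cont (hs : 0 < s) (hm : 0 < m) (ht : 0 < t) : Continuous (D.psi q s m ι t κ) := by
  have := D.w_cont (q := q) (ι := ι) hs ht; have := D.J_cont (q := q) hm; have := D.tau_cont (q := q) hm
  have : Continuous (fun p => dolG q s t (D.X p)) := (dolG_cont hs ht).comp D.X_cont
  have : Continuous (fun p => dolZ t ι (D.X p)) := (dolZ_cont ht).comp D.X_cont
  unfold psi; fun_prop

theorem hasD (hs : 0 < s) (ht : 0 < t) (hι : 0 < ι) {u v : ℝ → ℝ} {u' v' x : ℝ} (hu : HasDerivAt u u' x)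
    (hv : HasDerivAt v v' x) :
    HasDerivAt (fun y => dolT q s t ι (u y ^ 2 + v y ^ 2) * u y) (dolD1 q s t ι (u x) (v x) u' v') x ∧
    HasDerivAt (fun y => dolT q s t ι (u y ^ 2 + v y ^ 2) * v y) (dolD2 q s t ι (u x) (v x) u' v') x := by
  have h1 : HasDerivAt (fun y => u y ^ 2 + v y ^ 2) (2 * (u x * u' + v x * v')) x := by
    refine ((hu.pow 2).add (hv.pow 2)).congr_deriv ?_
    simp; ring
  have h2 := (dolT_hasDerivAt (q := q) hs ht hι (u x ^ 2 + v x ^ 2)).comp x h1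
  constructor
  · refine (h2.mul hu).congr_deriv ?_
    unfold dolD1; simp; ring
  · refine (h2.mul hv).congr_deriv ?_
    unfold dolD2; simp; ring

theorem hY1r (hs : 0 < s) (ht : 0 < t) (hι : 0 < ι) (r θ : ℝ) :
    HasDerivAt (fun r => D.Y1 q s ι t (r, θ)) (D.Y1r q s ι t (r, θ)) r :=
  (hasD hs ht hι (D.fr r θ) (D.gr r θ)).1
theorem hY2r (hs : 0 < s) (ht : 0 < t) (hι : 0 < ι) (r θ : ℝ) :
    HasDerivAt (fun r => D.Y2 q s ι t (r, θ)) (D.Y2r q s ι t (r, θ)) r :=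
  (hasD hs ht hι (D.fr r θ) (D.gr r θ)).2
theorem hY1t (hs : 0 < s) (ht : 0 < t) (hι : 0 < ι) (r θ : ℝ) :
    HasDerivAt (fun θ => D.Y1 q s ι t (r, θ)) (D.Y1t q s ι t (r, θ)) θ :=
  (hasD hs ht hι (D.ft r θ) (D.gt r θ)).1
theorem hY2t (hs : 0 < s) (ht : 0 < t) (hι : 0 < ι) (r θ : ℝ) :
    HasDerivAt (fun θ => D.Y2 q s ι t (r, θ)) (D.Y2t q s ι t (r, θ)) θ :=
  (hasD hs ht hι (D.ft r θ) (D.gt r θ)).2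

theorem I_eq (hs : 0 < s) (hm : 0 < m) (hmt : m ≤ t) (hι : 0 < ι) (R : ℝ) :
    D.I q s ι t R = ∫ r in (0:ℝ)..R, ∫ θ in (-π)..π, 
      2 * (r * (D.w q s ι t (r,θ) * (D.J q m (r,θ) - D.a m (r,θ) * D.tau q m (r,θ)))) := by
  have ht : 0 < t := by linarith
  have h := dol_stokes (D.Y1 q s ι t) (D.Y2 q s ι t) (D.Y_cd hs ht hι).1 (D.Y_cd hs ht hι).2
    (fun r => by unfold Y1 X; rw [D.pf, D.pg]) (fun r => by unfold Y2 X; rw [D.pf, D.pg])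
    _ _ _ _ (D.hY1r hs ht hι) (D.hY1t hs ht hι) (D.hY2r hs ht hι) (D.hY2t hs ht hι) R
  have h0 : (∫ θ in (-π)..π, (D.Y2 q s ι t (0, θ) * D.Y1t q s ι t (0, θ) - D.Y1 q s ι t (0, θ) * D.Y2t q s ι t (0, θ))) = 0 := by
    have : ∀ θ : ℝ, (D.Y2 q s ι t (0, θ) * D.Y1t q s ι t (0, θ) - D.Y1 q s ι t (0, θ) * D.Y2t q s ι t (0, θ)) = 0 := by
      intro θ; unfold Y1t Y2t dolD1 dolD2; simp
    simp [this]
  rw [h0, sub_zero] at h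
  unfold I; rw [h]
  apply intervalIntegral.integral_congr; intro r _
  apply intervalIntegral.integral_congr; intro θ _
  show 2 * _ = 2 * _
  congr 1
  exact dol_det hm hmt hι _ _ _ _ _ _ _ _ (by rw [add_comm]; exact sin_sq_add_cos_sq θ)

theorem tang (hq : 1 < q) (hs : 0 < s) (hm : 0 < m) (hmt : m ≤ t) (hι : 0 < ι)
    (hιK : 2 * ι * dolK ≤ 1) (hκ : 0 < κ) (r θ : ℝ) :
    (D.Y1t q s ι t (r,θ) ^ 2 + D.Y2t q s ι t (r,θ) ^ 2) *
     (1 + dolEps q / q * ((D.Y1 q s ι t (r,θ) * sin θ - D.Y2 q s ι t (r,θ) * cos θ)^2 /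
        (D.Y1 q s ι t (r,θ)^2 + D.Y2 q s ι t (r,θ)^2))) ≤ r^2 * D.psi q s m ι t κ (r,θ) :=
  dol_tang hq hs hm hmt hι hιK hκ (D.f (r,θ)) (D.g (r,θ)) (D.A (r,θ)) (D.B' (r,θ)) (D.C (r,θ)) r (cos θ) (sin θ) 
   (by rw [add_comm]; exact sin_sq_add_cos_sq θ)

theorem Yt_sq (hq : 1 < q) (hs : 0 < s) (hm : 0 < m) (hmt : m ≤ t) (hι : 0 < ι)
    (hιK : 2 * ι * dolK ≤ 1) (hκ : 0 < κ) (r θ : ℝ) :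
    D.Y1t q s ι t (r,θ) ^ 2 + D.Y2t q s ι t (r,θ) ^ 2 ≤ r^2 * D.psi q s m ι t κ (r,θ) := by
  refine le_trans ?_ (D.tang hq hs hm hmt hι hιK hκ r θ)
  apply le_mul_of_one_le_right (by positivity)
  have := dolEps_pos q hq
  have : 0 ≤ dolEps q / q * ((D.Y1 q s ι t (r,θ) * sin θ - D.Y2 q s ι t (r,θ) * cos θ)^2 /
        (D.Y1 q s ι t (r,θ)^2 + D.Y2 q s ι t (r,θ)^2)) := by positivity
  linarith

theorem Yr_sq (hq : 1 < q) (hs : 0 < s) (hm : 0 < m) (hmt : m ≤ t) (hι : 0 < ι)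
    (hιK : 2 * ι * dolK ≤ 1) (hκ : 0 < κ) (r θ : ℝ) :
    D.Y1r q s ι t (r,θ) ^ 2 + D.Y2r q s ι t (r,θ) ^ 2 ≤ D.psi q s m ι t κ (r,θ) := by
  have h := dol_tang hq hs hm hmt hι hιK hκ (D.f (r,θ)) (D.g (r,θ)) (D.A (r,θ)) (D.B' (r,θ)) (D.C (r,θ)) 1 (sin θ) (-cos θ) 
   (by rw [neg_sq]; exact sin_sq_add_cos_sq θ)
  have e1 : (1:ℝ) * (-D.A (r,θ) * -cos θ + D.B' (r,θ) * sin θ) = D.A (r,θ) * cos θ + D.B' (r,θ) * sin θ := by ring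
  have e2 : (1:ℝ) * (-D.B' (r,θ) * -cos θ + D.C (r,θ) * sin θ) = D.B' (r,θ) * cos θ + D.C (r,θ) * sin θ := by ring
  rw [e1, e2, one_pow, one_mul] at h
  refine le_trans ?_ h
  apply le_mul_of_one_le_right (by positivity)
  have := dolEps_pos q hq
  rw [le_add_iff_nonneg_right]
  positivity
end DolPD

def dolAv (h : ℝ × ℝ → ℝ) (r : ℝ) : ℝ := r * ∫ θ in (-π)..π, h (r, θ)
def dolCum (h : ℝ × ℝ → ℝ) (R : ℝ) : ℝ := ∫ r in (0:ℝ)..R, dolAv h r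

theorem dolAv_cont {h : ℝ × ℝ → ℝ} (hh : Continuous h) : Continuous (dolAv h) :=
  continuous_id.mul (dol_par_cont h hh _ _)
theorem dolCum_deriv {h : ℝ × ℝ → ℝ} (hh : Continuous h) (R : ℝ) : HasDerivAt (dolCum h) (dolAv h R) R :=
  intervalIntegral.integral_hasDerivAt_right ((dolAv_cont hh).intervalIntegrable _ _)
    ((dolAv_cont hh).stronglyMeasurableAtFilter _ _) (dolAv_cont hh).continuousAt
theorem dol_int_slice {h : ℝ × ℝ → ℝ} (hh : Continuous h) (r : ℝ) :
    IntervalIntegrable (fun θ => h (r, θ)) volume (-π) π :=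
  Continuous.intervalIntegrable (by fun_prop) _ _
theorem dolAv_mono {h k : ℝ × ℝ → ℝ} (hh : Continuous h) (hk : Continuous k) {r : ℝ} (hr : 0 ≤ r)
    (hle : ∀ θ, h (r, θ) ≤ k (r, θ)) : dolAv h r ≤ dolAv k r := by
  unfold dolAv
  gcongr
  exact intervalIntegral.integral_mono (by linarith [pi_pos]) (dol_int_slice hh r) (dol_int_slice hk r) hle
theorem dolAv_nonneg {h : ℝ × ℝ → ℝ} {r : ℝ} (hr : 0 ≤ r) (h0 : ∀ p, 0 ≤ h p) : 0 ≤ dolAv h r :=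
  mul_nonneg hr (intervalIntegral.integral_nonneg (by linarith [pi_pos]) fun θ _ => h0 _)
theorem dolCum_mono {h k : ℝ × ℝ → ℝ} (hh : Continuous h) (hk : Continuous k) {R : ℝ} (hR : 0 ≤ R)
    (hle : ∀ p, h p ≤ k p) : dolCum h R ≤ dolCum k R :=
  intervalIntegral.integral_mono_on hR ((dolAv_cont hh).intervalIntegrable _ _)
    ((dolAv_cont hk).intervalIntegrable _ _) fun r hr => dolAv_mono hh hk hr.1 fun θ => hle _
theorem dolCum_nonneg {h : ℝ × ℝ → ℝ} {R : ℝ} (hR : 0 ≤ R) (h0 : ∀ p, 0 ≤ h p) : 0 ≤ dolCum h R :=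
  intervalIntegral.integral_nonneg hR fun r hr => dolAv_nonneg hr.1 h0
theorem dolAv_add {h k : ℝ × ℝ → ℝ} (hh : Continuous h) (hk : Continuous k) (r : ℝ) :
    dolAv (fun p => h p + k p) r = dolAv h r + dolAv k r := by
  unfold dolAv
  rw [intervalIntegral.integral_add (dol_int_slice hh r) (dol_int_slice hk r)]; ring
theorem dolAv_smul (c : ℝ) (h : ℝ × ℝ → ℝ) (r : ℝ) :
    dolAv (fun p => c * h p) r = c * dolAv h r := by
  unfold dolAv
  rw [intervalIntegral.integral_const_mul]; ring
theorem dolCum_add {h k : ℝ × ℝ → ℝ} (hh : Continuous h) (hk : Continuous k) (r : ℝ) :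
    dolCum (fun p => h p + k p) r = dolCum h r + dolCum k r := by
  unfold dolCum
  simp_rw [dolAv_add hh hk]
  exact intervalIntegral.integral_add ((dolAv_cont hh).intervalIntegrable _ _) ((dolAv_cont hk).intervalIntegrable _ _)
theorem dolCum_smul (c : ℝ) (h : ℝ × ℝ → ℝ) (r : ℝ) :
    dolCum (fun p => c * h p) r = c * dolCum h r := by
  unfold dolCum
  simp_rw [dolAv_smul]
  exact intervalIntegral.integral_const_mul _ _
theorem dolCum_monoR {h : ℝ × ℝ → ℝ} (hh : Continuous h) (h0 : ∀ p, 0 ≤ h p) {a b : ℝ} (ha : 0 ≤ a) (hab : a ≤ b) :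
    dolCum h a ≤ dolCum h b := by
  have : dolCum h b - dolCum h a = ∫ r in a..b, dolAv h r := 
    intervalIntegral.integral_interval_sub_left ((dolAv_cont hh).intervalIntegrable _ _) ((dolAv_cont hh).intervalIntegrable _ _)
  have h1 : 0 ≤ ∫ r in a..b, dolAv h r := intervalIntegral.integral_nonneg hab fun r hr => dolAv_nonneg (ha.trans hr.1) h0
  linarith

namespace DolPD
variable (D : DolPD) {q s m ι t κ : ℝ}

def Z (q s ι t : ℝ) (p : ℝ × ℝ) : ℂ := ⟨D.Y1 q s ι t p, -D.Y2 q s ι t p⟩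
def Zt (q s ι t : ℝ) (p : ℝ × ℝ) : ℂ := ⟨D.Y1t q s ι t p, -D.Y2t q s ι t p⟩
def Zr (q s ι t : ℝ) (p : ℝ × ℝ) : ℂ := ⟨D.Y1r q s ι t p, -D.Y2r q s ι t p⟩
def wJ (q s m ι t : ℝ) (p : ℝ × ℝ) : ℝ := D.w q s ι t p * D.J q m p
def wT (q s m ι t : ℝ) (p : ℝ × ℝ) : ℝ := D.w q s ι t p * D.tau q m p ^ 2

theorem _root_.dol_mk_hasDerivAt {u v : ℝ → ℝ} {u' v' x : ℝ} (hu : HasDerivAt u u' x) (hv : HasDerivAt v v' x) :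
    HasDerivAt (fun y => (⟨u y, -v y⟩ : ℂ)) ⟨u', -v'⟩ x := by
  have h1 := hu.ofReal_comp.sub (hv.ofReal_comp.mul_const Complex.I)
  have e : (fun y => (⟨u y, -v y⟩ : ℂ)) = (fun y => ((u y : ℝ) : ℂ) - ((v y : ℝ) : ℂ) * Complex.I) := by
    ext y; apply Complex.ext <;> simp
  rw [e]
  refine h1.congr_deriv ?_
  apply Complex.ext <;> simp
theorem _root_.dol_mk_cont {α : Type*} [TopologicalSpace α] {u v : α → ℝ} (hu : Continuous u) (hv : Continuous v) :
    Continuous (fun y => (⟨u y, -v y⟩ : ℂ)) := by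
  have e : (fun y => (⟨u y, -v y⟩ : ℂ)) = (fun y => ((u y : ℝ) : ℂ) - ((v y : ℝ) : ℂ) * Complex.I) := by
    ext y; apply Complex.ext <;> simp
  rw [e]; fun_prop
theorem _root_.dol_mk_norm_sq (a b : ℝ) : ‖(⟨a, -b⟩ : ℂ)‖^2 = a^2 + b^2 := by
  rw [Complex.sq_norm, Complex.normSq_apply]; ring

theorem hZt (hs : 0 < s) (ht : 0 < t) (hι : 0 < ι) (r θ : ℝ) :
    HasDerivAt (fun θ => D.Z q s ι t (r, θ)) (D.Zt q s ι t (r, θ)) θ :=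
  dol_mk_hasDerivAt (D.hY1t hs ht hι r θ) (D.hY2t hs ht hι r θ)
theorem hZr (hs : 0 < s) (ht : 0 < t) (hι : 0 < ι) (r θ : ℝ) :
    HasDerivAt (fun r => D.Z q s ι t (r, θ)) (D.Zr q s ι t (r, θ)) r :=
  dol_mk_hasDerivAt (D.hY1r hs ht hι r θ) (D.hY2r hs ht hι r θ)
theorem Z_cont (hs : 0 < s) (ht : 0 < t) (hι : 0 < ι) : Continuous (D.Z q s ι t) :=
  dol_mk_cont (D.Y_cd hs ht hι).1.continuous (D.Y_cd hs ht hι).2.continuous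
theorem Zt_cont (hs : 0 < s) (ht : 0 < t) (hι : 0 < ι) : Continuous (D.Zt q s ι t) :=
  dol_mk_cont (D.Yd_cont hs ht hι).2.2.1 (D.Yd_cont hs ht hι).2.2.2
theorem Zr_cont (hs : 0 < s) (ht : 0 < t) (hι : 0 < ι) : Continuous (D.Zr q s ι t) :=
  dol_mk_cont (D.Yd_cont hs ht hι).1 (D.Yd_cont hs ht hι).2.1
theorem Z_per (r : ℝ) : D.Z q s ι t (r, π) = D.Z q s ι t (r, -π) := by
  unfold Z Y1 Y2 X; rw [D.pf, D.pg]

theorem I_upper (hq : 1 < q) (hs : 0 < s) (hm : 0 < m) (hmt : m ≤ t) (hι : 0 < ι)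
    (hιK : 2 * ι * dolK ≤ 1) (hκ : 0 < κ) (R : ℝ) :
    D.I q s ι t R ≤ (1 - dolEps q / q / 2000) * (R * dolAv (D.psi q s m ι t κ) R) := by
  have ht : 0 < t := by linarith
  have hε := dolEps_pos q hq
  have hε1 : dolEps q / q ≤ 1 := by
    rw [div_le_one (by linarith)]; linarith [dolEps_le q hq]
  have hc := D.Zt_cont (q := q) hs ht hι
  have hcZ := D.Z_cont (q := q) hs ht hι
  have h := dol_curve (dolEps q / q) (by positivity) hε1 (fun θ => D.Z q s ι t (R, θ)) (fun θ => D.Zt q s ι t (R, θ))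
    (D.hZt hs ht hι R) (by fun_prop) (D.Z_per R)
  have e1 : D.I q s ι t R = ∫ θ in (-π)..π, ((starRingEnd ℂ) (D.Z q s ι t (R, θ)) * D.Zt q s ι t (R, θ)).im := by
    unfold I
    congr 1; ext θ
    simp [Z, Zt]; ring
  rw [e1]
  refine h.trans ?_
  have h1 : 0 ≤ 1 - dolEps q / q / 2000 := by linarith
  gcongr
  have e2 : R * dolAv (D.psi q s m ι t κ) R = ∫ θ in (-π)..π, R^2 * D.psi q s m ι t κ (R, θ) := by
    rw [intervalIntegral.integral_const_mul]; unfold dolAv; ring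
  rw [e2]
  have hpc := D.psi_cont (q := q) (ι := ι) (κ := κ) hs hm ht
  apply intervalIntegral.integral_mono (by linarith [pi_pos])
  · have := dolW_int (fun θ => D.Z q s ι t (R, θ)) (by fun_prop) (fun θ => ‖D.Zt q s ι t (R, θ)‖^2 * (dolEps q / q)) (by fun_prop)
    have h3 : IntervalIntegrable (fun θ => ‖D.Zt q s ι t (R, θ)‖^2) volume (-π) π :=
      Continuous.intervalIntegrable (by fun_prop) _ _
    refine (h3.add this).congr ?_
    intro θ _
    show _ + _ = _
    ring
  · exact Continuous.intervalIntegrable (by fun_prop) _ _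
  · intro θ
    have h4 := D.tang hq hs hm hmt hι hιK hκ R θ
    refine le_trans (le_of_eq ?_) h4
    unfold dolW
    simp only []
    rw [Z, Zt, dol_mk_norm_sq, dol_mk_norm_sq]
    congr 4
    rw [Complex.exp_mul_I, ← Complex.ofReal_cos, ← Complex.ofReal_sin]
    simp [-Complex.ofReal_cos, -Complex.ofReal_sin]
    ring

theorem wJ_cont (hs : 0 < s) (hm : 0 < m) (ht : 0 < t) : Continuous (D.wJ q s m ι t) :=
  (D.w_cont hs ht).mul (D.J_cont hm)
theorem wT_cont (hs : 0 < s) (hm : 0 < m) (ht : 0 < t) : Continuous (D.wT q s m ι t) :=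
  (D.w_cont hs ht).mul ((D.tau_cont hm).pow 2)
theorem w_nonneg (hq : 1 < q) (ht : 0 < t) (hι : 0 < ι) (p : ℝ × ℝ) : 0 ≤ D.w q s ι t p := dolw_nonneg hq ht hι _
theorem wJ_nonneg (hq : 1 < q) (ht : 0 < t) (hι : 0 < ι) (p : ℝ × ℝ) : 0 ≤ D.wJ q s m ι t p :=
  mul_nonneg (dolw_nonneg hq ht hι _) (dolJ_nonneg hq _ _ _ _ _)
theorem wT_nonneg (hq : 1 < q) (ht : 0 < t) (hι : 0 < ι) (p : ℝ × ℝ) : 0 ≤ D.wT q s m ι t p :=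
  mul_nonneg (dolw_nonneg hq ht hι _) (sq_nonneg _)

theorem I_lower (hq : 1 < q) (hs : 0 < s) (hm : 0 < m) (hmt : m ≤ t) (hι : 0 < ι)
    (hκ : 0 < κ) {R : ℝ} (hR : 0 ≤ R) :
    2 * (1 - κ) * dolCum (D.wJ q s m ι t) R ≤ D.I q s ι t R + 2 / κ * dolCum (D.wT q s m ι t) R := by
  have ht : 0 < t := by linarith
  have cJ := D.wJ_cont (q := q) (ι := ι) hs hm ht
  have cT := D.wT_cont (q := q) (ι := ι) hs hm ht
  have c1 := D.w_cont (q := q) (ι := ι) hs ht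
  have c2 := D.J_cont (q := q) hm
  have c3 := D.a_cont hm
  have c4 := D.tau_cont (q := q) hm
  have e : D.I q s ι t R = dolCum (fun p => 2 * (D.w q s ι t p * (D.J q m p - D.a m p * D.tau q m p))) R := by
    rw [D.I_eq hs hm hmt hι]
    unfold dolCum dolAv
    congr 1; ext r
    rw [← intervalIntegral.integral_const_mul]
    congr 1; ext θ; ring
  rw [e, ← dolCum_smul, ← dolCum_smul, ← dolCum_add (by fun_prop) (by fun_prop)]
  apply dolCum_mono (by fun_prop) (by fun_prop) hR
  intro p
  have hw := D.w_nonneg (s := s) hq ht hι p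
  have ha : D.a m p ^ 2 ≤ D.J q m p := dolA_sq_le hq _ _ _ _ _
  unfold wJ wT
  have : D.a m p * D.tau q m p ≤ κ * D.J q m p + 1/κ * D.tau q m p ^ 2 := by
    have h1 : 0 ≤ (κ * D.a m p - D.tau q m p)^2 / κ := by positivity
    have h2 : (κ * D.a m p - D.tau q m p)^2 / κ = κ * D.a m p ^2 - 2 * (D.a m p * D.tau q m p) + 1/κ * D.tau q m p ^2 := by
      field_simp; ring
    have h3 : κ * D.a m p ^ 2 ≤ κ * D.J q m p := by gcongr
    have h4 : 0 ≤ 1/κ * D.tau q m p ^2 := by positivity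
    have h5 : 0 ≤ κ * D.a m p ^2 := by positivity
    linarith
  have := mul_le_mul_of_nonneg_left this hw
  have e3 : 2 / κ * (D.w q s ι t p * D.tau q m p ^ 2) = 2 * (D.w q s ι t p * (1/κ * D.tau q m p ^ 2)) := by ring
  rw [e3]
  linarith
end DolPD

section
variable {q s m ι t κ : ℝ}
theorem dol_mt (hm : 0 < m) (hι : 0 < ι) (hmt : m * exp (1/ι) ≤ t) : m ≤ t := by
  have : (1:ℝ) ≤ exp (1/ι) := Real.one_le_exp (by positivity)
  nlinarith
theorem dolG_sq_le_w (hq : 1 < q) (hm : 0 < m) (hι : 0 < ι) (hmt : m * exp (1/ι) ≤ t) {x : ℝ} (hx : t ≤ x) :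
    dolG q s t x ^ 2 ≤ dolw q s m ι x := by
  have hmt' := dol_mt hm hι hmt
  unfold dolw
  rw [dolY_one hm hι (hmt.trans hx)]
  have e : dolG q s t x = dolG q s m x := by
    unfold dolG; rw [dolX_eq (by linarith) hx, dolX_eq hm (by linarith)]
  rw [e]
  have h2 := dolZ_nonneg (t := m) hι x
  have h3 := dolH_ge (s := s) hq hm x
  nlinarith [sq_nonneg (dolG q s m x)]
theorem dolw_le_w (hq : 1 < q) (hs : 0 < s) (hm : 0 < m) (hι : 0 < ι) (hιK : 2 * ι * dolK ≤ 1) (hmt : m * exp (1/ι) ≤ t) (x : ℝ) :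
    dolw q s t ι x ≤ (q+1) * dolw q s m ι x := by
  have hmt' := dol_mt hm hι hmt
  have ht : 0 < t := by linarith
  have hw := dolw_nonneg (s := s) hq hm hι x
  rcases le_or_gt x t with hx | hx
  · rw [dolw_zero ht hι hx]; positivity
  · have h1 := dolG_sq_le_w (s := s) hq hm hι hmt hx.le
    have h2 := dolY_nonneg (t := t) (ι := ι) x
    have h3 := dolY_le (t := t) (ι := ι) x
    have h4 := dolZ_nonneg (t := t) hι x
    have h5 := dolZ_le (t := t) hι x
    have h6 := dolH_le (q := q) hq hs ht x
    have h7 := dolH_ge (s := s) hq ht x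
    have : dolY t ι x * (dolY t ι x * dolH q s t x + dolZ t ι x) ≤ 1 * (1 * q + 1) := by
      gcongr; linarith
    calc dolw q s t ι x ≤ dolG q s t x ^ 2 * (1 * (1 * q + 1)) := by unfold dolw; gcongr
      _ ≤ dolw q s m ι x * (1 * (1 * q + 1)) := by gcongr
      _ = _ := by ring
theorem dolGZ_le (hq : 1 < q) (hm : 0 < m) (hι : 0 < ι) (hmt : m * exp (1/ι) ≤ t) (x : ℝ) :
    dolG q s t x ^ 2 * dolZ t ι x ≤ 2 * ι * dolK * dolw q s m ι x := by
  have hmt' := dol_mt hm hι hmt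
  have ht : 0 < t := by linarith
  have hw := dolw_nonneg (s := s) hq hm hι x
  have hK := dolK_pos
  rcases le_or_gt x t with hx | hx
  · rw [dolZ_zero ht hι hx]; simp; positivity
  · have h1 := dolG_sq_le_w (s := s) hq hm hι hmt hx.le
    have h4 := dolZ_nonneg (t := t) hι x
    have h5 := dolZ_le (t := t) hι x
    calc _ ≤ dolw q s m ι x * (2 * ι * dolK) := by gcongr
      _ = _ := by ring

theorem dol_cacc_pt (hq : 1 < q) (hs : 0 < s) (hm : 0 < m) (hι : 0 < ι)
    (f g A B C r c0 s0 : ℝ) (hcs : c0^2 + s0^2 = 1) :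
    ((dolT q s m ι (f^2+g^2) * g) * dolD1 q s m ι f g (r*(-A*s0+B*c0)) (r*(-B*s0+C*c0)) 
      - (dolT q s m ι (f^2+g^2) * f) * dolD2 q s m ι f g (r*(-A*s0+B*c0)) (r*(-B*s0+C*c0)))^2 
    ≤ r^2 * (2 * q * (f^2+g^2)) * (dolw q s m ι (f^2+g^2) * (dolJ q m f g A B C + dolTau q m f g A B C ^ 2)) := by
  have hw := dolw_nonneg (s := s) hq hm hι (f^2+g^2)
  have hJ := dolJ_nonneg (m := m) hq f g A B C
  rcases le_or_gt (f^2+g^2) m with hx | hx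
  · unfold dolD1 dolD2
    rw [dolT_zero hm hι hx]
    simp
    positivity
  · set h1 := A * g - B * f with hh1
    set h2 := B * g - C * f with hh2
    have eN : (dolT q s m ι (f^2+g^2) * g) * dolD1 q s m ι f g (r*(-A*s0+B*c0)) (r*(-B*s0+C*c0)) 
      - (dolT q s m ι (f^2+g^2) * f) * dolD2 q s m ι f g (r*(-A*s0+B*c0)) (r*(-B*s0+C*c0)) 
      = dolT q s m ι (f^2+g^2)^2 * (r * (-s0 * h1 + c0 * h2)) := by
      unfold dolD1 dolD2; simp only [hh1, hh2]; ring
    rw [eN]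
    have hX : 0 < f^2+g^2 := by linarith
    have hN : (-s0 * h1 + c0 * h2)^2 ≤ h1^2+h2^2 := by
      have : h1^2+h2^2 - (-s0 * h1 + c0 * h2)^2 = (c0 * h1 + s0 * h2)^2 := by linear_combination (-(h1^2+h2^2)) * hcs
      nlinarith [sq_nonneg (c0 * h1 + s0 * h2)]
    have hT : (dolT q s m ι (f^2+g^2)^2)^2 ≤ dolw q s m ι (f^2+g^2) := by
      have a1 := dolY_nonneg (t := m) (ι := ι) (f^2+g^2)
      have a2 := dolY_le (t := m) (ι := ι) (f^2+g^2)
      have a3 := (dolG_pos (q := q) hs hm (f^2+g^2)).le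
      have a4 := dolG_le hq hs hm (f^2+g^2)
      have a5 := dolZ_nonneg (t := m) hι (f^2+g^2)
      have a6 := dolH_ge (s := s) hq hm (f^2+g^2)
      have a7 : 0 ≤ dolT q s m ι (f^2+g^2) := mul_nonneg a1 a3
      have a8 : dolT q s m ι (f^2+g^2) ≤ 1 := mul_le_one₀ a2 a3 a4
      have a9 : dolT q s m ι (f^2+g^2) ^ 2 ≤ 1 := pow_le_one₀ a7 a8
      calc (dolT q s m ι (f^2+g^2)^2)^2 ≤ dolT q s m ι (f^2+g^2)^2 := by nlinarith [sq_nonneg (dolT q s m ι (f^2+g^2))]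
        _ = dolG q s m (f^2+g^2)^2 * (dolY m ι (f^2+g^2) * (dolY m ι (f^2+g^2) * 1 + 0)) := by unfold dolT; ring
        _ ≤ _ := by unfold dolw; gcongr
    have hH : h1^2+h2^2 ≤ (2 * q * (f^2+g^2)) * (dolJ q m f g A B C + dolTau q m f g A B C ^ 2) := by
      have e1 : h1^2+h2^2 = (f^2+g^2) * ((dolbN f g A B C / (f^2+g^2))^2 + (dolTau q m f g A B C - q * (dolaN f g A B C / (f^2+g^2)))^2) := by
        unfold dolTau
        rw [dolX_eq hm hx.le]
        simp only [hh1, hh2]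
        field_simp
        unfold dolaN dolbN
        ring
      have e2 : dolJ q m f g A B C = q * (dolaN f g A B C / (f^2+g^2))^2 + (dolbN f g A B C / (f^2+g^2))^2 := by
        unfold dolJ; rw [dolX_eq hm hx.le]; field_simp
      rw [e1, e2]
      generalize dolbN f g A B C / (f^2+g^2) = b
      generalize dolaN f g A B C / (f^2+g^2) = a
      generalize dolTau q m f g A B C = τ
      have : b^2 + (τ - q*a)^2 ≤ 2 * q * (q * a^2 + b^2 + τ^2) := by
        nlinarith [sq_nonneg (τ + q * a), mul_nonneg (by linarith : 0 ≤ q-1) (sq_nonneg b), mul_nonneg (by linarith : 0 ≤ q-1) (sq_nonneg τ), sq_nonneg b]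
      calc _ ≤ (f^2+g^2) * (2 * q * (q * a^2 + b^2 + τ^2)) := by gcongr
        _ = _ := by ring
    calc _ = (dolT q s m ι (f^2+g^2)^2)^2 * (r^2 * (-s0 * h1 + c0 * h2)^2) := by ring
      _ ≤ dolw q s m ι (f^2+g^2) * (r^2 * ((2 * q * (f^2+g^2)) * (dolJ q m f g A B C + dolTau q m f g A B C ^ 2))) := by
        gcongr; exact hN.trans hH
      _ = _ := by ring
end

namespace DolPD
variable (D : DolPD) {q s m ι t κ : ℝ}

theorem wJ_le (hq : 1 < q) (hs : 0 < s) (hm : 0 < m) (hι : 0 < ι) (hιK : 2 * ι * dolK ≤ 1) (hmt : m * exp (1/ι) ≤ t) (p : ℝ × ℝ) :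
    D.wJ q s m ι t p ≤ (q+1) * D.wJ q s m ι m p := by
  have := mul_le_mul_of_nonneg_right (dolw_le_w hq hs hm hι hιK hmt (D.X p)) (dolJ_nonneg (m := m) hq (D.f p) (D.g p) (D.A p) (D.B' p) (D.C p))
  unfold wJ w J; linarith
theorem wT_le (hq : 1 < q) (hs : 0 < s) (hm : 0 < m) (hι : 0 < ι) (hιK : 2 * ι * dolK ≤ 1) (hmt : m * exp (1/ι) ≤ t) (p : ℝ × ℝ) :
    D.wT q s m ι t p ≤ (q+1) * D.wT q s m ι m p := by
  have := mul_le_mul_of_nonneg_right (dolw_le_w hq hs hm hι hιK hmt (D.X p)) (sq_nonneg (D.tau q m p))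
  unfold wT w; linarith
theorem psi_le (hq : 1 < q) (hs : 0 < s) (hm : 0 < m) (hι : 0 < ι) (hιK : 2 * ι * dolK ≤ 1) (hκ : 0 < κ) (hmt : m * exp (1/ι) ≤ t) (p : ℝ × ℝ) :
    D.psi q s m ι t κ p ≤ (1+κ) * q * D.wJ q s m ι t p + 2 * (1+1/κ) * (q+1) * D.wT q s m ι m p
      + 4 * (2*q+1) * ι * dolK * D.wJ q s m ι m p := by
  have h1 := D.wT_le hq hs hm hι hιK hmt p
  have h2 := mul_le_mul_of_nonneg_right (dolGZ_le (s := s) hq hm hι hmt (D.X p)) (dolJ_nonneg (m := m) hq (D.f p) (D.g p) (D.A p) (D.B' p) (D.C p))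
  have h3 : 0 ≤ 2 * (1+1/κ) := by positivity
  have h4 := mul_le_mul_of_nonneg_left h1 h3
  have h5 := mul_le_mul_of_nonneg_left h2 (by linarith : 0 ≤ 2 * (2*q+1))
  unfold psi
  unfold wJ wT w J at *
  linarith

theorem I_bound (hq : 1 < q) (hs : 0 < s) (hm : 0 < m) (hι : 0 < ι) {R η : ℝ} (hR : 0 ≤ R) (hη : 0 ≤ η) :
    8 * η * D.I q s ι m R ≤ η^2 * (dolAv (D.wJ q s m ι m) R + dolAv (D.wT q s m ι m) R) + 32 * q * dolAv D.X R := by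
  have cJ := D.wJ_cont (q := q) (ι := ι) hs hm hm
  have cT := D.wT_cont (q := q) (ι := ι) hs hm hm
  have cX := D.X_cont
  have hY := D.Y_cd (q := q) hs hm hι
  have hY1 := hY.1.continuous
  have hY2 := hY.2.continuous
  obtain ⟨d1, d2, d3, d4⟩ := D.Yd_cont (q := q) hs hm hι
  have e : η^2 * (dolAv (D.wJ q s m ι m) R + dolAv (D.wT q s m ι m) R) + 32 * q * dolAv D.X R
    = ∫ θ in (-π)..π, R * (η^2 * (D.wJ q s m ι m (R,θ) + D.wT q s m ι m (R,θ)) + 32 * q * D.X (R,θ)) := by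
    rw [← dolAv_add cJ cT, ← dolAv_smul, ← dolAv_smul, ← dolAv_add (by fun_prop) (by fun_prop)]
    unfold dolAv
    rw [intervalIntegral.integral_const_mul]
  rw [e]
  unfold I
  rw [← intervalIntegral.integral_const_mul]
  apply intervalIntegral.integral_mono (by linarith [pi_pos])
  · exact Continuous.intervalIntegrable (by fun_prop) _ _
  · exact Continuous.intervalIntegrable (by fun_prop) _ _
  intro θ
  have hp := dol_cacc_pt hq hs hm hι (D.f (R,θ)) (D.g (R,θ)) (D.A (R,θ)) (D.B' (R,θ)) (D.C (R,θ)) R (cos θ) (sin θ) 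
   (by rw [add_comm]; exact sin_sq_add_cos_sq θ)
  have hw1 := D.wJ_nonneg (s := s) (m := m) hq hm hι (R,θ)
  have hw2 := D.wT_nonneg (s := s) (m := m) hq hm hι (R,θ)
  set N := D.Y2 q s ι m (R, θ) * D.Y1t q s ι m (R, θ) - D.Y1 q s ι m (R, θ) * D.Y2t q s ι m (R, θ) with hN
  have hp' : N^2 ≤ R^2 * (2 * q * D.X (R,θ)) * (D.wJ q s m ι m (R,θ) + D.wT q s m ι m (R,θ)) := by
    refine hp.trans (le_of_eq ?_)
    unfold wJ wT w J tau X; ring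
  have hX : 0 ≤ D.X (R,θ) := by unfold X; positivity
  show 8 * η * N ≤ R * (η^2 * (D.wJ q s m ι m (R,θ) + D.wT q s m ι m (R,θ)) + 32 * q * D.X (R,θ))
  generalize D.wJ q s m ι m (R,θ) = a at *
  generalize D.wT q s m ι m (R,θ) = b at *
  generalize D.X (R,θ) = x at *
  have hrhs : 0 ≤ R * (η^2 * (a + b) + 32 * q * x) := by positivity
  apply le_of_sq_le_sq _ hrhs
  nlinarith [mul_le_mul_of_nonneg_left hp' (by positivity : 0 ≤ 64 * η^2), mul_nonneg (sq_nonneg R) (sq_nonneg (η^2*(a+b) - 32 * q * x))]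
where le_of_sq_le_sq {a b : ℝ} (h : a^2 ≤ b^2) (hb : 0 ≤ b) : a ≤ b := abs_le_of_sq_le_sq' h hb |>.2

theorem energy (hq : 1 < q) (hs : 0 < s) (hm : 0 < m) (hι : 0 < ι) :
    dolCum (D.wJ q s m ι m) (1/2) ≤ 9 * dolCum (D.wT q s m ι m) (3/4) + 32 * q * dolCum D.X (3/4) := by
  have cJ := D.wJ_cont (q := q) (ι := ι) hs hm hm
  have cT := D.wT_cont (q := q) (ι := ι) hs hm hm
  have cX := D.X_cont
  set E := dolCum (D.wJ q s m ι m)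
  set T := dolCum (D.wT q s m ι m)
  set S := dolCum D.X
  have hd : ∀ R, HasDerivAt (fun R => (4*(3/4-R))^2 * E R + T R + 32 * q * S R + 32 * T (3/4) * R)
     (-8 * (4*(3/4-R)) * E R + (4*(3/4-R))^2 * dolAv (D.wJ q s m ι m) R + dolAv (D.wT q s m ι m) R + 32 * q * dolAv D.X R + 32 * T (3/4)) R := by
    intro R
    have h1 : HasDerivAt (fun R : ℝ => (4*(3/4-R))^2) (-8 * (4*(3/4-R))) R := by
      refine ((((hasDerivAt_id R).const_sub (3/4)).const_mul 4).pow 2).congr_deriv ?_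
      simp; ring
    refine ((((h1.mul (dolCum_deriv cJ R)).add (dolCum_deriv cT R)).add ((dolCum_deriv cX R).const_mul (32*q))).add ((hasDerivAt_id R).const_mul (32 * T (3/4)))).congr_deriv ?_
    show _ * E R + _ + _ + _ + _ = _
    ring
  have hmono : MonotoneOn (fun R => (4*(3/4-R))^2 * E R + T R + 32 * q * S R + 32 * T (3/4) * R) (Set.Icc (1/2) (3/4)) := by
    apply monotoneOn_of_deriv_nonneg (convex_Icc _ _)
    · exact fun R _ => (hd R).continuousAt.continuousWithinAt
    · exact fun R _ => (hd R).differentiableAt.differentiableWithinAt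
    · intro R hR
      rw [interior_Icc] at hR
      rw [(hd R).deriv]
      have hη : 0 ≤ 4*(3/4-R) := by linarith [hR.2]
      have hη1 : 4*(3/4-R) ≤ 1 := by linarith [hR.1]
      have hR0 : 0 ≤ R := by linarith [hR.1]
      have h1 := D.I_lower (κ := 1/2) hq hs hm le_rfl hι (by norm_num) hR0
      have h2 := D.I_bound hq hs hm hι hR0 hη
      have h3 : T R ≤ T (3/4) := dolCum_monoR cT (fun p => D.wT_nonneg hq hm hι p) hR0 hR.2.le
      have h4 : 0 ≤ T R := dolCum_nonneg hR0 (fun p => D.wT_nonneg hq hm hι p)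
      have h5 : 0 ≤ dolAv (D.wT q s m ι m) R := dolAv_nonneg hR0 (fun p => D.wT_nonneg hq hm hι p)
      set η := 4*(3/4-R)
      have h1' : E R ≤ D.I q s ι m R + 4 * T R := by
        have e1 : 2 * (1 - 1/2 : ℝ) = 1 := by norm_num
        have e2 : (2 : ℝ) / (1/2) = 4 := by norm_num
        rw [e1, e2, one_mul] at h1; exact h1
      have h6 := mul_le_mul_of_nonneg_left h1' (by positivity : 0 ≤ 8 * η)
      have h7 : η * T R ≤ 1 * T (3/4) := by gcongr
      have h8 : η^2 * dolAv (D.wT q s m ι m) R ≤ 1 * dolAv (D.wT q s m ι m) R := by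
        gcongr; nlinarith
      linarith
  have := hmono (by norm_num : (1/2:ℝ) ∈ Set.Icc (1/2:ℝ) (3/4)) (by norm_num : (3/4:ℝ) ∈ Set.Icc (1/2:ℝ) (3/4)) (by norm_num)
  norm_num at this
  have h4 : 0 ≤ T (1/2) := dolCum_nonneg (by norm_num) (fun p => D.wT_nonneg hq hm hι p)
  have h5 : 0 ≤ S (1/2) := dolCum_nonneg (by norm_num) (fun p => by unfold X; positivity)
  have h6 : 0 ≤ q * S (1/2) := by positivity
  linarith
end DolPD

theorem dol_ode {Φ g : ℝ → ℝ} {γ D2 η0 : ℝ} (hγ : 0 < γ) (hγ1 : γ < 1) (hD : 0 ≤ D2) (hη : 0 ≤ η0)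
    (hd : ∀ R, HasDerivAt Φ (g R) R)
    (h0 : 0 ≤ Φ (1/2))
    (hΦ : ∀ R, 0 < R → R ≤ 1/2 → Φ R ≤ R / (2*γ) * g R + D2 * R^2 + η0) {R : ℝ} (hR : 0 < R) (hR2 : R ≤ 1/2) :
    Φ R ≤ η0 + (4 * Φ (1/2) + γ/(1-γ) * D2) * R ^ (2*γ) := by
  have hd1 : ∀ R : ℝ, 0 < R → HasDerivAt (fun R : ℝ => R ^ (-(2*γ)) * (Φ R - η0) + γ/(1-γ) * D2 * R ^ (2 - 2*γ))
      (R ^ (-(2*γ)-1) * (-(2*γ) * (Φ R - η0) + R * g R + 2 * γ * D2 * R^2)) R := by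
    intro R hR
    have h1 := Real.hasDerivAt_rpow_const (x := R) (p := -(2*γ)) (Or.inl hR.ne')
    have h2 := Real.hasDerivAt_rpow_const (x := R) (p := 2-2*γ) (Or.inl hR.ne')
    refine ((h1.mul ((hd R).sub_const η0)).add (h2.const_mul (γ/(1-γ) * D2))).congr_deriv ?_
    have e1 : R ^ (-(2*γ)) = R ^ (-(2*γ)-1) * R := by
      rw [Real.rpow_sub_one hR.ne']; field_simp
    have e2 : R ^ (2 - 2*γ - 1) = R ^ (-(2*γ)-1) * R^2 := by
      rw [← Real.rpow_natCast R 2, ← Real.rpow_add hR]; congr 1; push_cast; ring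
    rw [e1, e2]
    have : 1 - γ ≠ 0 := by linarith
    field_simp
  have hmono : MonotoneOn (fun R : ℝ => R ^ (-(2*γ)) * (Φ R - η0) + γ/(1-γ) * D2 * R ^ (2 - 2*γ)) (Set.Icc R (1/2)) := by
    apply monotoneOn_of_deriv_nonneg (convex_Icc _ _)
    · exact fun x hx => (hd1 x (hR.trans_le hx.1)).continuousAt.continuousWithinAt
    · intro x hx
      rw [interior_Icc] at hx
      exact (hd1 x (hR.trans hx.1)).differentiableAt.differentiableWithinAt
    · intro x hx
      rw [interior_Icc] at hx
      have hx0 := hR.trans hx.1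
      rw [(hd1 x hx0).deriv]
      have := hΦ x hx0 hx.2.le
      apply mul_nonneg (by positivity)
      have h3 := mul_le_mul_of_nonneg_left this (by positivity : 0 ≤ 2*γ)
      have e : 2 * γ * (x / (2*γ) * g x + D2 * x^2 + η0) = x * g x + 2 * γ * D2 * x^2 + 2*γ*η0 := by field_simp
      rw [e] at h3
      linarith
  have h := hmono (Set.left_mem_Icc.2 hR2) (Set.right_mem_Icc.2 hR2) hR2
  simp only [] at h
  have hh : ((1/2:ℝ)) ^ (-(2*γ)) ≤ 4 := by
    have : ((1/2:ℝ)) ^ (-(2*γ)) ≤ (1/2:ℝ) ^ (-2:ℝ) := 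
      Real.rpow_le_rpow_of_exponent_ge (by norm_num) (by norm_num) (by linarith)
    refine this.trans (le_of_eq ?_)
    rw [Real.rpow_neg (by norm_num)]; norm_num
  have hh2 : ((1/2:ℝ)) ^ (2-2*γ) ≤ 1 := Real.rpow_le_one (by norm_num) (by norm_num) (by linarith)
  have hc : 0 ≤ γ/(1-γ) * D2 := mul_nonneg (div_nonneg hγ.le (by linarith)) hD
  have h1 : (1/2:ℝ) ^ (-(2*γ)) * (Φ (1/2) - η0) ≤ 4 * Φ (1/2) := by
    calc _ ≤ (1/2:ℝ) ^ (-(2*γ)) * Φ (1/2) := by gcongr; linarith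
      _ ≤ _ := by gcongr
  have h2 : γ/(1-γ) * D2 * (1/2:ℝ) ^ (2-2*γ) ≤ γ/(1-γ) * D2 * 1 := by gcongr
  have h3 : R ^ (-(2*γ)) * (Φ R - η0) ≤ 4 * Φ (1/2) + γ/(1-γ) * D2 := by
    have : 0 ≤ γ/(1-γ) * D2 * R ^ (2-2*γ) := by positivity
    linarith
  have h4 : Φ R - η0 = (R ^ (-(2*γ)) * (Φ R - η0)) * R ^ (2*γ) := by
    rw [Real.rpow_neg hR.le]; field_simp
  have h5 := mul_le_mul_of_nonneg_right h3 (by positivity : 0 ≤ R ^ (2*γ))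
  linarith

def dolQ (γ η0 M : ℝ) (Φ : ℝ → ℝ) (x : ℝ) : ℝ := 1/2 * (x ^ (-γ) * (Φ x - η0) + M * x ^ γ + x ^ γ / γ)
def dolQd (γ η0 M : ℝ) (Φ g : ℝ → ℝ) (x : ℝ) : ℝ :=
  1/2 * (x ^ (-γ) * g x + (γ * x ^ (-γ-1) * (η0 + M * x ^ (2*γ) - Φ x)) + x ^ (γ-1))

theorem dolQ_deriv {γ η0 M : ℝ} {Φ g : ℝ → ℝ} (hγ : 0 < γ) {x : ℝ} (hx : 0 < x) (hd : HasDerivAt Φ (g x) x) :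
    HasDerivAt (dolQ γ η0 M Φ) (dolQd γ η0 M Φ g x) x := by
  have h1 := Real.hasDerivAt_rpow_const (x := x) (p := -γ) (Or.inl hx.ne')
  have h2 := Real.hasDerivAt_rpow_const (x := x) (p := γ) (Or.inl hx.ne')
  refine ((((h1.mul (hd.sub_const η0)).add (h2.const_mul M)).add (h2.div_const γ)).const_mul (1/2)).congr_deriv ?_
  unfold dolQd
  have e : x ^ (2*γ) = x ^ (γ-1) * x ^ (γ+1) := by rw [← Real.rpow_add hx]; congr 1; ring
  have e2 : x ^ (-γ-1) * x ^ (γ+1) = 1 := by rw [← Real.rpow_add hx]; simp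
  rw [e]
  have : γ * x^(γ-1) / γ = x^(γ-1) := by field_simp
  rw [this]
  linear_combination (-(1/2) * γ * M * x ^ (γ-1)) * e2

theorem dolQd_ge {γ η0 M : ℝ} {Φ g : ℝ → ℝ} (hγ : 0 < γ) {x a : ℝ} (hx : 0 < x) (hΦ : Φ x ≤ η0 + M * x^(2*γ))
    (hg : 0 ≤ g x) (ha : x * a^2 ≤ g x) : a ≤ dolQd γ η0 M Φ g x := by
  have h1 : 1/2 * (x ^ (-γ) * g x + x ^ (γ-1)) ≤ dolQd γ η0 M Φ g x := by
    unfold dolQd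
    have : 0 ≤ γ * x ^ (-γ-1) * (η0 + M * x ^ (2*γ) - Φ x) := mul_nonneg (by positivity) (by linarith)
    linarith
  refine le_trans ?_ h1
  have h2 : 0 ≤ 1/2 * (x ^ (-γ) * g x + x ^ (γ-1)) := by positivity
  refine (abs_le_of_sq_le_sq' ?_ h2).2
  have e : x ^ (-γ) * g x * x ^ (γ-1) = g x / x := by
    have : x ^ (-γ) * x ^ (γ-1) = x⁻¹ := by rw [← Real.rpow_add hx, ← Real.rpow_neg_one]; congr 1; ring
    rw [div_eq_mul_inv, ← this]; ring
  have h3 : a^2 ≤ g x / x := by rw [le_div_iff₀ hx]; linarith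
  nlinarith [sq_nonneg (x ^ (-γ) * g x - x ^ (γ-1))]

theorem dolQd_cont {γ η0 M : ℝ} {Φ g : ℝ → ℝ} (hΦ : Continuous Φ) (hg : Continuous g) {a b : ℝ} (ha : 0 < a) :
    ContinuousOn (dolQd γ η0 M Φ g) (Set.Icc a b) := by
  have hr : ∀ p : ℝ, ContinuousOn (fun x : ℝ => x ^ p) (Set.Icc a b) := fun p x hx =>
    (Real.continuousAt_rpow_const x p (Or.inl (ha.trans_le hx.1).ne')).continuousWithinAt
  unfold dolQd
  have h1 := hr (-γ); have h2 := hr (-γ-1); have h3 := hr (2*γ); have h4 := hr (γ-1)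
  have h5 := hΦ.continuousOn (s := Set.Icc a b); have h6 := hg.continuousOn (s := Set.Icc a b)
  fun_prop

theorem dolQ_diff {γ η0 M : ℝ} {Φ : ℝ → ℝ} (hγ : 0 < γ) (hM : 0 ≤ M) (hη : 0 ≤ η0) {a b : ℝ} (ha : 0 < a) (hab : a ≤ b)
    (hΦa : 0 ≤ Φ a) (hΦ : Φ b ≤ η0 + M * b^(2*γ)) :
    dolQ γ η0 M Φ b - dolQ γ η0 M Φ a ≤ (M + 1/γ) * b ^ γ + η0 * a ^ (-γ) := by
  have hb : 0 < b := by linarith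
  unfold dolQ
  have h1 : b ^ (-γ) * (Φ b - η0) ≤ M * b ^ γ := by
    have : b ^ (-γ) * (Φ b - η0) ≤ b ^ (-γ) * (M * b^(2*γ)) := by gcongr; linarith
    refine this.trans (le_of_eq ?_)
    have e : b ^ (2*γ) = b ^ γ * b ^ γ := by rw [← Real.rpow_add hb]; congr 1; ring
    rw [e, Real.rpow_neg hb.le]; field_simp
  have h2 : -(η0 * a ^ (-γ)) ≤ a ^ (-γ) * (Φ a - η0) := by
    have : 0 ≤ a ^ (-γ) * Φ a := by positivity
    linarith
  have h3 : 0 ≤ M * a ^ γ := by positivity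
  have h4 : 0 ≤ a ^ γ / γ := by positivity
  have h5 : 0 ≤ b ^ γ / γ := by positivity
  have h6 : 0 ≤ η0 * a ^ (-γ) := by positivity
  have e : (M + 1/γ) * b ^ γ = M * b^γ + b ^ γ / γ := by ring
  rw [e]
  linarith

/-- pointwise comparison of truncated field and original field -/
theorem dolT_close {q s t ι : ℝ} (hq : 1 < q) (hs : 0 < s) (ht : 0 < t) (hι : 0 < ι) (hts : t * exp (1/ι) ≤ s^2) {ρ : ℝ} (hρ : 0 ≤ ρ) :
    (1 - dolT q s t ι (ρ^2)) * ρ ≤ (q+1) * s := by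
  have h1 := dolY_nonneg (t := t) (ι := ι) (ρ^2)
  have h2 := dolY_le (t := t) (ι := ι) (ρ^2)
  have h3 := (dolG_pos (q := q) hs ht (ρ^2)).le
  have h4 := dolG_le hq hs ht (ρ^2)
  rcases le_or_gt (t * exp (1/ι)) (ρ^2) with h | h
  · have h5 : dolT q s t ι (ρ^2) = dolG q s t (ρ^2) := by
      unfold dolT; rw [dolY_one ht hι h, one_mul]
    rw [h5]
    have hxt : t ≤ ρ^2 := by
      have : (1:ℝ) ≤ exp (1/ι) := Real.one_le_exp (by positivity)
      nlinarith
    have hX : 0 < ρ^2 := by linarith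
    have hG : 1 - q * (s^2 / (s^2 + ρ^2)) ≤ dolG q s t (ρ^2) := by
      unfold dolG
      rw [dolX_eq ht hxt]
      have hb0 : 0 < ρ^2 / (s^2+ρ^2) := by positivity
      have hb1 : ρ^2 / (s^2+ρ^2) ≤ 1 := by rw [div_le_one (by positivity)]; nlinarith
      rcases le_or_gt 1 ((q-1)/2) with hk | hk
      · have := one_add_mul_self_le_rpow_one_add (s := ρ^2/(s^2+ρ^2) - 1) (by linarith) hk
        rw [add_sub_cancel] at this
        refine le_trans ?_ this
        have e : ρ^2/(s^2+ρ^2) - 1 = -(s^2 / (s^2+ρ^2)) := by field_simp; ring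
        rw [e]
        have : 0 ≤ s^2 / (s^2+ρ^2) := by positivity
        nlinarith
      · have h7 : ρ^2 / (s^2+ρ^2) ≤ (ρ^2 / (s^2+ρ^2)) ^ ((q-1)/2) := by
          have := Real.rpow_le_rpow_of_exponent_ge hb0 hb1 hk.le
          rwa [Real.rpow_one] at this
        refine le_trans ?_ h7
        have e : ρ^2/(s^2+ρ^2) = 1 -(s^2 / (s^2+ρ^2)) := by field_simp; ring
        rw [e]
        have : 0 ≤ s^2 / (s^2+ρ^2) := by positivity
        nlinarith
    have h8 : s^2 / (s^2+ρ^2) * ρ ≤ s := by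
      rw [div_mul_eq_mul_div, div_le_iff₀ (by positivity)]
      nlinarith [sq_nonneg (s-ρ), sq_nonneg (s+ρ)]
    calc (1 - dolG q s t (ρ^2)) * ρ ≤ (q * (s^2 / (s^2 + ρ^2))) * ρ := by gcongr; linarith
      _ = q * (s^2 / (s^2 + ρ^2) * ρ) := by ring
      _ ≤ q * s := by gcongr
      _ ≤ _ := by linarith
  · have h5 : ρ ≤ s := by
      refine (abs_le_of_sq_le_sq' ?_ hs.le).2; linarith
    have h6 : 0 ≤ dolT q s t ι (ρ^2) := mul_nonneg h1 h3
    calc (1 - dolT q s t ι (ρ^2)) * ρ ≤ 1 * s := by gcongr; linarith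
      _ ≤ _ := by nlinarith

def dolE2 (q : ℝ) : ℝ := dolEps q / q / 2000
def dolKap (q : ℝ) : ℝ := dolE2 q / 8
def dolGam (q : ℝ) : ℝ := 1 / (q * (1 - dolE2 q / 2))
def dolc2 (q : ℝ) : ℝ := 2 * (1 + 1/dolKap q) * (q+1) / (1 - dolKap q)
def dolc3 (q : ℝ) : ℝ := 4 * (2*q+1) * dolK / (1 - dolKap q)
def dolc4 (q : ℝ) : ℝ := (q+1) / (dolKap q * (1 - dolKap q))

section
variable {q : ℝ}
theorem dolE2_pos (hq : 1 < q) : 0 < dolE2 q := by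
  have := dolEps_pos q hq; unfold dolE2; positivity
theorem dolE2_le (hq : 1 < q) : dolE2 q ≤ 1/2000 ∧ dolE2 q * q ≤ (q-1)/2000 := by
  have h1 : dolEps q = 0.29*(q-1)/q^2 := rfl
  have hq0 : 0 < q := by linarith
  have h2 : dolEps q ≤ (q-1) := by
    rw [h1, div_le_iff₀ (by positivity)]
    nlinarith [mul_pos (sub_pos.2 hq) hq0, mul_pos (mul_pos (sub_pos.2 hq) hq0) hq0]
  have h3 : dolEps q / q ≤ 1 := by
    rw [div_le_one hq0]; linarith
  unfold dolE2
  refine ⟨by linarith, ?_⟩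
  have : dolEps q / q / 2000 * q = dolEps q / 2000 := by field_simp
  rw [this]; linarith
theorem dolKap_pos (hq : 1 < q) : 0 < dolKap q := by have := dolE2_pos hq; unfold dolKap; positivity
theorem dolKap_le (hq : 1 < q) : dolKap q ≤ 1/2 := by have := (dolE2_le hq).1; unfold dolKap; linarith
theorem dolGam_pos (hq : 1 < q) : 0 < dolGam q := by
  have := (dolE2_le hq).1; unfold dolGam
  have : 0 < q * (1 - dolE2 q / 2) := by apply mul_pos <;> linarith
  positivity
theorem dolGam_lt (hq : 1 < q) : dolGam q < 1 := by
  have h1 := (dolE2_le hq).1; have h2 := (dolE2_le hq).2; unfold dolGam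
  have : 0 < q * (1 - dolE2 q / 2) := by apply mul_pos <;> linarith
  rw [div_lt_one this]; nlinarith
theorem dolGam_gt (hq : 1 < q) : 1/q < dolGam q := by
  have h1 := (dolE2_le hq).1; have h2 := (dolE2_pos hq); unfold dolGam
  have : 0 < q * (1 - dolE2 q / 2) := by apply mul_pos <;> linarith
  apply one_div_lt_one_div_of_lt this
  nlinarith
theorem dolc2_pos (hq : 1 < q) : 0 < dolc2 q := by
  have h1 := dolKap_pos hq; have h2 := dolKap_le hq
  have : 0 < 1 - dolKap q := by linarith
  unfold dolc2; positivity
theorem dolc3_pos (hq : 1 < q) : 0 < dolc3 q := by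
  have h1 := dolKap_pos hq; have h2 := dolKap_le hq; have := dolK_pos
  have : 0 < 1 - dolKap q := by linarith
  unfold dolc3; positivity
theorem dolc4_pos (hq : 1 < q) : 0 < dolc4 q := by
  have h1 := dolKap_pos hq; have h2 := dolKap_le hq
  have : 0 < 1 - dolKap q := by linarith
  unfold dolc4; positivity
end

namespace DolPD
variable (D : DolPD) {q s m ι t : ℝ}

def Phi (q s m ι t : ℝ) (R : ℝ) : ℝ := dolCum (D.wJ q s m ι t) R + dolc2 q * dolCum (D.wT q s m ι m) R
  + dolc3 q * ι * dolCum (D.wJ q s m ι m) R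
def phi (q s m ι t : ℝ) (R : ℝ) : ℝ := dolAv (D.wJ q s m ι t) R + dolc2 q * dolAv (D.wT q s m ι m) R
  + dolc3 q * ι * dolAv (D.wJ q s m ι m) R

theorem Phi_deriv (hs : 0 < s) (hm : 0 < m) (ht : 0 < t) (R : ℝ) :
    HasDerivAt (D.Phi q s m ι t) (D.phi q s m ι t R) R :=
  ((dolCum_deriv (D.wJ_cont hs hm ht) R).add ((dolCum_deriv (D.wT_cont hs hm hm) R).const_mul _)).add
    ((dolCum_deriv (D.wJ_cont hs hm hm) R).const_mul _)
theorem phi_cont (hs : 0 < s) (hm : 0 < m) (ht : 0 < t) : Continuous (D.phi q s m ι t) := by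
  have := dolAv_cont (D.wJ_cont (q := q) (ι := ι) hs hm ht); have := dolAv_cont (D.wT_cont (q := q) (ι := ι) hs hm hm); have := dolAv_cont (D.wJ_cont (q := q) (ι := ι) hs hm hm)
  unfold phi; fun_prop
theorem phi_nonneg (hq : 1 < q) (hm : 0 < m) (ht : 0 < t) (hι : 0 < ι) {R : ℝ} (hR : 0 ≤ R) : 0 ≤ D.phi q s m ι t R := by
  have h1 : 0 ≤ dolAv (D.wJ q s m ι t) R := dolAv_nonneg hR (fun p => D.wJ_nonneg hq ht hι p)
  have h2 : 0 ≤ dolAv (D.wT q s m ι m) R := dolAv_nonneg hR (fun p => D.wT_nonneg hq hm hι p)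
  have h3 : 0 ≤ dolAv (D.wJ q s m ι m) R := dolAv_nonneg hR (fun p => D.wJ_nonneg hq hm hι p)
  have := dolc2_pos hq; have := dolc3_pos hq
  unfold phi; positivity
theorem Phi_nonneg (hq : 1 < q) (hm : 0 < m) (ht : 0 < t) (hι : 0 < ι) {R : ℝ} (hR : 0 ≤ R) : 0 ≤ D.Phi q s m ι t R := by
  have h1 : 0 ≤ dolCum (D.wJ q s m ι t) R := dolCum_nonneg hR (fun p => D.wJ_nonneg hq ht hι p)
  have h2 : 0 ≤ dolCum (D.wT q s m ι m) R := dolCum_nonneg hR (fun p => D.wT_nonneg hq hm hι p)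
  have h3 : 0 ≤ dolCum (D.wJ q s m ι m) R := dolCum_nonneg hR (fun p => D.wJ_nonneg hq hm hι p)
  have := dolc2_pos hq; have := dolc3_pos hq
  unfold Phi; positivity

theorem Av_psi_le' (hq : 1 < q) (hs : 0 < s) (hm : 0 < m) (hι : 0 < ι) (hιK : 2 * ι * dolK ≤ 1) (hmt : m * exp (1/ι) ≤ t)
    {R : ℝ} (hR : 0 ≤ R) :
    dolAv (D.psi q s m ι t (dolKap q)) R ≤ (1+dolKap q) * q * dolAv (D.wJ q s m ι t) R 
      + (1 - dolKap q) * dolc2 q * dolAv (D.wT q s m ι m) R + (1 - dolKap q) * dolc3 q * ι * dolAv (D.wJ q s m ι m) R := by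
  have hmt' := dol_mt hm hι hmt
  have ht : 0 < t := by linarith
  have k1 := dolKap_pos hq; have k2 := dolKap_le hq
  have c1 := D.wJ_cont (q := q) (ι := ι) hs hm ht; have c2 := D.wT_cont (q := q) (ι := ι) hs hm hm
  have c3 := D.wJ_cont (q := q) (ι := ι) hs hm hm
  rw [← dolAv_smul, ← dolAv_smul, ← dolAv_smul, ← dolAv_add (by fun_prop) (by fun_prop), ← dolAv_add (by fun_prop) (by fun_prop)]
  apply dolAv_mono (D.psi_cont hs hm ht) (by fun_prop) hR
  intro θ
  refine (D.psi_le hq hs hm hι hιK k1 hmt (R,θ)).trans (le_of_eq ?_)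
  have : 1 - dolKap q ≠ 0 := by linarith
  unfold dolc2 dolc3
  field_simp

theorem Av_psi_le (hq : 1 < q) (hs : 0 < s) (hm : 0 < m) (hι : 0 < ι) (hιK : 2 * ι * dolK ≤ 1) (hmt : m * exp (1/ι) ≤ t)
    {R : ℝ} (hR : 0 ≤ R) :
    dolAv (D.psi q s m ι t (dolKap q)) R ≤ 2 * q * D.phi q s m ι t R := by
  refine (D.Av_psi_le' hq hs hm hι hιK hmt hR).trans ?_
  have ht : 0 < t := by linarith [dol_mt hm hι hmt]
  have h1 : 0 ≤ dolAv (D.wJ q s m ι t) R := dolAv_nonneg hR (fun p => D.wJ_nonneg hq ht hι p)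
  have h2 : 0 ≤ dolAv (D.wT q s m ι m) R := dolAv_nonneg hR (fun p => D.wT_nonneg hq hm hι p)
  have h3 : 0 ≤ dolAv (D.wJ q s m ι m) R := dolAv_nonneg hR (fun p => D.wJ_nonneg hq hm hι p)
  have k1 := dolKap_pos hq; have k2 := dolKap_le hq
  have := dolc2_pos hq; have := dolc3_pos hq
  have e : 2 * q * D.phi q s m ι t R = 2 * q * dolAv (D.wJ q s m ι t) R + 2 * q * dolc2 q * dolAv (D.wT q s m ι m) R
   + 2 * q * dolc3 q * ι * dolAv (D.wJ q s m ι m) R := by unfold phi; ring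
  rw [e]
  gcongr <;> linarith

theorem decay1 (hq : 1 < q) (hs : 0 < s) (hm : 0 < m) (hι : 0 < ι) (hιK : 2 * ι * dolK ≤ 1) (hmt : m * exp (1/ι) ≤ t)
    {R : ℝ} (hR : 0 ≤ R) :
    D.Phi q s m ι t R ≤ R / (2 * dolGam q) * D.phi q s m ι t R + (dolc2 q + dolc4 q) * dolCum (D.wT q s m ι m) R 
      + dolc3 q * ι * dolCum (D.wJ q s m ι m) R := by
  have hmt' := dol_mt hm hι hmt
  have ht : 0 < t := by linarith
  have k1 := dolKap_pos hq; have k2 := dolKap_le hq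
  have k3 : 0 < 1 - dolKap q := by linarith
  have p2 := dolc2_pos hq; have p3 := dolc3_pos hq
  have h1 : 0 ≤ dolAv (D.wJ q s m ι t) R := dolAv_nonneg hR (fun p => D.wJ_nonneg hq ht hι p)
  have h2 : 0 ≤ dolAv (D.wT q s m ι m) R := dolAv_nonneg hR (fun p => D.wT_nonneg hq hm hι p)
  have h3 : 0 ≤ dolAv (D.wJ q s m ι m) R := dolAv_nonneg hR (fun p => D.wJ_nonneg hq hm hι p)
  have g1 := D.I_lower hq hs hm hmt' hι k1 hR
  have g2 := D.I_upper hq hs hm hmt' hι hιK k1 R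
  have g3 := D.Av_psi_le' hq hs hm hι hιK hmt hR
  have g4 : dolCum (D.wT q s m ι t) R ≤ (q+1) * dolCum (D.wT q s m ι m) R := by
    rw [← dolCum_smul]
    have c2 := D.wT_cont (q := q) (ι := ι) hs hm hm
    exact dolCum_mono (D.wT_cont hs hm ht) (by fun_prop) hR fun p => D.wT_le hq hs hm hι hιK hmt p
  have e2 := dolE2_pos hq; have e2' := (dolE2_le hq).1
  have g5 : (1 - dolE2 q) * (R * dolAv (D.psi q s m ι t (dolKap q)) R) ≤ 
    R * ((1 - dolKap q) * (q * (1 - dolE2 q / 2)) * dolAv (D.wJ q s m ι t) R 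
      + (1 - dolKap q) * dolc2 q * dolAv (D.wT q s m ι m) R + (1 - dolKap q) * dolc3 q * ι * dolAv (D.wJ q s m ι m) R) := by
    have a0 : 0 ≤ 1 - dolE2 q := by linarith
    have a1 : (1 - dolE2 q) * ((1 + dolKap q) * q) ≤ (1 - dolKap q) * (q * (1 - dolE2 q / 2)) := by
      have : (1 - dolE2 q) * (1 + dolKap q) ≤ (1 - dolKap q) * (1 - dolE2 q / 2) := by
        unfold dolKap; nlinarith
      nlinarith
    have a2 := mul_le_mul_of_nonneg_right a1 h1
    have b1 : 0 ≤ (1 - dolKap q) * dolc2 q * dolAv (D.wT q s m ι m) R := by positivity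
    have b2 : 0 ≤ (1 - dolKap q) * dolc3 q * ι * dolAv (D.wJ q s m ι m) R := by positivity
    have a3 := mul_le_mul_of_nonneg_left g3 a0
    have a4 : (1 - dolE2 q) * dolAv (D.psi q s m ι t (dolKap q)) R ≤ (1 - dolKap q) * (q * (1 - dolE2 q / 2)) * dolAv (D.wJ q s m ι t) R 
      + (1 - dolKap q) * dolc2 q * dolAv (D.wT q s m ι m) R + (1 - dolKap q) * dolc3 q * ι * dolAv (D.wJ q s m ι m) R := by
      nlinarith [mul_nonneg e2.le b1, mul_nonneg e2.le b2]
    have := mul_le_mul_of_nonneg_left a4 hR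
    linarith
  have g6 : 2 * (1 - dolKap q) * dolCum (D.wJ q s m ι t) R ≤ 
    R * ((1 - dolKap q) * (q * (1 - dolE2 q / 2)) * dolAv (D.wJ q s m ι t) R 
      + (1 - dolKap q) * dolc2 q * dolAv (D.wT q s m ι m) R + (1 - dolKap q) * dolc3 q * ι * dolAv (D.wJ q s m ι m) R)
     + 2 / dolKap q * ((q+1) * dolCum (D.wT q s m ι m) R) := by
    have : 2 / dolKap q * dolCum (D.wT q s m ι t) R ≤ 2 / dolKap q * ((q+1) * dolCum (D.wT q s m ι m) R) := by gcongr
    have g2' : D.I q s ι t R ≤ (1 - dolE2 q) * (R * dolAv (D.psi q s m ι t (dolKap q)) R) := g2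
    linarith
  have g7 : dolCum (D.wJ q s m ι t) R ≤ R / 2 * ((q * (1 - dolE2 q / 2)) * dolAv (D.wJ q s m ι t) R 
      + dolc2 q * dolAv (D.wT q s m ι m) R + dolc3 q * ι * dolAv (D.wJ q s m ι m) R) + dolc4 q * dolCum (D.wT q s m ι m) R := by
    rw [← mul_le_mul_iff_right₀ (by linarith : 0 < 2 * (1 - dolKap q))]
    refine g6.trans (le_of_eq ?_)
    unfold dolc4
    field_simp
  have hγ := dolGam_pos hq
  have eγ : R / (2 * dolGam q) = R / 2 * (q * (1 - dolE2 q / 2)) := by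
    unfold dolGam
    have : 1 - dolE2 q / 2 ≠ 0 := by linarith
    field_simp
  have l1 : 1 ≤ q * (1 - dolE2 q / 2) := by
    have := (dolE2_le hq).2; nlinarith
  rw [eγ]
  unfold Phi phi
  have m1 : dolc2 q * dolAv (D.wT q s m ι m) R ≤ (q * (1 - dolE2 q / 2)) * (dolc2 q * dolAv (D.wT q s m ι m) R) :=
    le_mul_of_one_le_left (by positivity) l1
  have m2 : dolc3 q * ι * dolAv (D.wJ q s m ι m) R ≤ (q * (1 - dolE2 q / 2)) * (dolc3 q * ι * dolAv (D.wJ q s m ι m) R) :=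
    le_mul_of_one_le_left (by positivity) l1
  have m3 := mul_le_mul_of_nonneg_left (add_le_add m1 m2) (by positivity : 0 ≤ R / 2)
  linarith

/-- final decay -/
theorem decay (hq : 1 < q) (hs : 0 < s) (hm : 0 < m) (hι : 0 < ι) (hιK : 2 * ι * dolK ≤ 1) (hι1 : ι ≤ 1) (hmt : m * exp (1/ι) ≤ t)
    {C0 η : ℝ} (hη : 0 ≤ η) (hη1 : η ≤ 1) (hC0 : dolCum D.X (3/4) ≤ C0)
    (hT : ∀ R, 0 ≤ R → R ≤ 3/4 → dolCum (D.wT q s m ι m) R ≤ R^2 + η) {R : ℝ} (hR : 0 < R) (hR2 : R ≤ 1/2) :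
    D.Phi q s m ι t R ≤ ((dolc2 q + dolc4 q) * η + dolc3 q * ι * (18 + 32 * q * C0)) +
      (4 * ((q + 1 + dolc3 q) * (18 + 32 * q * C0) + 2 * dolc2 q) + dolGam q / (1 - dolGam q) * (dolc2 q + dolc4 q)) * R ^ (2 * dolGam q) := by
  have hmt' := dol_mt hm hι hmt
  have ht : 0 < t := by linarith
  have p2 := dolc2_pos hq; have p3 := dolc3_pos hq; have p4 := dolc4_pos hq
  have hE : dolCum (D.wJ q s m ι m) (1/2) ≤ 18 + 32 * q * C0 := by
    refine (D.energy hq hs hm hι).trans ?_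
    have := hT (3/4) (by norm_num) le_rfl
    have h2 : 32 * q * dolCum D.X (3/4) ≤ 32 * q * C0 := by gcongr
    norm_num at this
    linarith
  have hE0 : 0 ≤ dolCum (D.wJ q s m ι m) (1/2) := dolCum_nonneg (by norm_num) (fun p => D.wJ_nonneg hq hm hι p)
  set E0 := 18 + 32 * q * C0
  have hE00 : 0 ≤ E0 := hE0.trans hE
  have hPhi : D.Phi q s m ι t (1/2) ≤ (q + 1 + dolc3 q) * E0 + 2 * dolc2 q := by
    have h1 : dolCum (D.wJ q s m ι t) (1/2) ≤ (q+1) * dolCum (D.wJ q s m ι m) (1/2) := by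
      rw [← dolCum_smul]
      have c2 := D.wJ_cont (q := q) (ι := ι) hs hm hm
      exact dolCum_mono (D.wJ_cont hs hm ht) (by fun_prop) (by norm_num) fun p => D.wJ_le hq hs hm hι hιK hmt p
    have h2 : dolCum (D.wT q s m ι m) (1/2) ≤ 2 := by
      have := hT (1/2) (by norm_num) (by norm_num)
      norm_num at this ⊢; linarith
    have h3 : (q+1) * dolCum (D.wJ q s m ι m) (1/2) ≤ (q+1) * E0 := by gcongr
    have h4 : dolc2 q * dolCum (D.wT q s m ι m) (1/2) ≤ dolc2 q * 2 := by gcongr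
    have h5 : dolc3 q * ι * dolCum (D.wJ q s m ι m) (1/2) ≤ dolc3 q * 1 * E0 := by gcongr
    unfold Phi
    linarith
  have hγ := dolGam_pos hq; have hγ1 := dolGam_lt hq
  have := dol_ode (Φ := D.Phi q s m ι t) (g := D.phi q s m ι t) (γ := dolGam q) (D2 := dolc2 q + dolc4 q)
    (η0 := (dolc2 q + dolc4 q) * η + dolc3 q * ι * E0) hγ hγ1 (by positivity) (by positivity)
    (D.Phi_deriv hs hm ht) (D.Phi_nonneg hq hm ht hι (by norm_num)) ?_ hR hR2
  · refine this.trans ?_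
    gcongr
  · intro R hR hR2
    refine (D.decay1 hq hs hm hι hιK hmt hR.le).trans ?_
    have h1 := hT R hR.le (by linarith)
    have h2 := mul_le_mul_of_nonneg_left h1 (by positivity : 0 ≤ dolc2 q + dolc4 q)
    have h3 : dolCum (D.wJ q s m ι m) R ≤ E0 := (dolCum_monoR (D.wJ_cont hs hm hm) (fun p => D.wJ_nonneg hq hm hι p) hR.le hR2).trans hE
    have h4 := mul_le_mul_of_nonneg_left h3 (by positivity : 0 ≤ dolc3 q * ι)
    linarith
end DolPD

theorem dol_norm_int_sq (f : ℝ → ℂ) (hf : Continuous f) :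
    ‖∫ x in (-π)..π, f x‖^2 ≤ 2 * π * ∫ x in (-π)..π, ‖f x‖^2 := by
  have h1 : ‖∫ x in (-π)..π, f x‖ ≤ ∫ x in (-π)..π, ‖f x‖ :=
    intervalIntegral.norm_integral_le_integral_norm (by linarith [pi_pos])
  have h2 := dol_cs (fun x => ‖f x‖) (by fun_prop)
  calc _ ≤ (∫ x in (-π)..π, ‖f x‖)^2 := by gcongr
    _ ≤ _ := h2

theorem dol_swapC (F : ℝ × ℝ → ℂ) (hF : Continuous F) (a b c d : ℝ) :
    ∫ x in a..b, ∫ y in c..d, F (x, y) = ∫ y in c..d, ∫ x in a..b, F (x, y) := by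
  apply intervalIntegral_intervalIntegral_swap (F := fun x y => F (x, y))
  have : IntegrableOn F (Set.uIcc a b ×ˢ Set.uIcc c d) (volume.prod volume) :=
    hF.continuousOn.integrableOn_compact (isCompact_uIcc.prod isCompact_uIcc)
  exact this.mono_set (Set.prod_mono Set.uIoc_subset_uIcc Set.uIoc_subset_uIcc)
theorem dol_par_contC (F : ℝ × ℝ → ℂ) (hF : Continuous F) (c d : ℝ) :
    Continuous (fun x => ∫ y in c..d, F (x, y)) :=
  intervalIntegral.continuous_parametric_intervalIntegral_of_continuous' (f := fun x y => F (x,y)) 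
   (by simpa [Function.uncurry_def] using hF) _ _

namespace DolPD
variable (D : DolPD) {q s m ι t : ℝ}

def Fc (p : ℝ × ℝ) : ℂ := ⟨D.f p, -D.g p⟩
theorem Fc_cont : Continuous D.Fc := dol_mk_cont D.f_cont D.g_cont

theorem Z_close (hq : 1 < q) (hs : 0 < s) (ht : 0 < t) (hι : 0 < ι) (hts : t * exp (1/ι) ≤ s^2) (p : ℝ × ℝ) :
    ‖D.Z q s ι t p - D.Fc p‖ ≤ (q+1) * s := by
  have e : D.Z q s ι t p = (dolT q s t ι (D.X p)) • D.Fc p := by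
    unfold Z Fc Y1 Y2
    apply Complex.ext <;> simp
  have hX : D.X p = ‖D.Fc p‖^2 := by
    unfold Fc; rw [dol_mk_norm_sq]; rfl
  have h := dolT_close hq hs ht hι hts (norm_nonneg (D.Fc p))
  have h1 : dolT q s t ι (D.X p) ≤ 1 := by
    have a1 := dolY_nonneg (t := t) (ι := ι) (D.X p)
    have a2 := dolY_le (t := t) (ι := ι) (D.X p)
    have a3 := (dolG_pos (q := q) hs ht (D.X p)).le
    have a4 := dolG_le hq hs ht (D.X p)
    exact mul_le_one₀ a2 a3 a4
  have e2 : D.Z q s ι t p - D.Fc p = (dolT q s t ι (D.X p) - 1) • D.Fc p := by rw [e, sub_smul, one_smul]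
  rw [e2, norm_smul, Real.norm_eq_abs, abs_of_nonpos (by linarith)]
  rw [hX] at h1 ⊢
  linarith

theorem Av_norm_t (hq : 1 < q) (hs : 0 < s) (hm : 0 < m) (hι : 0 < ι) (hιK : 2 * ι * dolK ≤ 1) (hmt : m * exp (1/ι) ≤ t)
    {r : ℝ} (hr : 0 ≤ r) : (∫ θ in (-π)..π, ‖D.Zt q s ι t (r,θ)‖^2) ≤ r * (2 * q * D.phi q s m ι t r) := by
  have hmt' := dol_mt hm hι hmt
  have ht : 0 < t := by linarith
  have c1 := D.Zt_cont (q := q) hs ht hι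
  have c2 := D.psi_cont (q := q) (ι := ι) (κ := dolKap q) hs hm ht
  have h1 : (∫ θ in (-π)..π, ‖D.Zt q s ι t (r,θ)‖^2) ≤ ∫ θ in (-π)..π, r^2 * D.psi q s m ι t (dolKap q) (r,θ) := by
    apply intervalIntegral.integral_mono (by linarith [pi_pos])
    · exact Continuous.intervalIntegrable (by fun_prop) _ _
    · exact Continuous.intervalIntegrable (by fun_prop) _ _
    · intro θ
      have := D.Yt_sq hq hs hm hmt' hι hιK (dolKap_pos hq) r θ
      unfold Zt; simp only []; rw [dol_mk_norm_sq]; exact this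
  refine h1.trans ?_
  rw [intervalIntegral.integral_const_mul]
  have h2 := D.Av_psi_le hq hs hm hι hιK hmt hr
  unfold dolAv at h2
  have := mul_le_mul_of_nonneg_left h2 hr
  linarith

theorem Av_norm_r (hq : 1 < q) (hs : 0 < s) (hm : 0 < m) (hι : 0 < ι) (hιK : 2 * ι * dolK ≤ 1) (hmt : m * exp (1/ι) ≤ t)
    {r : ℝ} (hr : 0 ≤ r) : r * (∫ θ in (-π)..π, ‖D.Zr q s ι t (r,θ)‖^2) ≤ (2 * q * D.phi q s m ι t r) := by
  have hmt' := dol_mt hm hι hmt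
  have ht : 0 < t := by linarith
  have c1 := D.Zr_cont (q := q) hs ht hι
  have c2 := D.psi_cont (q := q) (ι := ι) (κ := dolKap q) hs hm ht
  have h1 : (∫ θ in (-π)..π, ‖D.Zr q s ι t (r,θ)‖^2) ≤ ∫ θ in (-π)..π, D.psi q s m ι t (dolKap q) (r,θ) := by
    apply intervalIntegral.integral_mono (by linarith [pi_pos])
    · exact Continuous.intervalIntegrable (by fun_prop) _ _
    · exact Continuous.intervalIntegrable (by fun_prop) _ _
    · intro θ
      have := D.Yr_sq hq hs hm hmt' hι hιK (dolKap_pos hq) r θ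
      unfold Zr; simp only []; rw [dol_mk_norm_sq]; exact this
  have h2 := D.Av_psi_le hq hs hm hι hιK hmt hr
  unfold dolAv at h2
  have := mul_le_mul_of_nonneg_left h1 hr
  linarith

def mean (q s ι t : ℝ) (r : ℝ) : ℂ := (1 / (2 * π) : ℝ) • ∫ θ in (-π)..π, D.Z q s ι t (r,θ)

theorem mean_sub (hs : 0 < s) (ht : 0 < t) (hι : 0 < ι) (a b : ℝ) :
    D.mean q s ι t b - D.mean q s ι t a = ∫ r in a..b, (1 / (2 * π) : ℝ) • ∫ θ in (-π)..π, D.Zr q s ι t (r,θ) := by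
  have c1 := D.Zr_cont (q := q) hs ht hι
  have c2 := D.Z_cont (q := q) hs ht hι
  unfold mean
  rw [intervalIntegral.integral_smul, ← smul_sub, dol_swapC _ c1, ← intervalIntegral.integral_sub 
    (Continuous.intervalIntegrable (by fun_prop) _ _) (Continuous.intervalIntegrable (by fun_prop) _ _)]
  congr 1
  apply intervalIntegral.integral_congr
  intro θ _
  exact (intervalIntegral.integral_eq_sub_of_hasDerivAt (fun r _ => D.hZr hs ht hι r θ) 
    (Continuous.intervalIntegrable (by fun_prop) _ _)).symm

set_option maxHeartbeats 800000 in
theorem final (q : ℝ) (hq : 1 < q) (C0 : ℝ) (hC0 : 0 ≤ C0) : ∃ C : ℝ, 0 < C ∧ ∀ s : ℝ, 0 < s → ∀ r0 : ℝ, 0 < r0 → r0 ≤ 1/2 →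
    ∃ ι m η : ℝ, 0 < ι ∧ 0 < m ∧ 0 < η ∧ 2 * ι * dolK ≤ 1 ∧ ∀ D : DolPD, dolCum D.X (3/4) ≤ C0 → 
    (∀ R, 0 ≤ R → R ≤ 3/4 → dolCum (D.wT q s m ι m) R ≤ R^2 + η) → ∀ c0 : ℂ,
    (∀ r θ, 0 ≤ r → r ≤ r0 → θ ∈ Set.Icc (-π) π → ‖D.Fc (r,θ) - c0‖ ≤ s) →
    ∀ lam, r0 ≤ lam → lam ≤ 1/2 → ∀ θ, θ ∈ Set.Icc (-π) π → 
      ∫ r in (0:ℝ)..lam, ‖D.Fc (r,θ) - c0‖ ≤ C * lam * (lam ^ dolGam q + s) := by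
  have p2 := dolc2_pos hq; have p3 := dolc3_pos hq; have p4 := dolc4_pos hq
  have hγ := dolGam_pos hq; have hγ1 := dolGam_lt hq
  set γ := dolGam q
  set E0 := 18 + 32 * q * C0 with hE0
  have hE0p : 0 < E0 := by positivity
  set M := (4 * ((q + 1 + dolc3 q) * E0 + 2 * dolc2 q) + γ / (1 - γ) * (dolc2 q + dolc4 q)) with hM
  have h1γ : 0 < 1 - γ := by linarith
  have hM0 : 0 < M := by positivity
  set k1 := √q
  set k2 := √(4 * π * q)
  have hk1 : 0 < k1 := Real.sqrt_pos.2 (by linarith)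
  have hk2 : 0 < k2 := Real.sqrt_pos.2 (by positivity)
  have hk1s : k1^2 = q := Real.sq_sqrt (by linarith)
  have hk2s : k2^2 = 4 * π * q := Real.sq_sqrt (by positivity)
  have hK := dolK_pos
  refine ⟨(k1 + k2) * (M + 1/γ + 1) + (2 * q + 4), by positivity, ?_⟩
  intro s hs r0 hr0 hr02
  set ι := min 1 (min (1/(2*dolK)) (s * r0 ^ γ / (2 * dolc3 q * E0))) with hι_def
  have hr0γ : 0 < r0 ^ γ := by positivity
  have hι : 0 < ι := by
    refine lt_min one_pos (lt_min ?_ ?_) <;> positivity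
  have hι1 : ι ≤ 1 := min_le_left _ _
  have hιK : 2 * ι * dolK ≤ 1 := by
    have : ι ≤ 1/(2*dolK) := (min_le_right _ _).trans (min_le_left _ _)
    rw [le_div_iff₀ (by positivity)] at this; linarith
  have hι3 : dolc3 q * ι * E0 ≤ s * r0^γ / 2 := by
    have : ι ≤ s * r0 ^ γ / (2 * dolc3 q * E0) := (min_le_right _ _).trans (min_le_right _ _)
    rw [le_div_iff₀ (by positivity)] at this; linarith
  set η := min 1 (s * r0^γ / (2 * (dolc2 q + dolc4 q))) with hη_def
  have hη : 0 < η := by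
    refine lt_min one_pos ?_; positivity
  have hη1 : η ≤ 1 := min_le_left _ _
  have hη3 : (dolc2 q + dolc4 q) * η ≤ s * r0^γ / 2 := by
    have : η ≤ s * r0^γ / (2 * (dolc2 q + dolc4 q)) := min_le_right _ _
    rw [le_div_iff₀ (by positivity)] at this; linarith
  set t := s^2 * exp (-(1/ι)) with ht_def
  set m := t * exp (-(1/ι)) with hm_def
  have ht : 0 < t := by positivity
  have hm : 0 < m := by positivity
  have hts : t * exp (1/ι) ≤ s^2 := by
    rw [ht_def, mul_assoc, ← Real.exp_add]; simp
  have hmt : m * exp (1/ι) ≤ t := by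
    rw [hm_def, mul_assoc, ← Real.exp_add]; simp
  clear_value ι η t m
  refine ⟨ι, m, η, hι, hm, hη, hιK, ?_⟩
  intro D hD hT c0 hF lam hlam0 hlam1 θ hθ
  have hlam : 0 < lam := by linarith
  have hdecay := fun R hR hR2 => D.decay (R := R) hq hs hm hι hιK hι1 hmt hη.le hη1 hD hT hR hR2
  rw [← hE0] at hdecay
  set η0 := (dolc2 q + dolc4 q) * η + dolc3 q * ι * E0 with hη0
  have heta0p : 0 ≤ η0 := by positivity
  have heta0le : η0 * r0 ^ (-γ) ≤ s := by
    rw [Real.rpow_neg hr0.le, ← div_eq_mul_inv, div_le_iff₀ hr0γ]; linarith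
  set Φ := D.Phi q s m ι t
  set g := D.phi q s m ι t
  have hd : ∀ R, HasDerivAt Φ (g R) R := D.Phi_deriv hs hm ht
  have hgc : Continuous g := D.phi_cont hs hm ht
  have hΦc : Continuous Φ := continuous_iff_continuousAt.2 fun x => (hd x).continuousAt
  have hg0 : ∀ R, 0 ≤ R → 0 ≤ g R := fun R hR => D.phi_nonneg hq hm ht hι hR
  set Q := dolQ γ η0 M Φ
  set Q' := dolQd γ η0 M Φ g
  have hQ : ∀ x, 0 < x → HasDerivAt Q (Q' x) x := fun x hx => dolQ_deriv hγ hx (hd x)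
  have hQge : ∀ x a, 0 < x → x ≤ 1/2 → x * a^2 ≤ g x → a ≤ Q' x := fun x a hx hx2 ha =>
    dolQd_ge hγ hx (hdecay x hx hx2) (hg0 x hx.le) ha
  have hQ0 : ∀ x, 0 < x → x ≤ 1/2 → 0 ≤ Q' x := fun x hx hx2 => hQge x 0 hx hx2 (by simpa using hg0 x hx.le)
  have hQc : ∀ b, ContinuousOn Q' (Set.Icc r0 b) := fun b => dolQd_cont hΦc hgc hr0
  have hQint : ∀ b, r0 ≤ b → IntervalIntegrable Q' volume r0 b := fun b hb =>
    ContinuousOn.intervalIntegrable (by rw [Set.uIcc_of_le hb]; exact hQc b)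
  have hQftc : ∀ b, r0 ≤ b → ∫ x in r0..b, Q' x = Q b - Q r0 := fun b hb =>
    intervalIntegral.integral_eq_sub_of_hasDerivAt (fun x hx => hQ x (by 
      rw [Set.uIcc_of_le hb] at hx; exact hr0.trans_le hx.1)) (hQint b hb)
  set dQ := Q lam - Q r0 with hdQ
  have hdQle : dQ ≤ (M + 1/γ + 1) * (lam ^ γ + s) := by
    have h1 := dolQ_diff (M := M) hγ hM0.le heta0p hr0 hlam0 (D.Phi_nonneg (s := s) hq hm ht hι hr0.le) (hdecay lam hlam hlam1)
    have h2 : 0 ≤ lam ^ γ := by positivity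
    have h3 : 0 ≤ (M + 1/γ) * s := by positivity
    change dQ ≤ _ at h1
    linarith
  have hdQ0 : 0 ≤ dQ := by
    rw [hdQ, ← hQftc lam hlam0]
    exact intervalIntegral.integral_nonneg hlam0 fun x hx => hQ0 x (hr0.trans_le hx.1) (hx.2.trans hlam1)
  have hosc : ∀ x, 0 < x → x ≤ 1/2 → ‖D.Z q s ι t (x,θ) - D.mean q s ι t x‖ ≤ x * k2 * Q' x := by
    intro x hx hx2
    have c1 := D.Zt_cont (q := q) hs ht hι
    have h1 := dol_osc (fun θ => D.Z q s ι t (x,θ)) (fun θ => D.Zt q s ι t (x,θ)) (D.hZt hs ht hι x) (by fun_prop) θ hθ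
    have h2 := D.Av_norm_t hq hs hm hι hιK hmt hx.le
    have h3 := hQge x (‖D.Z q s ι t (x,θ) - D.mean q s ι t x‖ / (x * k2)) hx hx2 ?_
    · rwa [div_le_iff₀ (by positivity), mul_comm] at h3
    · rw [div_pow, mul_pow, hk2s, mul_div_assoc', div_le_iff₀ (by positivity)]
      have h4 : ‖D.Z q s ι t (x,θ) - D.mean q s ι t x‖^2 ≤ 2 * π * (x * (2 * q * g x)) := by
        refine h1.trans ?_; gcongr
      calc x * ‖D.Z q s ι t (x,θ) - D.mean q s ι t x‖^2 ≤ x * (2 * π * (x * (2 * q * g x))) := by gcongr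
        _ = _ := by ring
  have hmd : ∀ x, 0 < x → x ≤ 1/2 → ‖(1 / (2 * π) : ℝ) • ∫ θ in (-π)..π, D.Zr q s ι t (x,θ)‖ ≤ k1 * Q' x := by
    intro x hx hx2
    have c1 := D.Zr_cont (q := q) hs ht hι
    have h1 := dol_norm_int_sq (fun θ => D.Zr q s ι t (x,θ)) (by fun_prop)
    have h2 := D.Av_norm_r hq hs hm hι hιK hmt hx.le
    rw [norm_smul, Real.norm_eq_abs, abs_of_nonneg (by positivity)]
    set N := ‖∫ θ in (-π)..π, D.Zr q s ι t (x,θ)‖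
    have h3 := hQge x (1 / (2*π) * N / k1) hx hx2 ?_
    · rwa [div_le_iff₀ (by positivity), mul_comm (Q' x)] at h3
    · rw [div_pow, mul_pow, hk1s, mul_div_assoc', div_le_iff₀ (by linarith)]
      have h4 : x * N^2 ≤ 2 * π * (2 * q * g x) := by
        calc x * N^2 ≤ x * (2 * π * ∫ θ in (-π)..π, ‖D.Zr q s ι t (x,θ)‖^2) := by gcongr
          _ = 2 * π * (x * ∫ θ in (-π)..π, ‖D.Zr q s ι t (x,θ)‖^2) := by ring
          _ ≤ _ := by gcongr
      have e : x * ((1 / (2*π))^2 * N^2) = (1 / (2*π))^2 * (x * N^2) := by ring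
      rw [e]
      have hg := hg0 x hx.le
      calc (1 / (2*π))^2 * (x * N^2) ≤ (1 / (2*π))^2 * (2 * π * (2 * q * g x)) := by gcongr
        _ = (g x * q) / π := by field_simp
        _ ≤ g x * q := by
          apply div_le_self (by positivity); linarith [pi_gt_three]
  have hmean : ∀ x, r0 ≤ x → x ≤ lam → ‖D.mean q s ι t x - D.mean q s ι t r0‖ ≤ k1 * dQ := by
    intro x hx hx2
    rw [D.mean_sub hs ht hι]
    have c1 := D.Zr_cont (q := q) hs ht hι
    have h1 : ‖∫ r in r0..x, (1 / (2 * π) : ℝ) • ∫ θ in (-π)..π, D.Zr q s ι t (r,θ)‖ ≤ ∫ r in r0..x, k1 * Q' r := by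
      apply intervalIntegral.norm_integral_le_of_norm_le hx
      · filter_upwards with r hr
        exact hmd r (hr0.trans hr.1) (by linarith [hr.2])
      · exact (hQint x hx).const_mul _
    refine h1.trans ?_
    rw [intervalIntegral.integral_const_mul, hQftc x hx]
    gcongr
    have h2 : ∫ r in x..lam, Q' r = Q lam - Q x := 
      intervalIntegral.integral_eq_sub_of_hasDerivAt (fun y hy => hQ y (by 
        rw [Set.uIcc_of_le hx2] at hy; exact (hr0.trans_le hx).trans_le hy.1)) ((hQint lam hlam0).mono_set (by
          rw [Set.uIcc_of_le hx2, Set.uIcc_of_le hlam0]; exact Set.Icc_subset_Icc_left hx))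
    have h3 : 0 ≤ ∫ r in x..lam, Q' r := intervalIntegral.integral_nonneg hx2 fun y hy => 
      hQ0 y ((hr0.trans_le hx).trans_le hy.1) (hy.2.trans hlam1)
    linarith
  have hmean0 : ‖D.mean q s ι t r0 - c0‖ ≤ (q+2) * s := by
    have c2 := D.Z_cont (q := q) hs ht hι
    have e : D.mean q s ι t r0 - c0 = (1 / (2 * π) : ℝ) • ∫ θ in (-π)..π, (D.Z q s ι t (r0,θ) - c0) := by
      unfold mean
      rw [intervalIntegral.integral_sub (Continuous.intervalIntegrable (by fun_prop) _ _) (by simp), intervalIntegral.integral_const,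
        smul_sub, smul_smul]
      have : (1 / (2 * π) : ℝ) * (π - -π) = 1 := by field_simp; ring
      rw [this, one_smul]
    rw [e, norm_smul, Real.norm_eq_abs, abs_of_nonneg (by positivity)]
    have h1 : ‖∫ θ in (-π)..π, (D.Z q s ι t (r0,θ) - c0)‖ ≤ (q+2) * s * |π - -π| := by
      apply intervalIntegral.norm_integral_le_of_norm_le_const
      intro x hx
      rw [Set.uIoc_of_le (by linarith [pi_pos])] at hx
      have h2 := D.Z_close hq hs ht hι hts (r0,x)
      have h3 := hF r0 x hr0.le le_rfl ⟨hx.1.le, hx.2⟩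
      calc _ = ‖(D.Z q s ι t (r0,x) - D.Fc (r0,x)) + (D.Fc (r0,x) - c0)‖ := by congr 1; ring
        _ ≤ _ := norm_add_le _ _
        _ ≤ _ := by linarith
    have h4 : |π - -π| = 2 * π := by rw [abs_of_pos] <;> linarith [pi_pos]
    rw [h4] at h1
    calc _ ≤ 1/(2*π) * ((q+2) * s * (2*π)) := by gcongr
      _ = _ := by field_simp
  have hpt : ∀ x, x ∈ Set.Icc r0 lam → ‖D.Fc (x,θ) - c0‖ ≤ lam * k2 * Q' x + (k1 * dQ + (2*q+3) * s) := by
    intro x hx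
    have hx0 := hr0.trans_le hx.1
    have a1 := D.Z_close hq hs ht hι hts (x,θ)
    have a2 := hosc x hx0 (hx.2.trans hlam1)
    have a3 := hmean x hx.1 hx.2
    have a4 : x * k2 * Q' x ≤ lam * k2 * Q' x := by
      have := hQ0 x hx0 (hx.2.trans hlam1)
      gcongr; exact hx.2
    calc _ = ‖-(D.Z q s ι t (x,θ) - D.Fc (x,θ)) + (D.Z q s ι t (x,θ) - D.mean q s ι t x) 
          + (D.mean q s ι t x - D.mean q s ι t r0) + (D.mean q s ι t r0 - c0)‖ := by congr 1; ring
      _ ≤ _ := norm_add₄_le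
      _ ≤ _ := by rw [norm_neg]; linarith
  have cF := D.Fc_cont
  have hi : ∀ a b, IntervalIntegrable (fun r => ‖D.Fc (r,θ) - c0‖) volume a b := fun a b => 
    Continuous.intervalIntegrable (by fun_prop) _ _
  rw [← intervalIntegral.integral_add_adjacent_intervals (hi 0 r0) (hi r0 lam)]
  have i1 : ∫ r in (0:ℝ)..r0, ‖D.Fc (r,θ) - c0‖ ≤ lam * s := by
    have : ∫ r in (0:ℝ)..r0, ‖D.Fc (r,θ) - c0‖ ≤ ∫ r in (0:ℝ)..r0, s := 
      intervalIntegral.integral_mono_on hr0.le (hi _ _) (by simp) fun r hr => hF r θ hr.1 hr.2 hθ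
    rw [intervalIntegral.integral_const, smul_eq_mul, sub_zero] at this
    exact this.trans (mul_le_mul_of_nonneg_right hlam0 hs.le)
  have i2 : ∫ r in r0..lam, ‖D.Fc (r,θ) - c0‖ ≤ lam * k2 * dQ + lam * (k1 * dQ + (2*q+3) * s) := by
    have : ∫ r in r0..lam, ‖D.Fc (r,θ) - c0‖ ≤ ∫ r in r0..lam, (lam * k2 * Q' r + (k1 * dQ + (2*q+3) * s)) := 
      intervalIntegral.integral_mono_on hlam0 (hi _ _) (((hQint lam hlam0).const_mul _).add (by simp)) hpt
    refine this.trans ?_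
    rw [intervalIntegral.integral_add ((hQint lam hlam0).const_mul _) (by simp), intervalIntegral.integral_const_mul, hQftc lam hlam0,
      intervalIntegral.integral_const, smul_eq_mul]
    have : 0 ≤ k1 * dQ + (2*q+3)*s := by positivity
    gcongr; linarith
  have hl : 0 ≤ lam ^ γ := by positivity
  calc _ ≤ lam * ((k1 + k2) * dQ + (2*q+4) * s) := by linarith
    _ ≤ lam * ((k1 + k2) * ((M + 1/γ + 1) * (lam ^ γ + s)) + (2*q+4) * (lam^γ + s)) := by
      gcongr; linarith
    _ = _ := by ring
end DolPD

abbrev DolE := EuclideanSpace ℝ (Fin 2)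
def dolP (p : ℝ × ℝ) : DolE := !₂[p.1 * cos p.2, p.1 * sin p.2]

theorem dolP_norm (p : ℝ × ℝ) : ‖dolP p‖ = |p.1| := by
  rw [EuclideanSpace.norm_eq]
  simp only [Fin.sum_univ_two, dolP, Real.norm_eq_abs, sq_abs]
  simp
  have : (p.1 * cos p.2)^2 + (p.1 * sin p.2)^2 = p.1^2 := by
    have := sin_sq_add_cos_sq p.2
    linear_combination p.1^2 * this
  rw [this, Real.sqrt_sq_eq_abs]

def dolPair (p : ℝ × ℝ) : DolE := !₂[p.1, p.2]
theorem dolPair_mp : MeasurePreserving dolPair := by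
  have h1 := (volume_preserving_finTwoArrow ℝ).symm
  have h2 := EuclideanSpace.volume_preserving_symm_measurableEquiv_toLp (Fin 2)
  have h3 := h2.symm.comp h1
  exact h3
theorem dolPair_emb : MeasurableEmbedding dolPair := by
  have : dolPair = (MeasurableEquiv.finTwoArrow (α := ℝ)).symm.trans (MeasurableEquiv.toLp 2 (Fin 2 → ℝ)) := by
    ext p; rfl
  rw [this]
  exact MeasurableEquiv.measurableEmbedding _

theorem dolP_cont : Continuous dolP := by
  unfold dolP
  fun_prop

theorem dol_polar (h : DolE → ℝ) (hh : Continuous h) {R : ℝ} (hR : 0 ≤ R) :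
    dolCum (fun p => h (dolP p)) R = ∫ x in ball (0:DolE) R, h x := by
  rw [← integral_indicator measurableSet_ball, ← dolPair_mp.integral_comp dolPair_emb, ← integral_comp_polarCoord_symm]
  have e : ∀ p : ℝ × ℝ, dolPair (polarCoord.symm p) = dolP p := by
    intro p; simp [polarCoord, dolPair, dolP]
  simp_rw [e]
  rw [polarCoord_target]
  have e2 : ∫ p in Set.Ioi (0:ℝ) ×ˢ Set.Ioo (-π) π, p.1 • (ball (0:DolE) R).indicator h (dolP p)
      = ∫ p in Set.Ioo (0:ℝ) R ×ˢ Set.Ioo (-π) π, p.1 * h (dolP p) := by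
    rw [← integral_indicator (measurableSet_Ioi.prod measurableSet_Ioo), ← integral_indicator (measurableSet_Ioo.prod measurableSet_Ioo)]
    congr 1; ext p
    by_cases h1 : p ∈ Set.Ioo (0:ℝ) R ×ˢ Set.Ioo (-π) π
    · rw [Set.indicator_of_mem h1, Set.indicator_of_mem (show p ∈ Set.Ioi (0:ℝ) ×ˢ Set.Ioo (-π) π from ⟨h1.1.1, h1.2⟩)]
      rw [Set.indicator_of_mem, smul_eq_mul]
      rw [mem_ball_zero_iff, dolP_norm, abs_of_pos h1.1.1]; exact h1.1.2
    · rw [Set.indicator_of_notMem h1]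
      by_cases h2 : p ∈ Set.Ioi (0:ℝ) ×ˢ Set.Ioo (-π) π
      · rw [Set.indicator_of_mem h2, Set.indicator_of_notMem, smul_zero]
        rw [mem_ball_zero_iff, dolP_norm, abs_of_pos h2.1]
        intro h3; exact h1 ⟨⟨h2.1, h3⟩, h2.2⟩
      · rw [Set.indicator_of_notMem h2]
  rw [e2]
  have hc := dolP_cont
  have hcont : Continuous fun p : ℝ × ℝ => p.1 * h (dolP p) := by fun_prop
  rw [Measure.volume_eq_prod, setIntegral_prod]
  · unfold dolCum
    rw [intervalIntegral.integral_of_le hR, integral_Ioc_eq_integral_Ioo]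
    apply setIntegral_congr_fun measurableSet_Ioo
    intro r _
    simp only [dolAv]
    rw [intervalIntegral.integral_of_le (by linarith [pi_pos]), integral_Ioc_eq_integral_Ioo, ← integral_const_mul]
  · exact (hcont.continuousOn.integrableOn_compact (isCompact_Icc.prod isCompact_Icc)).mono_set 
      (Set.prod_mono Set.Ioo_subset_Icc_self Set.Ioo_subset_Icc_self)

theorem dolP_surj (x : DolE) : ∃ θ ∈ Set.Icc (-π) π, x = dolP (‖x‖, θ) := by
  refine ⟨Complex.arg ⟨x 0, x 1⟩, ⟨(Complex.neg_pi_lt_arg _).le, Complex.arg_le_pi _⟩, ?_⟩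
  have hn : ‖x‖ = ‖(⟨x 0, x 1⟩ : ℂ)‖ := by
    rw [EuclideanSpace.norm_eq, Complex.norm_def, Complex.normSq_apply]
    simp [Fin.sum_univ_two, pow_two]
  unfold dolP
  simp only [hn]
  rw [Complex.norm_mul_cos_arg, Complex.norm_mul_sin_arg]
  ext i; fin_cases i <;> simp

def dole0 : DolE := !₂[1, 0]
def dole1 : DolE := !₂[0, 1]
/-- second partials -/
def dolHs (v : DolE → ℝ) (x a b : DolE) : ℝ := fderiv ℝ (fun y => fderiv ℝ v y a) x b

theorem dolGd_contDiff {v : DolE → ℝ} (hv : ContDiff ℝ (⊤ : ℕ∞) v) (a : DolE) :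
    ContDiff ℝ (⊤ : ℕ∞) (fun y => fderiv ℝ v y a) :=
  (hv.fderiv_right (m := (⊤ : ℕ∞)) (by simp)).clm_apply contDiff_const

theorem dolHs_cont {v : DolE → ℝ} (hv : ContDiff ℝ (⊤ : ℕ∞) v) (a b : DolE) :
    Continuous (fun y => dolHs v y a b) :=
  (dolGd_contDiff (dolGd_contDiff hv a) b).continuous

theorem dolHs_symm {v : DolE → ℝ} (hv : ContDiff ℝ (⊤ : ℕ∞) v) (x a b : DolE) :
    dolHs v x a b = dolHs v x b a := by
  have h : IsSymmSndFDerivAt ℝ v x := (hv.contDiffAt).isSymmSndFDerivAt (by simp; norm_cast)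
  have hd : DifferentiableAt ℝ (fderiv ℝ v) x := by
    have := (hv.fderiv_right (m := (⊤ : ℕ∞)) (by simp))
    exact this.differentiable (by simp) x
  have e : ∀ a b, dolHs v x a b = fderiv ℝ (fderiv ℝ v) x b a := by
    intro a b
    unfold dolHs
    rw [fderiv_clm_apply hd (by fun_prop)]
    simp
  rw [e, e]; exact h b a

theorem dolP_eq (r θ : ℝ) : dolP (r, θ) = r • (cos θ • dole0 + sin θ • dole1) := by
  ext i; fin_cases i <;> simp [dolP, dole0, dole1]

theorem dolP_dr (r θ : ℝ) : HasDerivAt (fun r => dolP (r, θ)) (cos θ • dole0 + sin θ • dole1) r := by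
  simp_rw [dolP_eq]
  have := (hasDerivAt_id r).smul_const (cos θ • dole0 + sin θ • dole1)
  simpa using this

theorem dolP_dt (r θ : ℝ) : HasDerivAt (fun θ => dolP (r, θ)) (r • (-sin θ • dole0 + cos θ • dole1)) θ := by
  simp_rw [dolP_eq]
  exact (((hasDerivAt_cos θ).smul_const dole0).add ((hasDerivAt_sin θ).smul_const dole1)).const_smul r

theorem dolP_smooth : ContDiff ℝ (⊤ : ℕ∞) dolP := by
  have : dolP = fun p : ℝ × ℝ => p.1 • (cos p.2 • dole0 + sin p.2 • dole1) := by
    ext1 p; exact dolP_eq p.1 p.2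
  rw [this]; fun_prop

def dolPDof (v : DolE → ℝ) (hv : ContDiff ℝ (⊤ : ℕ∞) v) : DolPD where
  f p := fderiv ℝ v (dolP p) dole0
  g p := fderiv ℝ v (dolP p) dole1
  A p := dolHs v (dolP p) dole0 dole0
  B' p := dolHs v (dolP p) dole0 dole1
  C p := dolHs v (dolP p) dole1 dole1
  hf := ((dolGd_contDiff hv dole0).comp dolP_smooth).of_le (by norm_cast)
  hg := ((dolGd_contDiff hv dole1).comp dolP_smooth).of_le (by norm_cast)
  hA := (dolHs_cont hv _ _).comp dolP_cont
  hB := (dolHs_cont hv _ _).comp dolP_cont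
  hC := (dolHs_cont hv _ _).comp dolP_cont
  fr r θ := by
    have h := ((dolGd_contDiff hv dole0).differentiable (by simp) (dolP (r,θ))).hasFDerivAt.comp_hasDerivAt r (dolP_dr r θ)
    refine h.congr_deriv ?_
    simp only [map_add, map_smul, smul_eq_mul, dolHs]; ring
  ft r θ := by
    have h := ((dolGd_contDiff hv dole0).differentiable (by simp) (dolP (r,θ))).hasFDerivAt.comp_hasDerivAt θ (dolP_dt r θ)
    refine h.congr_deriv ?_
    simp only [map_add, map_smul, smul_eq_mul, dolHs]; ring
  gr r θ := by
    have h := ((dolGd_contDiff hv dole1).differentiable (by simp) (dolP (r,θ))).hasFDerivAt.comp_hasDerivAt r (dolP_dr r θ)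
    refine h.congr_deriv ?_
    rw [dolHs_symm hv _ dole0 dole1]
    simp only [map_add, map_smul, smul_eq_mul, dolHs]; ring
  gt r θ := by
    have h := ((dolGd_contDiff hv dole1).differentiable (by simp) (dolP (r,θ))).hasFDerivAt.comp_hasDerivAt θ (dolP_dt r θ)
    refine h.congr_deriv ?_
    rw [dolHs_symm hv _ dole0 dole1]
    simp only [map_add, map_smul, smul_eq_mul, dolHs]; ring
  pf r := by simp [dolP]
  pg r := by simp [dolP]

theorem dolE_eta (a : DolE) : a = a 0 • dole0 + a 1 • dole1 := by
  ext i; fin_cases i <;> simp [dole0, dole1]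
theorem dolE_inner (a b : DolE) : ⟪a, b⟫ = a 0 * b 0 + a 1 * b 1 := by
  simp [PiLp.inner_apply, Fin.sum_univ_two]; ring
theorem dolE_norm_sq (a : DolE) : ‖a‖^2 = a 0 ^2 + a 1 ^2 := by
  rw [← real_inner_self_eq_norm_sq, dolE_inner]; ring
theorem dolE_grad0 (v : DolE → ℝ) (x : DolE) : fderiv ℝ v x dole0 = gradient v x 0 := by
  have : fderiv ℝ v x dole0 = ⟪gradient v x, dole0⟫ := by
    unfold gradient; rw [InnerProductSpace.toDual_symm_apply]
  rw [this, dolE_inner]; simp [dole0]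
theorem dolE_grad1 (v : DolE → ℝ) (x : DolE) : fderiv ℝ v x dole1 = gradient v x 1 := by
  have : fderiv ℝ v x dole1 = ⟪gradient v x, dole1⟫ := by
    unfold gradient; rw [InnerProductSpace.toDual_symm_apply]
  rw [this, dolE_inner]; simp [dole1]
theorem dol_fderiv_eq (v : DolE → ℝ) (x w : DolE) : fderiv ℝ v x w = ⟪gradient v x, w⟫ := by
  unfold gradient; rw [InnerProductSpace.toDual_symm_apply]
theorem dol_norm_grad (v : DolE → ℝ) (x : DolE) : ‖gradient v x‖ = ‖fderiv ℝ v x‖ := by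
  unfold gradient; simp

/-- line-integral Taylor estimate -/
theorem dolPD_taylor (v : DolE → ℝ) (hv : ContDiff ℝ (⊤ : ℕ∞) v) {lam : ℝ} (x : DolE) (hx : ‖x‖ ≤ lam)
    (K : ℝ) (hK : ∀ θ ∈ Set.Icc (-π) π, ∫ r in (0:ℝ)..lam, ‖(dolPDof v hv).Fc (r,θ) - (⟨gradient v 0 0, - gradient v 0 1⟩ : ℂ)‖ ≤ K) :
    |v x - (v 0 + ⟪gradient v 0, x⟫)| ≤ K := by
  obtain ⟨θ, hθ, hxe⟩ := dolP_surj x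
  have hx0 := norm_nonneg x
  set e : DolE := cos θ • dole0 + sin θ • dole1 with he
  have hxe' : x = ‖x‖ • e := by rw [he, ← dolP_eq]; exact hxe
  have he1 : ‖e‖ ≤ 1 := by
    have h1 : ‖e‖^2 = 1 := by
      rw [dolE_norm_sq, he]; simp [dole0, dole1]
    nlinarith [norm_nonneg e]
  have hd : ∀ r, HasDerivAt (fun r => v (dolP (r,θ)) - r * ⟪gradient v 0, e⟫) (⟪gradient v (dolP (r,θ)) - gradient v 0, e⟫) r := by
    intro r
    have h := ((hv.differentiable (by simp) (dolP (r,θ))).hasFDerivAt.comp_hasDerivAt r (dolP_dr r θ)).sub ((hasDerivAt_id r).mul_const ⟪gradient v 0, e⟫)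
    refine h.congr_deriv ?_
    rw [dol_fderiv_eq, inner_sub_left]; simp [he]
  have hgc : Continuous (gradient v) := by
    unfold gradient
    exact (InnerProductSpace.toDual ℝ DolE).symm.continuous.comp (hv.continuous_fderiv (by simp))
  have hgc2 : Continuous fun r => gradient v (dolP (r,θ)) := by
    have := dolP_cont
    exact hgc.comp (this.comp (by fun_prop))
  have hcont : Continuous fun r => ⟪gradient v (dolP (r,θ)) - gradient v 0, e⟫ := by fun_prop
  have hintg := intervalIntegral.integral_eq_sub_of_hasDerivAt (a := 0) (b := ‖x‖) (fun r _ => hd r) (hcont.intervalIntegrable _ _)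
  have h00 : dolP (0,θ) = 0 := by rw [dolP_eq]; simp
  have hn : ∀ r, ‖(dolPDof v hv).Fc (r,θ) - (⟨gradient v 0 0, - gradient v 0 1⟩ : ℂ)‖ = ‖gradient v (dolP (r,θ)) - gradient v 0‖ := by
    intro r
    rw [← sq_eq_sq₀ (norm_nonneg _) (norm_nonneg _), dolE_norm_sq]
    simp only [DolPD.Fc, dolPDof]
    rw [dolE_grad0, dolE_grad1, Complex.sq_norm, Complex.normSq_apply]
    simp; ring
  have key : v x - (v 0 + ⟪gradient v 0, x⟫) = ∫ r in (0:ℝ)..‖x‖, ⟪gradient v (dolP (r,θ)) - gradient v 0, e⟫ := by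
    rw [hintg, h00, ← hxe]
    conv_lhs => rw [show ⟪gradient v 0, x⟫ = ‖x‖ * ⟪gradient v 0, e⟫ by conv_lhs => rw [hxe', real_inner_smul_right]]
    ring
  rw [key]
  refine le_trans ?_ (hK θ hθ)
  simp_rw [hn]
  have hcn : Continuous fun r => ‖gradient v (dolP (r,θ)) - gradient v 0‖ := by fun_prop
  calc |∫ r in (0:ℝ)..‖x‖, ⟪gradient v (dolP (r,θ)) - gradient v 0, e⟫| ≤ ∫ r in (0:ℝ)..‖x‖, |⟪gradient v (dolP (r,θ)) - gradient v 0, e⟫| := intervalIntegral.abs_integral_le_integral_abs hx0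
    _ ≤ ∫ r in (0:ℝ)..‖x‖, ‖gradient v (dolP (r,θ)) - gradient v 0‖ := by
        apply intervalIntegral.integral_mono_on hx0 (hcont.abs.intervalIntegrable _ _) (hcn.intervalIntegrable _ _)
        intro r _
        refine (abs_real_inner_le_norm _ _).trans ?_
        exact mul_le_of_le_one_right (norm_nonneg _) he1
    _ ≤ ∫ r in (0:ℝ)..lam, ‖gradient v (dolP (r,θ)) - gradient v 0‖ := by
        rw [← intervalIntegral.integral_add_adjacent_intervals (hcn.intervalIntegrable 0 ‖x‖) (hcn.intervalIntegrable ‖x‖ lam)]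
        have := intervalIntegral.integral_nonneg (μ := volume) hx (fun r _ => norm_nonneg (gradient v (dolP (r,θ)) - gradient v 0))
        linarith

structure DolMol (M ε : ℝ) (ρ : DolE → ℝ) : Prop where
  smooth : ContDiff ℝ (⊤ : ℕ∞) ρ
  supp : tsupport ρ ⊆ closedBall 0 ε
  nonneg : ∀ x, 0 ≤ ρ x
  int : ∫ x, ρ x = 1
  le : ∀ x, ρ x ≤ M * (ε^2)⁻¹
  fle : ∀ x, ‖fderiv ℝ ρ x‖ ≤ M * (ε^3)⁻¹

theorem dolMol_exists : ∃ M : ℝ, 0 < M ∧ ∀ ε : ℝ, 0 < ε → ∃ ρ, DolMol M ε ρ := by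
  let b : ContDiffBump (0 : DolE) := ⟨1/2, 1, by norm_num, by norm_num⟩
  set r1 := b.normed volume with hr1
  have hs : ContDiff ℝ (⊤ : ℕ∞) r1 := b.contDiff_normed
  have hc : HasCompactSupport r1 := b.hasCompactSupport_normed
  have hts : tsupport r1 = closedBall 0 1 := b.tsupport_normed_eq
  obtain ⟨M1, hM1⟩ := hs.continuous.bounded_above_of_compact_support hc
  obtain ⟨M2, hM2⟩ := (hs.continuous_fderiv (by simp)).bounded_above_of_compact_support (hc.fderiv ℝ)
  refine ⟨max 1 (max M1 M2), by positivity, fun ε hε => ⟨fun y => (ε^2)⁻¹ * r1 (ε⁻¹ • y), ?_⟩⟩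
  have hz : ∀ y : DolE, ε < ‖y‖ → r1 (ε⁻¹ • y) = 0 := by
    intro y hy
    apply image_eq_zero_of_notMem_tsupport
    rw [hts, mem_closedBall_zero_iff, norm_smul, norm_inv, Real.norm_eq_abs, abs_of_pos hε, not_le]
    rw [inv_mul_eq_div, lt_div_iff₀ hε]; linarith
  constructor
  · fun_prop
  · apply closure_minimal _ isClosed_closedBall
    intro y hy
    by_contra h
    rw [mem_closedBall_zero_iff, not_le] at h
    exact hy (by simp [hz y h])
  · intro x; have := b.nonneg_normed (μ := volume) (ε⁻¹ • x); positivity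
  · rw [integral_const_mul, Measure.integral_comp_smul]
    rw [b.integral_normed]
    simp
    field_simp
  · intro x
    have h1 : r1 (ε⁻¹ • x) ≤ max 1 (max M1 M2) := (le_abs_self _).trans ((hM1 _).trans (by simp))
    rw [mul_comm]; gcongr
  · intro x
    have h0 : HasFDerivAt (fun y : DolE => (ε^2)⁻¹ * r1 (ε⁻¹ • y)) ((ε^2)⁻¹ • (fderiv ℝ r1 (ε⁻¹ • x)).comp (ε⁻¹ • ContinuousLinearMap.id ℝ DolE)) x := by
      have h2 : HasFDerivAt (fun y : DolE => ε⁻¹ • y) (ε⁻¹ • ContinuousLinearMap.id ℝ DolE) x := (hasFDerivAt_id x).const_smul ε⁻¹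
      exact ((hs.differentiable (by simp) (ε⁻¹ • x)).hasFDerivAt.comp x h2).const_mul _
    rw [h0.fderiv, ContinuousLinearMap.comp_smul, smul_smul, ContinuousLinearMap.comp_id, norm_smul]
    have h1 := (hM2 (ε⁻¹ • x)).trans (show M2 ≤ max 1 (max M1 M2) by simp)
    rw [Real.norm_eq_abs, abs_of_pos (by positivity), mul_comm, show (ε^3)⁻¹ = (ε^2)⁻¹*ε⁻¹ by field_simp]
    gcongr

namespace DolMol
variable {M ε : ℝ} {ρ : DolE → ℝ}

theorem hcs (h : DolMol M ε ρ) : HasCompactSupport ρ := 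
  HasCompactSupport.of_support_subset_isCompact (isCompact_closedBall 0 ε) ((subset_tsupport ρ).trans h.supp)
theorem zero (h : DolMol M ε ρ) {x : DolE} (hx : ε < ‖x‖) : ρ x = 0 := by
  apply image_eq_zero_of_notMem_tsupport
  intro hh; have := h.supp hh; rw [mem_closedBall_zero_iff] at this; linarith
theorem fzero (h : DolMol M ε ρ) {x : DolE} (hx : ε < ‖x‖) : fderiv ℝ ρ x = 0 := by
  apply image_eq_zero_of_notMem_tsupport
  intro hh; have := h.supp (tsupport_fderiv_subset ℝ hh); rw [mem_closedBall_zero_iff] at this; linarith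
theorem cont (h : DolMol M ε ρ) : Continuous ρ := h.smooth.continuous
theorem fcont (h : DolMol M ε ρ) : Continuous (fderiv ℝ ρ) := h.smooth.continuous_fderiv (by simp)

/-- the averaged continuous map -/
theorem integrable (h : DolMol M ε ρ) {G : Type*} [NormedAddCommGroup G] [NormedSpace ℝ G] {k : DolE → G} (hk : Continuous k) :
    Integrable (fun y => ρ y • k y) :=
  (h.cont.smul hk).integrable_of_hasCompactSupport h.hcs.smul_right

theorem fintegrable (h : DolMol M ε ρ) {k : DolE → DolE} (hk : Continuous k) :
    Integrable (fun y => fderiv ℝ ρ y (k y)) := by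
  have h1 := h.fcont
  apply Continuous.integrable_of_hasCompactSupport (by fun_prop)
  apply HasCompactSupport.intro (isCompact_closedBall (0:DolE) ε)
  intro x hx
  rw [mem_closedBall_zero_iff, not_le] at hx
  rw [h.fzero hx]; rfl

theorem fint_const (h : DolMol M ε ρ) (w : DolE) : ∫ y, fderiv ℝ ρ y w = 0 := by
  have := integral_mul_fderiv_eq_neg_fderiv_mul_of_integrable (𝕜 := ℝ) (μ := (volume : Measure DolE)) (f := fun _ => (1:ℝ)) (g := ρ) (v := w) (by simp) 
    (by simpa using h.fintegrable continuous_const) (by simpa using h.integrable (k := fun _ => (1:ℝ)) continuous_const) (by fun_prop) (fun x _ => h.smooth.differentiable (by simp) x)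
  simpa using this

theorem norm_sub_le (h : DolMol M ε ρ) {G : Type*} [NormedAddCommGroup G] [NormedSpace ℝ G] [CompleteSpace G] {k : DolE → G} (hk : Continuous k) (c : G) :
    ‖(∫ y, ρ y • k y) - c‖ ≤ M * (ε^2)⁻¹ * ∫ y in closedBall 0 ε, ‖k y - c‖ := by
  have e1 : (∫ y, ρ y • k y) - c = ∫ y, ρ y • (k y - c) := by
    simp_rw [smul_sub]
    rw [integral_sub (h.integrable hk) (h.integrable continuous_const), integral_smul_const, h.int, one_smul]
  rw [e1, ← integral_const_mul, ← integral_indicator measurableSet_closedBall]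
  apply norm_integral_le_of_norm_le
  · rw [integrable_indicator_iff measurableSet_closedBall]
    exact (Continuous.continuousOn (by fun_prop)).integrableOn_compact (isCompact_closedBall _ _)
  · refine Filter.Eventually.of_forall fun y => ?_
    by_cases hy : y ∈ closedBall (0:DolE) ε
    · rw [Set.indicator_of_mem hy, norm_smul, Real.norm_eq_abs, abs_of_nonneg (h.nonneg y)]
      have := h.le y
      gcongr
    · rw [Set.indicator_of_notMem hy]
      rw [mem_closedBall_zero_iff, not_le] at hy
      rw [h.zero hy]; simp

theorem norm_sub_le_sup (h : DolMol M ε ρ) {G : Type*} [NormedAddCommGroup G] [NormedSpace ℝ G] [CompleteSpace G] {k : DolE → G} (hk : Continuous k) (c : G) {e : ℝ}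
    (he : ∀ y, ‖y‖ ≤ ε → ‖k y - c‖ ≤ e) :
    ‖(∫ y, ρ y • k y) - c‖ ≤ e := by
  have e1 : (∫ y, ρ y • k y) - c = ∫ y, ρ y • (k y - c) := by
    simp_rw [smul_sub]
    rw [integral_sub (h.integrable hk) (h.integrable continuous_const), integral_smul_const, h.int, one_smul]
  have e2 : e = ∫ y, ρ y * e := by rw [integral_mul_const, h.int, one_mul]
  rw [e1, e2]
  apply norm_integral_le_of_norm_le
  · exact h.integrable (k := fun _ => e) continuous_const
  · refine Filter.Eventually.of_forall fun y => ?_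
    by_cases hy : ‖y‖ ≤ ε
    · rw [norm_smul, Real.norm_eq_abs, abs_of_nonneg (h.nonneg y)]
      exact mul_le_mul_of_nonneg_left (he y hy) (h.nonneg y)
    · rw [h.zero (not_le.1 hy)]; simp

theorem fint_le (h : DolMol M ε ρ) {k : DolE → DolE} {j : DolE → ℝ} (hj : Continuous j) (hkj : ∀ y, ‖y‖ ≤ ε → ‖k y‖ ≤ j y) :
    |∫ y, fderiv ℝ ρ y (k y)| ≤ M * (ε^3)⁻¹ * ∫ y in closedBall 0 ε, j y := by
  rw [← integral_const_mul, ← integral_indicator measurableSet_closedBall, ← Real.norm_eq_abs]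
  apply norm_integral_le_of_norm_le
  · rw [integrable_indicator_iff measurableSet_closedBall]
    exact (Continuous.continuousOn (by fun_prop)).integrableOn_compact (isCompact_closedBall _ _)
  · refine Filter.Eventually.of_forall fun y => ?_
    by_cases hy : y ∈ closedBall (0:DolE) ε
    · rw [Set.indicator_of_mem hy]
      rw [mem_closedBall_zero_iff] at hy
      have := h.fle y
      have h2 := hkj y hy
      have h3 := (norm_nonneg _).trans this
      exact (ContinuousLinearMap.le_opNorm _ _).trans (mul_le_mul this h2 (norm_nonneg _) h3)
    · rw [Set.indicator_of_notMem hy]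
      rw [mem_closedBall_zero_iff, not_le] at hy
      rw [h.fzero hy]; simp
end DolMol

/-- mollification -/
def dolMv (ρ U : DolE → ℝ) : DolE → ℝ := convolution ρ U (ContinuousLinearMap.lsmul ℝ ℝ) volume
theorem dolMv_eq (ρ U : DolE → ℝ) (x : DolE) : dolMv ρ U x = ∫ y, ρ y • U (x - y) := by
  simp [dolMv, convolution]

theorem dolMv_smooth {ρ U : DolE → ℝ} (hρ : ContDiff ℝ (⊤ : ℕ∞) ρ) (hρc : HasCompactSupport ρ) (hU : Continuous U) :
    ContDiff ℝ (⊤ : ℕ∞) (dolMv ρ U) :=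
  hρc.contDiff_convolution_left _ hρ hU.locallyIntegrable

theorem dolMv_fderiv {ρ U : DolE → ℝ} (hρ : Continuous ρ) (hU : ContDiff ℝ 1 U) (hUc : HasCompactSupport U) (x w : DolE) :
    fderiv ℝ (dolMv ρ U) x w = dolMv ρ (fun y => fderiv ℝ U y w) x := by
  have := (hUc.hasFDerivAt_convolution_right (ContinuousLinearMap.lsmul ℝ ℝ) hρ.locallyIntegrable hU x (μ := volume))
  rw [dolMv, this.fderiv, convolution_precompR_apply _ hρ.locallyIntegrable (hUc.fderiv ℝ) (hU.continuous_fderiv (by simp))]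
  rfl

theorem dolMv_fderiv_left {ρ U : DolE → ℝ} (hρ : ContDiff ℝ (⊤ : ℕ∞) ρ) (hρc : HasCompactSupport ρ) (hU : Continuous U) (x w : DolE) :
    fderiv ℝ (dolMv ρ U) x w = dolMv (fun y => fderiv ℝ ρ y w) U x := by
  have := (hρc.hasFDerivAt_convolution_left (ContinuousLinearMap.lsmul ℝ ℝ) (hρ.of_le (by simp)) hU.locallyIntegrable x (μ := volume))
  rw [dolMv, this.fderiv]
  have hi : Integrable (fun t => (ContinuousLinearMap.precompL DolE (ContinuousLinearMap.lsmul ℝ ℝ)) (fderiv ℝ ρ t) (U (x - t))) := by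
    have h1 := hρ.continuous_fderiv (by simp)
    apply Continuous.integrable_of_hasCompactSupport
    · fun_prop
    · apply HasCompactSupport.intro (hρc.fderiv ℝ)
      intro t ht
      rw [image_eq_zero_of_notMem_tsupport ht]; simp
  rw [convolution, ContinuousLinearMap.integral_apply hi]
  rfl

def dolAf (q : ℝ) (a : DolE) : DolE := ‖a‖^(q-1) • a
def dolDA (q : ℝ) (a : DolE) : DolE →L[ℝ] DolE :=
  ‖a‖^(q-1) • ContinuousLinearMap.id ℝ DolE + ((q-1) * ‖a‖^(q-3)) • (innerSL ℝ a).smulRight a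

theorem dolDA_apply (q : ℝ) (a x : DolE) : dolDA q a x = ‖a‖^(q-1) • x + ((q-1) * ‖a‖^(q-3) * ⟪a, x⟫) • a := by
  simp [dolDA, smul_smul]

theorem dolAf_cont {q : ℝ} (hq : 1 < q) : Continuous (dolAf q) := by
  unfold dolAf
  exact (continuous_norm.rpow_const (fun x => Or.inr (by linarith))).smul continuous_id

theorem dolAf_norm {q : ℝ} (hq : 1 < q) (a : DolE) : ‖dolAf q a‖ = ‖a‖^q := by
  unfold dolAf
  rw [norm_smul, Real.norm_eq_abs, abs_of_nonneg (by positivity)]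
  rcases eq_or_ne a 0 with rfl | h
  · simp; rw [zero_rpow (by linarith)]
  · have : 0 < ‖a‖ := norm_pos_iff.2 h
    rw [← rpow_add_one this.ne']; ring_nf

theorem dolAf_deriv {q : ℝ} {a : DolE} (ha : a ≠ 0) : HasFDerivAt (dolAf q) (dolDA q a) a := by
  have hpos : 0 < ‖a‖ := norm_pos_iff.2 ha
  have h1 : HasFDerivAt (fun x : DolE => ‖x‖^2) (2 • (innerSL ℝ a)) a := (hasStrictFDerivAt_norm_sq a).hasFDerivAt
  have h2 : HasFDerivAt (fun x : DolE => (‖x‖^2)^((q-1)/2)) ((((q-1)/2) * (‖a‖^2)^((q-1)/2-1)) • (2 • (innerSL ℝ a))) a :=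
    h1.rpow_const (Or.inl (by positivity))
  have e : ∀ x : DolE, ∀ c : ℝ, (‖x‖^2)^(c/2) = ‖x‖^c := by
    intro x c
    rw [← rpow_natCast, ← rpow_mul (norm_nonneg x)]; congr 1; push_cast; ring
  have h3 := h2.smul (hasFDerivAt_id a)
  have e2 : (fun x : DolE => (‖x‖^2)^((q-1)/2)) • (id : DolE → DolE) = dolAf q := by
    ext1 x; simp only [Pi.smul_apply', id]; rw [e]; rfl
  rw [e2] at h3
  refine h3.congr_fderiv ?_
  ext1 x
  rw [dolDA_apply, show (q-1)/2-1 = (q-3)/2 by ring, e, e]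
  simp [smul_smul]
  ring_nf

theorem dolDA_cont {q : ℝ} : ContinuousOn (dolDA q) {a | a ≠ 0} := by
  unfold dolDA
  have h : ∀ c : ℝ, ContinuousOn (fun a : DolE => ‖a‖^c) {a | a ≠ 0} := by
    intro c
    exact continuous_norm.continuousOn.rpow_const (fun x hx => Or.inl (norm_ne_zero_iff.2 hx))
  have h2 : Continuous fun a : DolE => (innerSL ℝ a).smulRight a := by
    have : Continuous fun a : DolE => ((innerSL ℝ a), a) := by fun_prop
    exact (ContinuousLinearMap.smulRightL ℝ DolE DolE).continuous₂.comp this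
  exact ((h _).smul continuousOn_const).add ((continuousOn_const.mul (h _)).smul h2.continuousOn)

theorem dolAf_unif {q t L ω : ℝ} (ht : 0 < t) (hω : 0 < ω) : ∃ κ, 0 < κ ∧ ∀ a b : DolE, t ≤ ‖a‖ → ‖a‖ ≤ L → ‖b - a‖ ≤ κ →
    ‖dolAf q b - dolAf q a - dolDA q a (b - a)‖ ≤ ω * ‖b - a‖ := by
  set K : Set DolE := closedBall 0 (L+t) ∩ {a | t/2 ≤ ‖a‖} with hK
  have hKc : IsCompact K := (isCompact_closedBall _ _).inter_right (isClosed_le continuous_const continuous_norm)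
  have hK0 : K ⊆ {a | a ≠ 0} := by
    intro a ha h0
    have h2 : t/2 ≤ ‖a‖ := ha.2
    rw [h0, norm_zero] at h2; linarith
  have hu := hKc.uniformContinuousOn_of_continuous (dolDA_cont (q := q) |>.mono hK0)
  rw [Metric.uniformContinuousOn_iff_le] at hu
  obtain ⟨κ, hκ, hu⟩ := hu ω hω
  refine ⟨min κ (t/2), by positivity, fun a b h1 h2 h3 => ?_⟩
  have hin : ∀ x ∈ closedBall a (min κ (t/2)), x ∈ K := by
    intro x hx
    rw [mem_closedBall, dist_eq_norm] at hx
    have hx2 := hx.trans (min_le_right _ _)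
    have hl := norm_sub_norm_le a x
    rw [norm_sub_rev] at hl
    have hl2 := norm_sub_norm_le x a
    refine ⟨?_, ?_⟩
    · rw [mem_closedBall_zero_iff]; linarith
    · show t/2 ≤ ‖x‖; linarith
  have ha : a ∈ closedBall a (min κ (t/2)) := mem_closedBall_self (by positivity)
  apply (convex_closedBall a (min κ (t/2))).norm_image_sub_le_of_norm_hasFDerivWithin_le' (f := dolAf q) (f' := dolDA q) 
    (fun x hx => (dolAf_deriv (hK0 (hin x hx))).hasFDerivWithinAt) (fun x hx => ?_) ha (by rw [mem_closedBall, dist_eq_norm]; exact h3)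
  rw [← dist_eq_norm]
  exact hu x (hin x hx) a (hin a ha) ((mem_closedBall.1 hx).trans (min_le_left _ _))

theorem dolDA_norm_le {q : ℝ} (hq : 1 < q) {a x : DolE} (ha : 0 < ‖a‖) : ‖dolDA q a x‖ ≤ q * ‖a‖^(q-1) * ‖x‖ := by
  have hcc : 0 ≤ (q-1) * ‖a‖^(q-3) := mul_nonneg (by linarith) (by positivity)
  rw [dolDA_apply]
  refine (norm_add_le _ _).trans ?_
  rw [norm_smul, norm_smul, Real.norm_eq_abs, Real.norm_eq_abs, abs_of_nonneg (by positivity), abs_mul, abs_of_nonneg hcc]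
  have h1 := abs_real_inner_le_norm a x
  have h2 : ‖a‖^(q-1) = ‖a‖^(q-3) * ‖a‖ * ‖a‖ := by
    rw [← rpow_add_one ha.ne', ← rpow_add_one ha.ne']; congr 1; ring
  have h3 : (q-1) * ‖a‖^(q-3) * |⟪a,x⟫| * ‖a‖ ≤ (q-1) * ‖a‖^(q-3) * (‖a‖ * ‖x‖) * ‖a‖ := by
    have : 0 ≤ q-1 := by linarith
    gcongr
  rw [h2] at *
  linarith

theorem dolDA_inner {q : ℝ} (hq : 1 < q) (a x : DolE) : ‖a‖^(q-1) * ‖x‖^2 ≤ ⟪dolDA q a x, x⟫ := by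
  rw [dolDA_apply, inner_add_left, real_inner_smul_left, real_inner_smul_left, real_inner_self_eq_norm_sq]
  have : 0 ≤ (q-1) * ‖a‖^(q-3) * (⟪a,x⟫ * ⟪a,x⟫) := by
    have : 0 ≤ q-1 := by linarith
    have := mul_self_nonneg ⟪a,x⟫
    positivity
  linarith

theorem dolAf_mono {q t L : ℝ} (hq : 1 < q) (ht : 0 < t) (htL : t ≤ L) : ∃ c Λ κ, 0 < c ∧ 0 < Λ ∧ 0 < κ ∧ ∀ a b : DolE, t ≤ ‖a‖ → ‖a‖ ≤ L → ‖b - a‖ ≤ κ →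
    c * ‖b - a‖^2 ≤ ⟪dolAf q b - dolAf q a, b - a⟫ ∧ ‖dolAf q b - dolAf q a‖ ≤ Λ * ‖b - a‖ := by
  have hc : 0 < t^(q-1) := by positivity
  obtain ⟨κ, hκ, H⟩ := dolAf_unif (q := q) (t := t) (L := L) (ω := t^(q-1)/2) ht (by positivity)
  have hL : 0 < L := by linarith
  refine ⟨t^(q-1)/2, t^(q-1)/2 + q * L^(q-1), κ, by positivity, by positivity, hκ, fun a b h1 h2 h3 => ?_⟩
  have h := H a b h1 h2 h3
  have hq0 : 0 ≤ q-1 := by linarith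
  have hta : t^(q-1) ≤ ‖a‖^(q-1) := rpow_le_rpow ht.le h1 hq0
  have haL : ‖a‖^(q-1) ≤ L^(q-1) := rpow_le_rpow (norm_nonneg _) h2 hq0
  set r := dolAf q b - dolAf q a - dolDA q a (b - a) with hr
  have e : dolAf q b - dolAf q a = r + dolDA q a (b-a) := by rw [hr]; abel
  rw [e]
  constructor
  · rw [inner_add_left]
    have g1 := dolDA_inner hq a (b-a)
    have g2 := abs_real_inner_le_norm r (b-a)
    have g3 := neg_abs_le ⟪r, b-a⟫
    have g4 : ‖r‖ * ‖b-a‖ ≤ t^(q-1)/2 * ‖b-a‖ * ‖b-a‖ := by gcongr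
    have g5 : t^(q-1) * ‖b-a‖^2 ≤ ‖a‖^(q-1) * ‖b-a‖^2 := by gcongr
    linarith
  · refine (norm_add_le _ _).trans ?_
    have g1 := dolDA_norm_le hq (a := a) (x := b-a) (by linarith)
    have g2 : q * ‖a‖^(q-1) * ‖b-a‖ ≤ q * L^(q-1) * ‖b-a‖ := by gcongr
    linarith

theorem dol_grad_cont {U : DolE → ℝ} (hU : ContDiff ℝ 1 U) : Continuous (gradient U) := by
  unfold gradient
  exact (InnerProductSpace.toDual ℝ DolE).symm.continuous.comp (hU.continuous_fderiv (by simp))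

theorem dolMv_grad {M ε : ℝ} {ρ U : DolE → ℝ} (h : DolMol M ε ρ) (hU : ContDiff ℝ 1 U) (hUc : HasCompactSupport U) (x : DolE) :
    gradient (dolMv ρ U) x = ∫ y, ρ y • gradient U (x - y) := by
  have hg := dol_grad_cont hU
  have hi : Integrable (fun y => ρ y • gradient U (x - y)) := h.integrable (k := fun y => gradient U (x-y)) (by fun_prop)
  apply ext_inner_right ℝ
  intro w
  rw [← dol_fderiv_eq, dolMv_fderiv h.cont hU hUc, dolMv_eq, real_inner_comm, ← integral_inner hi]
  congr 1; ext y
  rw [real_inner_smul_right, real_inner_comm, ← dol_fderiv_eq]; rfl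

theorem dolMv_hs {M ε : ℝ} {ρ U : DolE → ℝ} (h : DolMol M ε ρ) (hU : ContDiff ℝ 1 U) (hUc : HasCompactSupport U) (x c b : DolE) :
    dolHs (dolMv ρ U) x c b = ∫ y, fderiv ℝ ρ y b * ⟪gradient U (x - y), c⟫ := by
  unfold dolHs
  have e : (fun y => fderiv ℝ (dolMv ρ U) y c) = dolMv ρ (fun y => fderiv ℝ U y c) := by
    ext1 y; exact dolMv_fderiv h.cont hU hUc y c
  have hc : Continuous (fun y => fderiv ℝ U y c) := by
    have := hU.continuous_fderiv (by simp)
    fun_prop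
  rw [e, dolMv_fderiv_left h.smooth h.hcs hc, dolMv_eq]
  congr 1; ext y
  rw [smul_eq_mul, dol_fderiv_eq U]

theorem dol_int4 {f1 f2 f3 f4 : DolE → ℝ} (h1 : Integrable f1) (h2 : Integrable f2) (h3 : Integrable f3) (h4 : Integrable f4) (c1 c2 c3 c4 : ℝ) :
    ∫ y, (c1 * f1 y + (c2 * f2 y + (c3 * f3 y + c4 * f4 y))) = c1 * (∫ y, f1 y) + (c2 * (∫ y, f2 y) + (c3 * (∫ y, f3 y) + c4 * (∫ y, f4 y))) := by
  rw [integral_add (h1.const_mul c1) (((h2.const_mul c2).add ((h3.const_mul c3).add (h4.const_mul c4)) : Integrable (fun y => c2 * f2 y + (c3 * f3 y + c4 * f4 y)))),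
    integral_add (h2.const_mul c2) (((h3.const_mul c3).add (h4.const_mul c4)) : Integrable (fun y => (c3 * f3 y + c4 * f4 y))),
    integral_add (h3.const_mul c3) (h4.const_mul c4)]
  simp only [integral_const_mul]

/-- the (unnormalized) normalized p-Laplacian trace -/
def dolTr (q : ℝ) (v : DolE → ℝ) (x : DolE) : ℝ :=
  dolHs v x dole0 dole0 + dolHs v x dole1 dole1 + (q-1) * ((gradient v x 0)^2 * dolHs v x dole0 dole0
    + 2 * gradient v x 0 * gradient v x 1 * dolHs v x dole0 dole1 + (gradient v x 1)^2 * dolHs v x dole1 dole1) / ‖gradient v x‖^2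

theorem dolTr_eq {q M ε : ℝ} {ρ U : DolE → ℝ} (h : DolMol M ε ρ) (hU : ContDiff ℝ 1 U) (hUc : HasCompactSupport U) (x : DolE)
    (ha : 0 < ‖gradient (dolMv ρ U) x‖) :
    ‖gradient (dolMv ρ U) x‖^(q-1) * dolTr q (dolMv ρ U) x = ∫ y, fderiv ℝ ρ y (dolDA q (gradient (dolMv ρ U) x) (gradient U (x - y))) := by
  set a := gradient (dolMv ρ U) x with hae
  have hs := dolHs_symm (dolMv_smooth h.smooth h.hcs hU.continuous) x dole0 dole1
  have hg := dol_grad_cont hU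
  have hf := h.fcont
  have hi : ∀ b c : DolE, Integrable fun y => fderiv ℝ ρ y b * ⟪gradient U (x - y), c⟫ := by
    intro b c
    have := h.fintegrable (k := fun y => ⟪gradient U (x-y), c⟫ • b) (by fun_prop)
    refine this.congr (Filter.Eventually.of_forall fun y => ?_)
    simp [mul_comm]
  have e2 : ‖a‖^(q-1) = ‖a‖^(q-3) * ‖a‖^2 := by
    rw [← rpow_natCast, ← rpow_add ha]; congr 1; push_cast; ring
  have ei : ∀ y, fderiv ℝ ρ y (dolDA q a (gradient U (x - y))) = 
      (‖a‖^(q-1) + (q-1) * ‖a‖^(q-3) * a 0 ^2) * (fderiv ℝ ρ y dole0 * ⟪gradient U (x - y), dole0⟫)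
      + ((q-1) * ‖a‖^(q-3) * (a 0 * a 1) * (fderiv ℝ ρ y dole1 * ⟪gradient U (x - y), dole0⟫)
      + ((q-1) * ‖a‖^(q-3) * (a 0 * a 1) * (fderiv ℝ ρ y dole0 * ⟪gradient U (x - y), dole1⟫)
      + (‖a‖^(q-1) + (q-1) * ‖a‖^(q-3) * a 1 ^2) * (fderiv ℝ ρ y dole1 * ⟪gradient U (x - y), dole1⟫))) := by
    intro y
    set G := gradient U (x - y)
    have k0 : ⟪G, dole0⟫ = G 0 := by rw [dolE_inner]; simp [dole0]
    have k1 : ⟪G, dole1⟫ = G 1 := by rw [dolE_inner]; simp [dole1]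
    rw [dolDA_apply, map_add, map_smul, map_smul, k0, k1, dolE_inner]
    have f1 : ∀ z : DolE, fderiv ℝ ρ y z = z 0 * fderiv ℝ ρ y dole0 + z 1 * fderiv ℝ ρ y dole1 := by
      intro z; conv_lhs => rw [dolE_eta z, map_add, map_smul, map_smul]
      rfl
    rw [f1 G, f1 a]
    simp only [smul_eq_mul]; ring
  simp_rw [ei]
  rw [dol_int4 (hi _ _) (hi _ _) (hi _ _) (hi _ _),
    ← dolMv_hs h hU hUc, ← dolMv_hs h hU hUc, ← dolMv_hs h hU hUc, ← dolMv_hs h hU hUc]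
  unfold dolTr
  rw [← hae, ← hs, e2]
  field_simp
  ring

/-- Weak form used throughout. -/
def DolWeak (q δ : ℝ) (F : DolE → DolE) : Prop :=
  ∀ φ : DolE → ℝ, ContDiff ℝ 1 φ → HasCompactSupport φ → tsupport φ ⊆ ball 0 (7/8) →
    |∫ x, fderiv ℝ φ x (dolAf q (F x))| ≤ δ * ∫ x, |φ x|

theorem dolWeak_mol {q δ M ε : ℝ} {ρ : DolE → ℝ} {F : DolE → DolE} (h : DolMol M ε ρ)
    (hw : DolWeak q δ F) (hε : ε < 1/8) {x : DolE} (hx : ‖x‖ ≤ 3/4) :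
    |∫ y, fderiv ℝ ρ y (dolAf q (F (x - y)))| ≤ δ := by
  have hsup : tsupport (fun y => ρ (x - y)) ⊆ closedBall x ε := by
    apply closure_minimal _ isClosed_closedBall
    intro y hy
    by_contra hh
    rw [mem_closedBall, dist_eq_norm, norm_sub_rev, not_le] at hh
    exact hy (h.zero hh)
  have h1 := hw (fun y => ρ (x - y)) ((h.smooth.of_le (by simp)).comp (by fun_prop))
    (HasCompactSupport.of_support_subset_isCompact (isCompact_closedBall x ε) ((subset_tsupport _).trans hsup))
    (hsup.trans (fun y hy => by
      rw [mem_closedBall, dist_eq_norm] at hy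
      rw [mem_ball_zero_iff]
      have := norm_sub_norm_le y x
      linarith))
  have e1 : ∫ y, |ρ (x - y)| = 1 := by
    rw [integral_sub_left_eq_self (fun y => |ρ y|) volume x, ← h.int]
    congr 1; ext y; exact abs_of_nonneg (h.nonneg y)
  have e2 : ∫ y, fderiv ℝ (fun y => ρ (x - y)) y (dolAf q (F y)) = - ∫ y, fderiv ℝ ρ y (dolAf q (F (x - y))) := by
    rw [← integral_sub_left_eq_self (fun y => fderiv ℝ ρ y (dolAf q (F (x - y)))) volume x, ← integral_neg]
    congr 1; ext y
    have : HasFDerivAt (fun y => ρ (x - y)) (- fderiv ℝ ρ (x - y)) y := by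
      have h2 := (h.smooth.differentiable (by simp) (x - y)).hasFDerivAt.comp y ((hasFDerivAt_id y).const_sub x)
      refine h2.congr_fderiv ?_
      ext; simp
    rw [this.fderiv]; simp
  rw [e2, abs_neg, e1, mul_one] at h1
  exact h1

theorem dolTr_bound {q δ M ε ω : ℝ} {ρ U : DolE → ℝ} (hq : 1 < q) (h : DolMol M ε ρ) (hM : 0 < M) (hε0 : 0 < ε) (hω : 0 ≤ ω) (hU : ContDiff ℝ 1 U) (hUc : HasCompactSupport U) 
    (hw : DolWeak q δ (gradient U)) (hε : ε < 1/8) {x : DolE} (hx : ‖x‖ ≤ 3/4)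
    (ha : 0 < ‖gradient (dolMv ρ U) x‖) 
    (hlin : ∀ y : DolE, ‖y‖ ≤ ε → ‖dolAf q (gradient U (x-y)) - dolAf q (gradient (dolMv ρ U) x) - dolDA q (gradient (dolMv ρ U) x) (gradient U (x-y) - gradient (dolMv ρ U) x)‖ ≤ ω * ‖gradient U (x-y) - gradient (dolMv ρ U) x‖) :
    ‖gradient (dolMv ρ U) x‖^(q-1) * |dolTr q (dolMv ρ U) x| ≤ δ + ω * (M * (1 + M * π) * (ε^3)⁻¹ * ∫ y in closedBall 0 ε, ‖gradient U (x-y) - gradient U x‖) := by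
  set a := gradient (dolMv ρ U) x with hae
  have hg := dol_grad_cont hU
  have hA := dolAf_cont hq
  have e0 := dolTr_eq (q := q) h hU hUc x ha
  rw [← hae] at e0
  have e1 := dolWeak_mol h hw hε hx
  have e2 : ∫ y, fderiv ℝ ρ y (dolDA q a (gradient U (x - y))) = (∫ y, fderiv ℝ ρ y (dolAf q (gradient U (x - y)))) - ∫ y, fderiv ℝ ρ y (dolAf q (gradient U (x - y)) - dolAf q a - dolDA q a (gradient U (x - y) - a)) := by
    have i1 := h.fintegrable (k := fun y => dolAf q (gradient U (x - y))) (by fun_prop)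
    have i2 := h.fintegrable (k := fun y => dolDA q a (gradient U (x - y))) (by fun_prop)
    have i3 := h.fintegrable (k := fun y => dolDA q a a - dolAf q a) (by fun_prop)
    have : ∀ y, fderiv ℝ ρ y (dolAf q (gradient U (x - y)) - dolAf q a - dolDA q a (gradient U (x - y) - a)) = 
      fderiv ℝ ρ y (dolAf q (gradient U (x - y))) - fderiv ℝ ρ y (dolDA q a (gradient U (x - y))) + fderiv ℝ ρ y (dolDA q a a - dolAf q a) := by
      intro y; simp only [map_sub]; ring
    simp_rw [this]
    have k1 := integral_add (i1.sub i2) i3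
    have k2 := integral_sub i1 i2
    have k3 := h.fint_const (dolDA q a a - dolAf q a)
    simp only [Pi.sub_apply] at k1 k2
    rw [k1, k2, k3]; ring
  have e3 := h.fint_le (k := fun y => dolAf q (gradient U (x - y)) - dolAf q a - dolDA q a (gradient U (x - y) - a)) (j := fun y => ω * ‖gradient U (x-y) - a‖) (by fun_prop) hlin
  rw [integral_const_mul] at e3
  have e4 := h.norm_sub_le (k := fun y => gradient U (x-y)) (by fun_prop) (gradient U x)
  rw [← dolMv_grad h hU hUc x, ← hae] at e4
  set I := ∫ y in closedBall 0 ε, ‖gradient U (x-y) - gradient U x‖ with hI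
  have e5 : ∫ y in closedBall (0:DolE) ε, ‖gradient U (x-y) - a‖ ≤ (1 + M * π) * I := by
    have j1 : IntegrableOn (fun y => ‖gradient U (x-y) - a‖) (closedBall (0:DolE) ε) := (Continuous.continuousOn (by fun_prop)).integrableOn_compact (isCompact_closedBall _ _)
    have j2 : IntegrableOn (fun y => ‖gradient U (x-y) - gradient U x‖) (closedBall (0:DolE) ε) := (Continuous.continuousOn (by fun_prop)).integrableOn_compact (isCompact_closedBall _ _)
    have j3 : IntegrableOn (fun y => M * (ε^2)⁻¹ * I) (closedBall (0:DolE) ε) := (Continuous.continuousOn (by fun_prop)).integrableOn_compact (isCompact_closedBall _ _)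
    have := integral_mono j1 (j2.add j3) (fun y => by
      show ‖gradient U (x-y) - a‖ ≤ ‖gradient U (x-y) - gradient U x‖ + M * (ε^2)⁻¹ * I
      have := norm_sub_le_norm_sub_add_norm_sub (gradient U (x-y)) (gradient U x) a
      rw [norm_sub_rev (gradient U x) a] at this
      linarith)
    refine this.trans ?_
    rw [Pi.add_def, integral_add j2 j3]
    rw [setIntegral_const, measureReal_def, EuclideanSpace.volume_closedBall_fin_two]
    rw [ENNReal.toReal_mul, ENNReal.toReal_pow, ENNReal.toReal_ofReal hε0.le]
    simp only [smul_eq_mul]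
    rw [ENNReal.toReal_ofReal pi_pos.le, ← hI]
    apply le_of_eq
    field_simp
  rw [← abs_of_nonneg (show 0 ≤ ‖a‖^(q-1) by positivity), ← abs_mul, e0, e2]
  refine (abs_sub _ _).trans ?_
  have e6 : M * (ε^3)⁻¹ * (ω * ∫ y in closedBall (0:DolE) ε, ‖gradient U (x-y) - a‖) ≤ M * (ε^3)⁻¹ * (ω * ((1 + M * π) * I)) := by gcongr
  have e7 : M * (ε^3)⁻¹ * (ω * ((1 + M * π) * I)) = ω * (M * (1 + M * π) * (ε^3)⁻¹ * I) := by ring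
  linarith

theorem dol_cutoff {K O : Set DolE} (hK : IsClosed K) (hO : IsOpen O) (h : K ⊆ O) :
    ∃ η : DolE → ℝ, ContDiff ℝ (⊤ : ℕ∞) η ∧ (∀ x, 0 ≤ η x) ∧ (∀ x, η x ≤ 1) ∧ (∀ x ∈ K, η x = 1) ∧ (∀ x, x ∉ O → η x = 0) := by
  obtain ⟨η, h1, h2, h3, h4⟩ := exists_contMDiff_zero_iff_one_iff_of_isClosed (n := (⊤:ℕ∞)) (modelWithCornersSelf ℝ DolE) (s := Oᶜ) (t := K) hO.isClosed_compl hK (Set.disjoint_compl_left_iff_subset.2 h)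
  refine ⟨η, contMDiff_iff_contDiff.1 h1, fun x => (h2 ⟨x, rfl⟩).1, fun x => (h2 ⟨x, rfl⟩).2, fun x hx => (h4 x).1 hx, fun x hx => (h3 x).1 hx⟩

theorem dol_translate_L1 {ψ : DolE → ℝ} (hψ : ContDiff ℝ 1 ψ) (hc : HasCompactSupport ψ) (h : DolE) :
    ∫ x, |ψ (x - h) - ψ x| ≤ ‖h‖ * ∫ x, ‖fderiv ℝ ψ x‖ := by
  have hf := hψ.continuous_fderiv (by simp)
  have hψc := hψ.continuous
  have hfi : Integrable (fun x => ‖fderiv ℝ ψ x‖) := (hf.integrable_of_hasCompactSupport (hc.fderiv ℝ)).norm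
  obtain ⟨R, hR⟩ := hc.isBounded.subset_closedBall 0
  set A : Set DolE := closedBall 0 (R + ‖h‖) with hA
  have hAc : IsCompact A := isCompact_closedBall _ _
  have hz : ∀ x : DolE, R < ‖x‖ → ψ x = 0 := by
    intro x hx
    apply image_eq_zero_of_notMem_tsupport
    intro hh; have := hR hh; rw [mem_closedBall_zero_iff] at this; linarith
  have e1 : ∫ x, |ψ (x - h) - ψ x| = ∫ x in A, |ψ (x - h) - ψ x| := by
    symm
    apply setIntegral_eq_integral_of_forall_compl_eq_zero
    intro x hx
    rw [hA, mem_closedBall_zero_iff, not_le] at hx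
    have h1 := norm_sub_norm_le x h
    have h2 := norm_nonneg h
    rw [hz x (by linarith), hz (x-h) (by linarith)]; simp
  have e2 : ∀ x, |ψ (x - h) - ψ x| ≤ ∫ s in Set.Ioc (0:ℝ) 1, ‖h‖ * ‖fderiv ℝ ψ (x - s • h)‖ := by
    intro x
    have hd : ∀ s : ℝ, HasDerivAt (fun s : ℝ => ψ (x - s • h)) (fderiv ℝ ψ (x - s • h) (-h)) s := by
      intro s
      have h1 : HasDerivAt (fun s : ℝ => x - s • h) (-h) s := by
        have := ((hasDerivAt_id s).smul_const h).const_sub x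
        simpa using this
      exact (hψ.differentiable (by simp) (x - s • h)).hasFDerivAt.comp_hasDerivAt s h1
    have hcont : Continuous fun s : ℝ => fderiv ℝ ψ (x - s • h) (-h) := by fun_prop
    have hcont2 : Continuous fun s : ℝ => ‖h‖ * ‖fderiv ℝ ψ (x - s • h)‖ := by fun_prop
    have := intervalIntegral.integral_eq_sub_of_hasDerivAt (a := 0) (b := 1) (fun s _ => hd s) (hcont.intervalIntegrable _ _)
    simp only [one_smul, zero_smul, sub_zero] at this
    rw [← this, ← intervalIntegral.integral_of_le zero_le_one, ← Real.norm_eq_abs]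
    apply intervalIntegral.norm_integral_le_of_norm_le zero_le_one _ (hcont2.intervalIntegrable _ _)
    refine Filter.Eventually.of_forall fun s _ => ?_
    refine (ContinuousLinearMap.le_opNorm _ _).trans ?_
    rw [norm_neg, mul_comm]
  have hcc : Continuous (fun p : DolE × ℝ => ‖h‖ * ‖fderiv ℝ ψ (p.1 - p.2 • h)‖) := by fun_prop
  have hprod : Integrable (Function.uncurry fun (x : DolE) (s : ℝ) => ‖h‖ * ‖fderiv ℝ ψ (x - s • h)‖) ((volume.restrict A).prod (volume.restrict (Set.Ioc (0:ℝ) 1))) := by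
    rw [Measure.prod_restrict]
    exact (hcc.continuousOn.integrableOn_compact (hAc.prod isCompact_Icc)).mono_set (Set.prod_mono subset_rfl Set.Ioc_subset_Icc_self)
  rw [e1]
  calc ∫ x in A, |ψ (x - h) - ψ x| ≤ ∫ x in A, ∫ s in Set.Ioc (0:ℝ) 1, ‖h‖ * ‖fderiv ℝ ψ (x - s • h)‖ := by
        apply integral_mono
        · exact (Continuous.continuousOn (by fun_prop)).integrableOn_compact hAc
        · exact hprod.integral_prod_left
        · exact e2
    _ = ∫ s in Set.Ioc (0:ℝ) 1, ∫ x in A, ‖h‖ * ‖fderiv ℝ ψ (x - s • h)‖ := integral_integral_swap hprod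
    _ ≤ ∫ s in Set.Ioc (0:ℝ) 1, ‖h‖ * ∫ x, ‖fderiv ℝ ψ x‖ := by
        apply integral_mono
        · exact hprod.integral_prod_right
        · exact integrable_const _
        · intro s
          show ∫ x in A, ‖h‖ * ‖fderiv ℝ ψ (x - s • h)‖ ≤ ‖h‖ * ∫ x, ‖fderiv ℝ ψ x‖
          rw [integral_const_mul, ← integral_sub_right_eq_self (fun x => ‖fderiv ℝ ψ x‖) (s • h)]
          gcongr
          · exact Filter.Eventually.of_forall fun x => norm_nonneg _
          · exact hfi.comp_sub_right (s • h)
          · exact Measure.restrict_le_self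
    _ = ‖h‖ * ∫ x, ‖fderiv ℝ ψ x‖ := by simp

theorem dol_unif {F : DolE → DolE} (hF : Continuous F) (hc : HasCompactSupport F) {e : ℝ} (he : 0 < e) :
    ∃ d, 0 < d ∧ ∀ x y, ‖x - y‖ ≤ d → ‖F x - F y‖ ≤ e := by
  have := hc.uniformContinuous_of_continuous hF
  rw [Metric.uniformContinuous_iff] at this
  obtain ⟨d, hd, H⟩ := this e he
  refine ⟨d/2, by positivity, fun x y hxy => ?_⟩
  have := @H x y (by rw [dist_eq_norm]; linarith)
  rw [dist_eq_norm] at this; exact this.le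

theorem dol_dq_alg {c Λ δ N L η D d W hh g1 : ℝ} (hc : 0 < c) (hη : 0 ≤ η) (hη1 : η ≤ 1) (hD : 0 ≤ D) (hδ : 0 ≤ δ) (hN : 0 ≤ N) (hL : 0 ≤ L) (hΛ : 0 ≤ Λ)
    (hh0 : 0 ≤ hh) (hd : d ≤ L * hh) (h1 : c * D^2 ≤ g1) (hW0 : 0 ≤ W) (hW : W ≤ Λ * D) (hd0 : 0 ≤ d) :
    c/2 * (η^2*D^2) ≤ (η^2 * g1 - 2 * η * d * N * W) - δ * hh * (η^2 * D + 2 * η * d * N) + (δ^2/c + 4*N^2*L^2*Λ^2/c + 2*δ*L*N) * hh^2 := by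
  have a1 : η^2 * (c*D^2) ≤ η^2 * g1 := by gcongr
  have a2 : 2 * η * d * N * W ≤ 2 * η * (L*hh) * N * (Λ*D) := by gcongr
  have a3 : δ * hh * (η^2*D + 2*η*d*N) ≤ δ * hh * (η*D + 2*1*(L*hh)*N) := by
    gcongr
    nlinarith
  have a4 : 2 * η * (L*hh) * N * (Λ*D) ≤ c/4 * (η^2*D^2) + 4*N^2*L^2*Λ^2/c * hh^2 := by
    have : c/4 * (η^2*D^2) + 4*N^2*L^2*Λ^2/c * hh^2 - 2 * η * (L*hh) * N * (Λ*D) = (c*η*D/2 - 2*N*L*Λ*hh)^2 / c := by field_simp; ring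
    have h2 : 0 ≤ (c*η*D/2 - 2*N*L*Λ*hh)^2 / c := by positivity
    linarith
  have a5 : δ * hh * (η*D) ≤ c/4 * (η^2*D^2) + δ^2/c * hh^2 := by
    have : c/4 * (η^2*D^2) + δ^2/c * hh^2 - δ * hh * (η*D) = (c*η*D/2 - δ*hh)^2 / c := by field_simp; ring
    have h2 : 0 ≤ (c*η*D/2 - δ*hh)^2 / c := by positivity
    linarith
  linarith

theorem dol_dq_test {ψ : DolE → ℝ} {F : DolE → DolE} {q δ : ℝ} (hq : 1 < q) (hδ : 0 ≤ δ) (hF : Continuous F) (hw : DolWeak q δ F)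
    (hψ : ContDiff ℝ 1 ψ) (hs : tsupport ψ ⊆ closedBall 0 (13/16)) {h : DolE} (hh : ‖h‖ ≤ 1/32) :
    ∫ x, fderiv ℝ ψ x (dolAf q (F (x + h)) - dolAf q (F x)) ≤ δ * ‖h‖ * ∫ x, ‖fderiv ℝ ψ x‖ := by
  have hc : HasCompactSupport ψ := HasCompactSupport.of_support_subset_isCompact (isCompact_closedBall 0 (13/16)) ((subset_tsupport _).trans hs)
  have hf := hψ.continuous_fderiv (by simp)
  have hψc := hψ.continuous
  have hA := dolAf_cont hq
  have hz : ∀ x : DolE, 13/16 < ‖x‖ → ψ x = 0 := by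
    intro x hx
    apply image_eq_zero_of_notMem_tsupport
    intro hh; have := hs hh; rw [mem_closedBall_zero_iff] at this; linarith
  have hfz : ∀ x : DolE, 13/16 < ‖x‖ → fderiv ℝ ψ x = 0 := by
    intro x hx
    apply image_eq_zero_of_notMem_tsupport
    intro hh; have := hs (tsupport_fderiv_subset ℝ hh); rw [mem_closedBall_zero_iff] at this; linarith
  have hsub : tsupport (fun x => ψ (x - h) - ψ x) ⊆ closedBall 0 (27/32) := by
    apply closure_minimal _ isClosed_closedBall
    intro x hx
    by_contra hn
    rw [mem_closedBall_zero_iff, not_le] at hn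
    have h1 := norm_sub_norm_le x h
    apply hx
    show ψ (x - h) - ψ x = 0
    rw [hz x (by linarith), hz (x-h) (by linarith)]; simp
  have h1 := hw (fun x => ψ (x - h) - ψ x) ((hψ.comp (by fun_prop)).sub hψ)
    (HasCompactSupport.of_support_subset_isCompact (isCompact_closedBall 0 (27/32)) ((subset_tsupport _).trans hsub))
    (hsub.trans (closedBall_subset_ball (by norm_num)))
  have h2 := dol_translate_L1 hψ hc h
  have hintg : ∀ k : DolE → DolE, Continuous k → Integrable (fun x => fderiv ℝ ψ x (k x)) := by
    intro k hk
    apply Continuous.integrable_of_hasCompactSupport (by fun_prop)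
    apply HasCompactSupport.intro (isCompact_closedBall (0:DolE) (13/16))
    intro x hx
    rw [mem_closedBall_zero_iff, not_le] at hx
    rw [hfz x hx]; rfl
  have i1 := hintg (fun x => dolAf q (F (x+h))) (by fun_prop)
  have i2 := hintg (fun x => dolAf q (F x)) (by fun_prop)
  have e : ∫ x, fderiv ℝ (fun x => ψ (x - h) - ψ x) x (dolAf q (F x)) = ∫ x, fderiv ℝ ψ x (dolAf q (F (x + h)) - dolAf q (F x)) := by
    have e1 : ∀ x, fderiv ℝ (fun x => ψ (x - h) - ψ x) x (dolAf q (F x)) = fderiv ℝ ψ (x - h) (dolAf q (F ((x - h) + h))) - fderiv ℝ ψ x (dolAf q (F x)) := by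
      intro x
      have g1 : HasFDerivAt (fun x => ψ (x - h)) (fderiv ℝ ψ (x-h)) x := by
        have h2 := (hψ.differentiable (by simp) (x - h)).hasFDerivAt.comp x ((hasFDerivAt_id x).sub_const h)
        exact h2
      have g2 := (g1.sub (hψ.differentiable (by simp) x).hasFDerivAt).fderiv
      have g3 : fderiv ℝ (fun x => ψ (x - h) - ψ x) x = fderiv ℝ ψ (x-h) - fderiv ℝ ψ x := g2
      rw [g3, sub_add_cancel]; rfl
    simp_rw [e1, map_sub]
    rw [integral_sub i1 i2, integral_sub _ i2]
    · rw [integral_sub_right_eq_self (fun x => fderiv ℝ ψ x (dolAf q (F (x+h)))) h]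
    · exact i1.comp_sub_right h
  rw [e] at h1
  have h3 := (le_abs_self _).trans h1
  have h4 := mul_le_mul_of_nonneg_left h2 hδ
  linarith

set_option maxHeartbeats 1600000 in
theorem dol_dq {U : DolE → ℝ} {q δ t : ℝ} (hq : 1 < q) (hδ : 0 ≤ δ) (ht : 0 < t) (hU : ContDiff ℝ 1 U) (hUc : HasCompactSupport U)
    (hw : DolWeak q δ (gradient U)) : ∃ CK h0, 0 ≤ CK ∧ 0 < h0 ∧ ∀ h : DolE, ‖h‖ ≤ h0 →
      ∫ x in closedBall 0 (3/4) ∩ {x | t ≤ ‖gradient U x‖}, ‖gradient U (x + h) - gradient U x‖^2 ≤ CK * ‖h‖^2 := by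
  set F := gradient U with hFd
  have hF : Continuous F := dol_grad_cont hU
  have hFc : HasCompactSupport F := by
    apply HasCompactSupport.intro hUc
    intro x hx
    have : fderiv ℝ U x = 0 := image_eq_zero_of_notMem_tsupport (fun h => hx (tsupport_fderiv_subset ℝ h))
    rw [hFd]; unfold gradient; rw [this]; simp
  obtain ⟨L0, hL0⟩ := hF.bounded_above_of_compact_support hFc
  set L := max L0 (t/2) with hL
  have hLF : ∀ x, ‖F x‖ ≤ L := fun x => (hL0 x).trans (le_max_left _ _)
  have htL : t/2 ≤ L := le_max_right _ _
  have hLp : 0 < L := by linarith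
  obtain ⟨c, Λ, κ, hc, hΛ, hκ, Hm⟩ := dolAf_mono (q := q) (t := t/2) (L := L) hq (by positivity) htL
  obtain ⟨d0, hd0, Hu⟩ := dol_unif hF hFc hκ
  set K : Set DolE := closedBall 0 (3/4) ∩ {x | t ≤ ‖F x‖} with hK
  have hKcl : IsClosed K := isClosed_closedBall.inter (isClosed_le continuous_const hF.norm)
  set O : Set DolE := ball 0 (13/16) ∩ {x | t/2 < ‖F x‖} with hO
  have hOo : IsOpen O := isOpen_ball.inter (isOpen_lt continuous_const hF.norm)
  have hKO : K ⊆ O := by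
    rintro x ⟨h1, h2⟩
    have h2' : t ≤ ‖F x‖ := h2
    refine ⟨closedBall_subset_ball (by norm_num) h1, ?_⟩
    show t/2 < ‖F x‖; linarith
  obtain ⟨η, hη, hη0, hη1, hηK, hηO⟩ := dol_cutoff hKcl hOo hKO
  have hηc : HasCompactSupport η := HasCompactSupport.intro (isCompact_closedBall (0:DolE) (13/16)) (fun x hx => hηO x (fun h => hx (ball_subset_closedBall h.1)))
  obtain ⟨N, hN⟩ := (hη.continuous_fderiv (by simp)).bounded_above_of_compact_support (hηc.fderiv ℝ)
  have hN0 : 0 ≤ N := (norm_nonneg _).trans (hN 0)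
  set C1 := δ^2/c + 4*N^2*L^2*Λ^2/c + 2*δ*L*N with hC1
  have hC10 : 0 ≤ C1 := by positivity
  refine ⟨2/c * (C1 * volume.real (closedBall (0:DolE) 1)), min d0 (1/32), by positivity, by positivity, fun h hh => ?_⟩
  have hh1 := hh.trans (min_le_left _ _)
  have hh2 := hh.trans (min_le_right _ _)
  have hUd : Differentiable ℝ U := hU.differentiable (by simp)
  set ψ : DolE → ℝ := fun x => η x ^2 * (U (x + h) - U x) with hψd
  have heta1d : ContDiff ℝ 1 η := hη.of_le (by simp)
  have hψ : ContDiff ℝ 1 ψ := (heta1d.pow 2).mul ((hU.comp (by fun_prop)).sub hU)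
  have hψs : tsupport ψ ⊆ closedBall 0 (13/16) := by
    apply closure_minimal _ isClosed_closedBall
    intro x hx
    by_contra hn
    apply hx
    show η x ^2 * (U (x + h) - U x) = 0
    rw [hηO x (fun h => hn (ball_subset_closedBall h.1))]; ring
  have hfd : ∀ x w, fderiv ℝ ψ x w = η x ^2 * ⟪F (x+h) - F x, w⟫ + 2 * η x * (U (x+h) - U x) * fderiv ℝ η x w := by
    intro x w
    have g1 : HasFDerivAt (fun x => U (x + h)) (fderiv ℝ U (x+h)) x := 
      (hUd (x + h)).hasFDerivAt.comp x ((hasFDerivAt_id x).add_const h)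
    have g2 := g1.sub (hUd x).hasFDerivAt
    have g3 := ((hη.differentiable (by simp) x).hasFDerivAt.pow 2).mul g2
    have g4 : HasFDerivAt ψ _ x := g3
    rw [g4.fderiv]
    simp only [ContinuousLinearMap.add_apply, ContinuousLinearMap.smul_apply, ContinuousLinearMap.sub_apply, smul_eq_mul]
    rw [inner_sub_left, ← dol_fderiv_eq, ← dol_fderiv_eq]
    simp
    ring
  have hdU : ∀ x, |U (x+h) - U x| ≤ L * ‖h‖ := by
    intro x
    have := Convex.norm_image_sub_le_of_norm_fderiv_le (𝕜 := ℝ) (f := U) (C := L) (s := Set.univ) (x := x) (y := x+h) (fun y _ => hUd y) (fun y _ => by rw [← dol_norm_grad]; exact hLF y) convex_univ trivial trivial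
    simpa using this
  have hψn : ∀ x, ‖fderiv ℝ ψ x‖ ≤ η x ^2 * ‖F (x+h) - F x‖ + 2 * η x * |U (x+h) - U x| * N := by
    intro x
    have hηx := hη0 x
    apply ContinuousLinearMap.opNorm_le_bound _ (by positivity)
    intro w
    rw [hfd]
    refine (norm_add_le _ _).trans ?_
    rw [norm_mul, norm_mul, norm_mul, norm_mul, Real.norm_eq_abs, Real.norm_eq_abs, Real.norm_eq_abs, Real.norm_eq_abs, Real.norm_eq_abs, abs_of_nonneg (by positivity : 0 ≤ η x^2), abs_of_nonneg hηx, abs_two]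
    have k1 := abs_real_inner_le_norm (F (x+h) - F x) w
    have k2 : ‖fderiv ℝ η x w‖ ≤ N * ‖w‖ := (ContinuousLinearMap.le_opNorm _ _).trans (by gcongr; exact hN x)
    have k3 : η x^2 * |⟪F (x+h) - F x, w⟫| ≤ η x^2 * (‖F (x+h) - F x‖ * ‖w‖) := by gcongr
    have k4 : 2 * η x * |U (x+h) - U x| * ‖fderiv ℝ η x w‖ ≤ 2 * η x * |U (x+h) - U x| * (N * ‖w‖) := by gcongr
    linarith
  set W : DolE → DolE := fun x => dolAf q (F (x + h)) - dolAf q (F x) with hW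
  have hA := dolAf_cont hq
  have hWc : Continuous W := by fun_prop
  have hfψc := hψ.continuous_fderiv (by simp)
  have hηcc := hη.continuous
  have hψc : HasCompactSupport ψ := HasCompactSupport.of_support_subset_isCompact (isCompact_closedBall 0 (13/16)) ((subset_tsupport _).trans hψs)
  have hpt : ∀ x, c/2 * (η x^2 * ‖F (x+h) - F x‖^2) ≤ fderiv ℝ ψ x (W x) - δ * ‖h‖ * ‖fderiv ℝ ψ x‖ + (closedBall (0:DolE) 1).indicator (fun _ => C1 * ‖h‖^2) x := by
    intro x
    by_cases hx : x ∈ O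
    · have hx1 : x ∈ closedBall (0:DolE) 1 := closedBall_subset_closedBall (by norm_num) (ball_subset_closedBall hx.1)
      rw [Set.indicator_of_mem hx1]
      obtain ⟨m1, m2⟩ := Hm (F x) (F (x+h)) (le_of_lt hx.2) (hLF x) (Hu _ _ (by simpa using hh1))
      have := dol_dq_alg (g1 := ⟪W x, F (x+h) - F x⟫) (N := N) (δ := δ) hc (hη0 x) (hη1 x) (norm_nonneg (F (x+h) - F x)) hδ hN0 hLp.le hΛ.le (norm_nonneg h) (hdU x) m1 (norm_nonneg (W x)) m2 (abs_nonneg _)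
      have k1 : η x^2 * ⟪W x, F (x+h) - F x⟫ - 2 * η x * |U (x+h) - U x| * N * ‖W x‖ ≤ fderiv ℝ ψ x (W x) := by
        rw [hfd, real_inner_comm]
        have k2 : ‖fderiv ℝ η x (W x)‖ ≤ N * ‖W x‖ := (ContinuousLinearMap.le_opNorm _ _).trans (by gcongr; exact hN x)
        have hηx := hη0 x
        have k3 : |2 * η x * (U (x+h) - U x) * fderiv ℝ η x (W x)| ≤ 2 * η x * |U (x+h) - U x| * (N * ‖W x‖) := by
          rw [abs_mul, abs_mul, abs_mul, abs_two, abs_of_nonneg hηx]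
          rw [Real.norm_eq_abs] at k2
          gcongr
        have k4 := neg_abs_le (2 * η x * (U (x+h) - U x) * fderiv ℝ η x (W x))
        linarith
      have k5 : δ * ‖h‖ * ‖fderiv ℝ ψ x‖ ≤ δ * ‖h‖ * (η x ^2 * ‖F (x+h) - F x‖ + 2 * η x * |U (x+h) - U x| * N) := by gcongr; exact hψn x
      linarith
    · have e0 : η x = 0 := hηO x hx
      have e1 := hψn x
      rw [e0] at e1
      have e2 : fderiv ℝ ψ x = 0 := by
        rw [← norm_le_zero_iff]; simpa using e1
      rw [e0, e2]
      simp
      apply Set.indicator_nonneg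
      intro x _; positivity
  have I1 : Integrable (fun x => c/2 * (η x^2 * ‖F (x+h) - F x‖^2)) := by
    apply Continuous.integrable_of_hasCompactSupport (by fun_prop)
    apply HasCompactSupport.intro (isCompact_closedBall (0:DolE) (13/16))
    intro x hx
    rw [hηO x (fun h => hx (ball_subset_closedBall h.1))]; ring
  have I2 : Integrable (fun x => fderiv ℝ ψ x (W x)) := by
    apply Continuous.integrable_of_hasCompactSupport (by fun_prop)
    apply HasCompactSupport.intro (hψc.fderiv ℝ)
    intro x hx
    rw [image_eq_zero_of_notMem_tsupport hx]; rfl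
  have I3 : Integrable (fun x => ‖fderiv ℝ ψ x‖) := (hfψc.integrable_of_hasCompactSupport (hψc.fderiv ℝ)).norm
  have I4 : Integrable ((closedBall (0:DolE) 1).indicator (fun _ => C1 * ‖h‖^2)) := by
    rw [integrable_indicator_iff measurableSet_closedBall]
    exact continuous_const.continuousOn.integrableOn_compact (isCompact_closedBall _ _)
  have test := dol_dq_test hq hδ hF hw hψ hψs hh2
  have hmain := integral_mono I1 ((I2.sub (I3.const_mul (δ * ‖h‖))).add I4) hpt
  have hsum : ∫ x, ((fun x => fderiv ℝ ψ x (W x)) - (fun x => δ * ‖h‖ * ‖fderiv ℝ ψ x‖) + (closedBall (0:DolE) 1).indicator (fun _ => C1 * ‖h‖^2)) x = (∫ x, fderiv ℝ ψ x (W x)) - δ * ‖h‖ * (∫ x, ‖fderiv ℝ ψ x‖) + C1 * ‖h‖^2 * volume.real (closedBall (0:DolE) 1) := by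
    rw [integral_add' (I2.sub (I3.const_mul (δ * ‖h‖))) I4, integral_sub' I2 (I3.const_mul (δ * ‖h‖)), integral_const_mul, integral_indicator measurableSet_closedBall, setIntegral_const, smul_eq_mul]
    ring
  rw [hsum, integral_const_mul] at hmain
  have hKle : ∫ x in K, ‖F (x+h) - F x‖^2 ≤ ∫ x, η x^2 * ‖F (x+h) - F x‖^2 := by
    have I1' : Integrable (fun x => (η x^2 * ‖F (x+h) - F x‖^2)) := by
      have := I1.const_mul (2/c)
      refine this.congr (Filter.Eventually.of_forall fun x => ?_)
      show 2/c * (c/2 * (η x^2 * ‖F (x+h) - F x‖^2)) = _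
      field_simp
    rw [show ∫ x in K, ‖F (x+h) - F x‖^2 = ∫ x in K, η x^2 * ‖F (x+h) - F x‖^2 from setIntegral_congr_fun hKcl.measurableSet (fun x hx => by simp [hηK x hx])]
    exact setIntegral_le_integral I1' (Filter.Eventually.of_forall fun x => by positivity)
  refine hKle.trans ?_
  have hfin : c/2 * (∫ x, η x^2 * ‖F (x+h) - F x‖^2) ≤ C1 * ‖h‖^2 * volume.real (closedBall (0:DolE) 1) := by linarith
  have : 2/c * (C1 * volume.real (closedBall (0:DolE) 1)) * ‖h‖^2 = 2/c * (C1 * ‖h‖^2 * volume.real (closedBall (0:DolE) 1)) := by ring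
  rw [this]
  have h3 := mul_le_mul_of_nonneg_left hfin (show 0 ≤ 2/c by positivity)
  have h4 : 2/c * (c/2 * (∫ x, η x^2 * ‖F (x+h) - F x‖^2)) = ∫ x, η x^2 * ‖F (x+h) - F x‖^2 := by field_simp
  linarith

theorem dol_vol_ball {ε : ℝ} (hε : 0 ≤ ε) : volume.real (closedBall (0:DolE) ε) = π * ε^2 := by
  rw [measureReal_def, EuclideanSpace.volume_closedBall_fin_two]
  rw [ENNReal.toReal_mul, ENNReal.toReal_pow, ENNReal.toReal_ofReal hε]
  rw [mul_comm]
  congr 1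
  exact ENNReal.toReal_ofReal pi_pos.le

theorem dol_csb {ε : ℝ} (hε : 0 < ε) {g : DolE → ℝ} (hg : Continuous g) :
    (∫ y in closedBall (0:DolE) ε, g y)^2 ≤ π * ε^2 * ∫ y in closedBall (0:DolE) ε, g y^2 := by
  set V : ℝ := π * ε^2 with hV
  have hVp : 0 < V := by positivity
  have hc : IsCompact (closedBall (0:DolE) ε) := isCompact_closedBall _ _
  set I := ∫ y in closedBall (0:DolE) ε, g y with hI
  have i1 : IntegrableOn g (closedBall (0:DolE) ε) := hg.continuousOn.integrableOn_compact hc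
  have i2 : IntegrableOn (fun y => g y^2) (closedBall (0:DolE) ε) := (hg.pow 2).continuousOn.integrableOn_compact hc
  have h : (2 * (I/V)) * I ≤ (∫ y in closedBall (0:DolE) ε, g y^2) + (I/V)^2 * V := by
    have e : (I/V)^2 * V = ∫ y in closedBall (0:DolE) ε, (I/V)^2 := by
      rw [setIntegral_const, dol_vol_ball hε.le, smul_eq_mul, mul_comm]
    have e2 : (2 * (I/V)) * I = ∫ y in closedBall (0:DolE) ε, (2 * (I/V)) * g y := by
      rw [integral_const_mul]
    have i3 : IntegrableOn (fun _ : DolE => (I/V)^2) (closedBall (0:DolE) ε) := continuousOn_const.integrableOn_compact hc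
    rw [e, e2, ← integral_add i2 i3]
    apply integral_mono (i1.const_mul _) (i2.add i3)
    intro y
    show 2 * (I/V) * g y ≤ g y^2 + (I/V)^2
    nlinarith [sq_nonneg (g y - I/V)]
  have : (2 * (I/V)) * I - (I/V)^2 * V = I^2/V := by field_simp; ring
  have h2 : I^2 / V ≤ ∫ y in closedBall (0:DolE) ε, g y^2 := by linarith
  rw [div_le_iff₀ hVp] at h2; linarith

theorem dol_R1 {F : DolE → DolE} (hF : Continuous F) {K : Set DolE} (hK : IsCompact K) {ε h0 CK : ℝ} (hε : 0 < ε) (hε0 : ε ≤ h0) (hCK : 0 ≤ CK)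
    (H : ∀ h, ‖h‖ ≤ h0 → ∫ x in K, ‖F (x+h) - F x‖^2 ≤ CK * ‖h‖^2) :
    ∫ x in K, (∫ y in closedBall (0:DolE) ε, ‖F (x-y) - F x‖)^2 ≤ π^2 * CK * ε^6 := by
  have hB : IsCompact (closedBall (0:DolE) ε) := isCompact_closedBall _ _
  have hcc : Continuous (fun p : DolE × DolE => ‖F (p.1-p.2) - F p.1‖^2) := by fun_prop
  have hcc1 : Continuous (fun p : DolE × DolE => ‖F (p.1-p.2) - F p.1‖) := by fun_prop
  have hprod : Integrable (Function.uncurry fun (x y : DolE) => ‖F (x-y) - F x‖^2) ((volume.restrict K).prod (volume.restrict (closedBall (0:DolE) ε))) := by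
    rw [Measure.prod_restrict]
    exact hcc.continuousOn.integrableOn_compact (hK.prod hB)
  have hin : Continuous fun x => ∫ y in closedBall (0:DolE) ε, ‖F (x-y) - F x‖ := by
    exact continuous_parametric_integral_of_continuous hcc1 hB
  calc ∫ x in K, (∫ y in closedBall (0:DolE) ε, ‖F (x-y) - F x‖)^2 
      ≤ ∫ x in K, π * ε^2 * ∫ y in closedBall (0:DolE) ε, ‖F (x-y) - F x‖^2 := by
        apply integral_mono
        · exact (hin.pow 2).continuousOn.integrableOn_compact hK
        · exact hprod.integral_prod_left.const_mul _
        · intro x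
          exact dol_csb hε (by fun_prop)
    _ = π * ε^2 * ∫ y in closedBall (0:DolE) ε, ∫ x in K, ‖F (x-y) - F x‖^2 := by
        rw [integral_const_mul, integral_integral_swap hprod]
    _ ≤ π * ε^2 * ∫ y in closedBall (0:DolE) ε, CK * ε^2 := by
        refine mul_le_mul_of_nonneg_left ?_ (by positivity)
        apply setIntegral_mono_on
        · exact hprod.integral_prod_right
        · exact continuousOn_const.integrableOn_compact hB
        · exact isClosed_closedBall.measurableSet
        · intro y hy
          rw [mem_closedBall_zero_iff] at hy
          have := H (-y) (by rw [norm_neg]; linarith)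
          simp only [← sub_eq_add_neg, norm_neg] at this
          refine this.trans ?_
          gcongr
    _ = π^2 * CK * ε^6 := by
        rw [setIntegral_const, dol_vol_ball hε.le, smul_eq_mul]; ring

theorem dolw_up {q s t ι x : ℝ} (hq : 1 < q) (hs : 0 < s) (ht : 0 < t) (hι : 0 < ι) (hιK : 2 * ι * dolK ≤ 1) (hx : t ≤ x) :
    dolw q s t ι x ≤ (q+1) * (x / s^2)^(q-1) := by
  have hxp : 0 < x := ht.trans_le hx
  have hG : dolG q s t x^2 ≤ (x/s^2)^(q-1) := by
    unfold dolG
    rw [dolX_eq ht hx]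
    rw [← Real.rpow_natCast, ← Real.rpow_mul (by positivity)]
    have : (q-1)/2 * ((2:ℕ):ℝ) = q-1 := by push_cast; ring
    rw [this]
    apply Real.rpow_le_rpow (by positivity) _ (by linarith)
    gcongr; linarith
  have h1 := dolH_le hq hs ht x
  have h0 := dolH_ge (s := s) hq ht x
  have y0 := dolY_nonneg (t := t) (ι := ι) x
  have y1 := dolY_le (t := t) (ι := ι) x
  have z0 := dolZ_nonneg (t := t) hι x
  have z1 := dolZ_le (t := t) hι x
  unfold dolw
  have : dolY t ι x * (dolY t ι x * dolH q s t x + dolZ t ι x) ≤ 1 * (1 * q + 1) := by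
    gcongr
    linarith
  calc _ ≤ (x/s^2)^(q-1) * (1 * (1*q+1)) := by gcongr
    _ = _ := by ring

/-- the weighted squared trace -/
def dolHF (q s m ι : ℝ) (v : DolE → ℝ) (x : DolE) : ℝ :=
  dolw q s m ι (fderiv ℝ v x dole0^2 + fderiv ℝ v x dole1^2) *
    dolTau q m (fderiv ℝ v x dole0) (fderiv ℝ v x dole1) (dolHs v x dole0 dole0) (dolHs v x dole0 dole1) (dolHs v x dole1 dole1)^2

theorem dolHF_cont {q s m ι : ℝ} {v : DolE → ℝ} (hv : ContDiff ℝ (⊤ : ℕ∞) v) (hs : 0 < s) (hm : 0 < m) : Continuous (dolHF q s m ι v) := by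
  have h0 := (dolGd_contDiff hv dole0).continuous
  have h1 := (dolGd_contDiff hv dole1).continuous
  have a := dolHs_cont hv dole0 dole0
  have b := dolHs_cont hv dole0 dole1
  have c := dolHs_cont hv dole1 dole1
  have hw := dolw_cont (q := q) (ι := ι) hs hm
  have hX := dolX_cont m
  unfold dolHF dolTau dolaN
  refine (hw.comp (by fun_prop)).mul ((Continuous.add (by fun_prop) (Continuous.div (by fun_prop) (hX.comp (by fun_prop)) ?_)).pow 2)
  intro x; exact (dolX_pos hm _).ne'

theorem dolHF_cum {q s m ι : ℝ} {v : DolE → ℝ} (hv : ContDiff ℝ (⊤ : ℕ∞) v) (hs : 0 < s) (hm : 0 < m) {R : ℝ} (hR : 0 ≤ R) :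
    dolCum ((dolPDof v hv).wT q s m ι m) R = ∫ x in ball (0:DolE) R, dolHF q s m ι v x := by
  rw [← dol_polar _ (dolHF_cont hv hs hm) hR]; rfl

theorem dolHF_zero {q s m ι : ℝ} {v : DolE → ℝ} (hm : 0 < m) (hι : 0 < ι) {x : DolE} (hx : ‖gradient v x‖^2 ≤ m) : dolHF q s m ι v x = 0 := by
  unfold dolHF
  rw [dolE_grad0, dolE_grad1, ← dolE_norm_sq, dolw_zero hm hι hx, zero_mul]

theorem dolHF_le {q s m ι E : ℝ} {v : DolE → ℝ} (hq : 1 < q) (hs : 0 < s) (hm : 0 < m) (hι : 0 < ι) (hιK : 2 * ι * dolK ≤ 1) {x : DolE} (hx : m ≤ ‖gradient v x‖^2)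
    (hE : ‖gradient v x‖^(q-1) * |dolTr q v x| ≤ E) : dolHF q s m ι v x ≤ (q+1) / (s^2)^(q-1) * E^2 := by
  have e : dolHF q s m ι v x = dolw q s m ι (‖gradient v x‖^2) * dolTr q v x^2 := by
    unfold dolHF dolTau dolTr dolaN
    rw [dolE_grad0, dolE_grad1, ← dolE_norm_sq, dolX_eq hm hx]
  rw [e]
  have h1 := dolw_up hq hs hm hι hιK hx
  calc _ ≤ (q+1) * (‖gradient v x‖^2 / s^2)^(q-1) * dolTr q v x^2 := by gcongr
    _ = (q+1) / (s^2)^(q-1) * (‖gradient v x‖^(q-1) * |dolTr q v x|)^2 := by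
      rw [Real.div_rpow (by positivity) (by positivity), mul_pow, sq_abs, ← Real.rpow_natCast (‖gradient v x‖) 2, ← Real.rpow_natCast (‖gradient v x‖^(q-1)) 2,
        ← Real.rpow_mul (norm_nonneg _), ← Real.rpow_mul (norm_nonneg _), mul_comm (q-1)]
      ring
    _ ≤ _ := by gcongr

set_option maxHeartbeats 1600000 in
theorem dol_Tbound {q δ s m ι η M : ℝ} {U : DolE → ℝ} (hq : 1 < q) (hδ : 0 ≤ δ) (hs : 0 < s) (hm : 0 < m) (hι : 0 < ι) (hη : 0 < η) (hιK : 2 * ι * dolK ≤ 1) (hM : 0 < M)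
    (hU : ContDiff ℝ 1 U) (hUc : HasCompactSupport U) (hw : DolWeak q δ (gradient U)) (hc1 : 2 * (q+1) / (s^2)^(q-1) * δ^2 * π ≤ 1) :
    ∃ ε0, 0 < ε0 ∧ ∀ ε, 0 < ε → ε ≤ ε0 → ∀ ρ, DolMol M ε ρ → ∀ (hv : ContDiff ℝ (⊤ : ℕ∞) (dolMv ρ U)), ∀ R, 0 ≤ R → R ≤ 3/4 →
      dolCum ((dolPDof (dolMv ρ U) hv).wT q s m ι m) R ≤ R^2 + η := by
  set F := gradient U with hFdef
  have hF : Continuous F := dol_grad_cont hU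
  have hFc : HasCompactSupport F := by
    have := hUc.fderiv ℝ
    rw [hFdef]
    exact this.comp_left (g := fun L => (InnerProductSpace.toDual ℝ DolE).symm L) (by simp)
  set sm := √m with hsm
  have hsmp : 0 < sm := Real.sqrt_pos.2 hm
  have hsm2 : sm^2 = m := Real.sq_sqrt hm.le
  obtain ⟨CK, h0, hCK, hh0, HK⟩ := dol_dq hq hδ (t := sm/2) (by positivity) hU hUc hw
  set c1 := 2 * (q+1) / (s^2)^(q-1) with hc1d
  have hc1p : 0 < c1 := by positivity
  set Q := (M * (1 + M*π))^2 * π^2 * CK with hQ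
  have hQ0 : 0 ≤ Q := by positivity
  set ω := √(η / (c1 * (Q+1))) with hωd
  have hω : 0 < ω := Real.sqrt_pos.2 (by positivity)
  have hω2 : c1 * ω^2 * Q ≤ η := by
    rw [Real.sq_sqrt (by positivity)]
    have : c1 * (η / (c1 * (Q+1))) * Q = η * (Q / (Q+1)) := by field_simp
    rw [this]
    have : Q / (Q+1) ≤ 1 := by rw [div_le_one (by positivity)]; linarith
    nlinarith
  obtain ⟨L, hL⟩ : ∃ L, ∀ x, ‖F x‖ ≤ L := by
    obtain ⟨L, hL⟩ := hF.bounded_above_of_compact_support hFc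
    exact ⟨L, hL⟩
  obtain ⟨κ, hκ, Hκ⟩ := dolAf_unif (q := q) (t := sm) (L := L) (ω := ω) hsmp hω
  obtain ⟨d, hd, Hd⟩ := dol_unif hF hFc (e := min (κ/2) (sm/2)) (by positivity)
  refine ⟨min (min h0 d) (1/16), by positivity, ?_⟩
  intro ε hε hεle ρ hρ hv R hR0 hR
  have hε1 : ε ≤ h0 := hεle.trans ((min_le_left _ _).trans (min_le_left _ _))
  have hε2 : ε ≤ d := hεle.trans ((min_le_left _ _).trans (min_le_right _ _))
  have hε3 : ε ≤ 1/16 := hεle.trans (min_le_right _ _)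
  rw [dolHF_cum hv hs hm hR0]
  set K : Set DolE := closedBall 0 (3/4) ∩ {x | sm/2 ≤ ‖F x‖} with hK
  have hKcl : IsClosed K := isClosed_closedBall.inter (isClosed_le continuous_const hF.norm)
  have hKc : IsCompact K := (isCompact_closedBall (0:DolE) (3/4)).inter_right (isClosed_le continuous_const hF.norm)
  set J : DolE → ℝ := fun x => (∫ y in closedBall (0:DolE) ε, ‖F (x-y) - F x‖)^2 with hJ
  have hJc : Continuous J := by
    have hcc1 : Continuous (fun p : DolE × DolE => ‖F (p.1-p.2) - F p.1‖) := by fun_prop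
    exact (continuous_parametric_integral_of_continuous hcc1 (isCompact_closedBall (0:DolE) ε)).pow 2
  have hR1 := dol_R1 hF hKc hε hε1 hCK HK
  set c2 := c1 * ω^2 * ((M * (1 + M * π))^2 * (ε^6)⁻¹) with hc2
  have hc2p : 0 ≤ c2 := by positivity
  have hpt : ∀ x ∈ ball (0:DolE) R, dolHF q s m ι (dolMv ρ U) x ≤ c1 * δ^2 + c2 * K.indicator J x := by
    intro x hx
    rw [mem_ball_zero_iff] at hx
    have hind : 0 ≤ K.indicator J x := Set.indicator_nonneg (fun x _ => sq_nonneg _) x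
    rcases le_total (‖gradient (dolMv ρ U) x‖^2) m with h | h
    · rw [dolHF_zero hm hι h]; positivity
    · set a := gradient (dolMv ρ U) x with ha
      have hasm : sm ≤ ‖a‖ := by
        rw [← hsm2] at h; exact le_of_sq_le_sq h (norm_nonneg _)
      have haint : a = ∫ y, ρ y • F (x - y) := dolMv_grad hρ hU hUc x
      have hclose : ∀ y z : DolE, ‖y‖ ≤ ε → ‖z‖ ≤ ε → True := fun _ _ _ _ => trivial
      have haF : ‖a - F x‖ ≤ min (κ/2) (sm/2) := by
        rw [haint]
        apply hρ.norm_sub_le_sup (k := fun y => F (x-y)) (by fun_prop)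
        intro y hy
        apply Hd
        simp only [sub_sub_cancel_left, norm_neg]; linarith
      have hxK : x ∈ K := by
        refine ⟨by rw [mem_closedBall_zero_iff]; linarith, ?_⟩
        show sm/2 ≤ ‖F x‖
        have h1 := haF.trans (min_le_right _ _)
        have h2 := norm_sub_norm_le a (F x)
        linarith
      have haL : ‖a‖ ≤ L := by
        rw [haint, ← sub_zero (∫ y, ρ y • F (x - y))]
        exact hρ.norm_sub_le_sup (k := fun y => F (x-y)) (by fun_prop) 0 (fun y _ => by simpa using hL _)
      have hb := dolTr_bound hq hρ hM hε hω.le hU hUc hw (by linarith) (x := x) (by linarith) (by rw [← ha]; linarith) (by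
        intro y hy
        apply Hκ _ _ hasm haL
        have h1 := haF.trans (min_le_left _ _)
        have h2 := (Hd (x-y) x (by simp only [sub_sub_cancel_left, norm_neg]; linarith)).trans (min_le_left _ _)
        have h3 := norm_sub_le (F (x-y) - F x) (a - F x)
        rw [sub_sub_sub_cancel_right] at h3
        linarith)
      have hle := dolHF_le hq hs hm hι hιK h hb
      refine hle.trans ?_
      rw [Set.indicator_of_mem hxK]
      set I := ∫ y in closedBall (0:DolE) ε, ‖F (x-y) - F x‖ with hI
      have hJx : J x = I^2 := rfl
      rw [hJx]
      have e1 : c1 * δ^2 + c2 * I^2 = (q+1) / (s^2)^(q-1) * (2 * δ^2 + 2 * (ω * (M * (1+M*π) * (ε^3)⁻¹ * I))^2) := by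
        rw [hc2, hc1d]; field_simp
      rw [e1]
      have hpos : 0 ≤ (q+1) / (s^2)^(q-1) := by positivity
      apply mul_le_mul_of_nonneg_left _ hpos
      nlinarith [sq_nonneg (δ - ω * (M * (1+M*π) * (ε^3)⁻¹ * I))]
  have iJ : IntegrableOn J K := hJc.continuousOn.integrableOn_compact hKc
  have iJ2 : Integrable (K.indicator J) := (integrable_indicator_iff hKcl.measurableSet).2 iJ
  have icb : IntegrableOn (fun _ : DolE => c1 * δ^2) (ball (0:DolE) R) := by
    exact integrableOn_const measure_ball_lt_top.ne
  calc ∫ x in ball (0:DolE) R, dolHF q s m ι (dolMv ρ U) x ≤ ∫ x in ball (0:DolE) R, (c1 * δ^2 + c2 * K.indicator J x) := by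
        apply setIntegral_mono_on
        · exact ((dolHF_cont hv hs hm).continuousOn.integrableOn_compact (isCompact_closedBall 0 R)).mono_set ball_subset_closedBall
        · exact icb.add (iJ2.integrableOn.const_mul _)
        · exact measurableSet_ball
        · exact hpt
    _ = c1 * δ^2 * (π * R^2) + c2 * ∫ x in ball (0:DolE) R, K.indicator J x := by
        rw [integral_add icb (iJ2.integrableOn.const_mul _), setIntegral_const, smul_eq_mul, integral_const_mul]
        congr 1
        rw [measureReal_def, ← Measure.addHaar_closedBall_eq_addHaar_ball, ← measureReal_def, dol_vol_ball hR0]; ring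
    _ ≤ c1 * δ^2 * (π * R^2) + c2 * ∫ x, K.indicator J x := by
        gcongr
        · exact Filter.Eventually.of_forall fun x => Set.indicator_nonneg (fun x _ => sq_nonneg _) x
        · exact Measure.restrict_le_self
    _ ≤ c1 * δ^2 * (π * R^2) + c2 * (π^2 * CK * ε^6) := by
        rw [integral_indicator hKcl.measurableSet]
        gcongr
    _ = (c1 * δ^2 * π) * R^2 + c1 * ω^2 * Q := by
        rw [hc2, hQ]; field_simp
    _ ≤ 1 * R^2 + η := by gcongr
    _ = _ := by ring

theorem dol_grad_hcs {U : DolE → ℝ} (hUc : HasCompactSupport U) : HasCompactSupport (gradient U) :=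
  (hUc.fderiv ℝ).comp_left (g := fun L => (InnerProductSpace.toDual ℝ DolE).symm L) (by simp)

theorem dol_approx (M : ℝ) {U : DolE → ℝ} (hU : ContDiff ℝ 1 U) (hUc : HasCompactSupport U) {e : ℝ} (he : 0 < e) :
    ∃ ε0, 0 < ε0 ∧ ∀ ε, 0 < ε → ε ≤ ε0 → ∀ ρ, DolMol M ε ρ → ∀ x, |dolMv ρ U x - U x| ≤ e ∧ ‖gradient (dolMv ρ U) x - gradient U x‖ ≤ e := by
  have hF := dol_grad_cont hU
  obtain ⟨d1, hd1, H1⟩ := dol_unif hF (dol_grad_hcs hUc) he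
  have hu := hUc.uniformContinuous_of_continuous hU.continuous
  rw [Metric.uniformContinuous_iff] at hu
  obtain ⟨d2, hd2, H2⟩ := hu e he
  refine ⟨min d1 (d2/2), by positivity, fun ε hε hle ρ hρ x => ⟨?_, ?_⟩⟩
  · rw [dolMv_eq, ← Real.norm_eq_abs]
    have hc := hU.continuous
    apply hρ.norm_sub_le_sup (k := fun y => U (x-y)) (by fun_prop)
    intro y hy
    rw [← dist_eq_norm]
    apply (H2 _).le
    rw [dist_eq_norm]
    simp only [sub_sub_cancel_left, norm_neg]
    have := hle.trans (min_le_right _ _)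
    linarith
  · rw [dolMv_grad hρ hU hUc x]
    apply hρ.norm_sub_le_sup (k := fun y => gradient U (x-y)) (by fun_prop)
    intro y hy
    apply H1
    simp only [sub_sub_cancel_left, norm_neg]
    have := hle.trans (min_le_left _ _)
    linarith

theorem dolMv_supp {M ε r : ℝ} {ρ U : DolE → ℝ} (hρ : DolMol M ε ρ) (hs : ∀ x, r < ‖x‖ → U x = 0) {x : DolE} (hx : r + ε < ‖x‖) : dolMv ρ U x = 0 := by
  rw [dolMv_eq]
  apply integral_eq_zero_of_ae
  refine Filter.Eventually.of_forall fun y => ?_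
  show ρ y • U (x - y) = 0
  rcases le_or_gt ‖y‖ ε with h | h
  · rw [hs (x-y), smul_zero]
    have := norm_sub_norm_le x y
    linarith
  · rw [hρ.zero h, zero_smul]

theorem dolWeak_of_smooth {q δ : ℝ} {F : DolE → DolE} (hq : 1 < q) (hδ : 0 ≤ δ) (hF : Continuous F) (hFc : HasCompactSupport F)
    (H : ∀ φ : DolE → ℝ, ContDiff ℝ (⊤ : ℕ∞) φ → HasCompactSupport φ → tsupport φ ⊆ ball 0 (15/16) → |∫ x, fderiv ℝ φ x (dolAf q (F x))| ≤ δ * ∫ x, |φ x|) :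
    DolWeak q δ F := by
  intro φ hφ hφc hs
  set G : DolE → DolE := fun x => dolAf q (F x) with hG
  have hGc : Continuous G := (dolAf_cont hq).comp hF
  have hGs : HasCompactSupport G := hFc.comp_left (g := dolAf q) (by simp [dolAf])
  have iG : Integrable (fun x => ‖G x‖) := (hGc.integrable_of_hasCompactSupport hGs).norm
  have iφ : Integrable φ := hφ.continuous.integrable_of_hasCompactSupport hφc
  have hff := hφ.continuous_fderiv (by simp)
  obtain ⟨M, hM, hex⟩ := dolMol_exists
  set T := δ * π + ∫ x, ‖G x‖ with hT
  have hT0 : 0 ≤ T := add_nonneg (by positivity) (integral_nonneg fun x => norm_nonneg _)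
  have hz : ∀ x : DolE, 7/8 < ‖x‖ → φ x = 0 := by
    intro x hx
    apply image_eq_zero_of_notMem_tsupport
    intro hh; have := hs hh; rw [mem_ball_zero_iff] at this; linarith
  apply le_of_forall_pos_le_add
  intro e' he'
  set e := e' / (T+1) with he
  have hep : 0 < e := by positivity
  obtain ⟨ε0, hε0, Ha⟩ := dol_approx M hφ hφc hep
  set ε := min ε0 (1/32) with hε
  have hεp : 0 < ε := by positivity
  obtain ⟨ρ, hρ⟩ := hex ε hεp
  have Ha := Ha ε hεp (min_le_left _ _) ρ hρ
  set ψ := dolMv ρ φ with hψ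
  have hψs : ContDiff ℝ (⊤ : ℕ∞) ψ := dolMv_smooth hρ.smooth hρ.hcs hφ.continuous
  have hψz : ∀ x : DolE, 29/32 < ‖x‖ → ψ x = 0 := by
    intro x hx
    apply dolMv_supp hρ hz
    have : ε ≤ 1/32 := min_le_right _ _
    linarith
  have hψt : tsupport ψ ⊆ closedBall 0 (29/32) := by
    apply closure_minimal _ isClosed_closedBall
    intro x hx
    by_contra h
    rw [mem_closedBall_zero_iff, not_le] at h
    exact hx (hψz x h)
  have hψc : HasCompactSupport ψ := HasCompactSupport.of_support_subset_isCompact (isCompact_closedBall 0 (29/32)) ((subset_tsupport _).trans hψt)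
  have hψf := hψs.continuous_fderiv (by simp)
  have h1 := H ψ hψs hψc (hψt.trans (closedBall_subset_ball (by norm_num)))
  have i1 : Integrable fun x => fderiv ℝ φ x (G x) := by
    apply Continuous.integrable_of_hasCompactSupport (by fun_prop)
    exact hGs.mono (by intro x hx; simp at hx ⊢; contrapose! hx; simp [hx])
  have i2 : Integrable fun x => fderiv ℝ ψ x (G x) := by
    apply Continuous.integrable_of_hasCompactSupport (by fun_prop)
    exact hGs.mono (by intro x hx; simp at hx ⊢; contrapose! hx; simp [hx])
  have iψ : Integrable ψ := hψs.continuous.integrable_of_hasCompactSupport hψc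
  have h2 : |(∫ x, fderiv ℝ φ x (G x)) - ∫ x, fderiv ℝ ψ x (G x)| ≤ e * ∫ x, ‖G x‖ := by
    rw [← integral_sub i1 i2, ← integral_const_mul, ← Real.norm_eq_abs]
    apply norm_integral_le_of_norm_le (iG.const_mul _)
    refine Filter.Eventually.of_forall fun x => ?_
    rw [dol_fderiv_eq, dol_fderiv_eq, ← inner_sub_left]
    refine (norm_inner_le_norm _ _).trans ?_
    gcongr
    rw [norm_sub_rev]; exact (Ha x).2
  have h3 : ∫ x, |ψ x| ≤ (∫ x, |φ x|) + e * π := by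
    have e1 : ∀ g : DolE → ℝ, (∀ x, 29/32 < ‖x‖ → g x = 0) → ∫ x, |g x| = ∫ x in closedBall (0:DolE) 1, |g x| := by
      intro g hg
      symm
      apply setIntegral_eq_integral_of_forall_compl_eq_zero
      intro x hx
      rw [mem_closedBall_zero_iff, not_le] at hx
      rw [hg x (by linarith), abs_zero]
    rw [e1 ψ hψz, e1 φ (fun x hx => hz x (by linarith))]
    have ic : IntegrableOn (fun _ : DolE => e) (closedBall (0:DolE) 1) := continuousOn_const.integrableOn_compact (isCompact_closedBall _ _)
    have e2 : e * π = ∫ x in closedBall (0:DolE) 1, e := by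
      rw [setIntegral_const, dol_vol_ball zero_le_one, smul_eq_mul]; ring
    rw [e2, ← integral_add iφ.abs.integrableOn ic]
    apply integral_mono iψ.abs.integrableOn (iφ.abs.integrableOn.add ic)
    intro x
    show |ψ x| ≤ |φ x| + e
    have := (Ha x).1
    have h5 := abs_sub_abs_le_abs_sub (ψ x) (φ x)
    linarith
  have h4 := abs_sub_abs_le_abs_sub (∫ x, fderiv ℝ φ x (G x)) (∫ x, fderiv ℝ ψ x (G x))
  have h5 : e * T ≤ e' := by
    rw [he, div_mul_eq_mul_div, div_le_iff₀ (by positivity)]; nlinarith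
  have h6 : δ * ∫ x, |ψ x| ≤ δ * ((∫ x, |φ x|) + e * π) := by gcongr
  rw [hT] at h5
  nlinarith

theorem dol_caccn_pt {q η y N : ℝ} {n : ℕ} (hq : 1 < q) (hn : q + 1 ≤ n) (h0 : 0 ≤ η) (h1 : η ≤ 1) (hy : 0 ≤ y) (hN : 0 ≤ N) :
    n * η^(n-1) * N * y^q ≤ 1/2 * (η^n * y^(q+1)) + n * N * (2 * n * N)^q := by
  obtain ⟨k, rfl⟩ : ∃ k, n = k+1 := by
    cases n with
    | zero => simp at hn; linarith
    | succ k => exact ⟨k, rfl⟩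
  simp only [Nat.add_sub_cancel]
  set c : ℝ := ((k+1:ℕ):ℝ) with hc
  have hc0 : 0 ≤ c := by positivity
  have hck : c = k + 1 := by rw [hc]; push_cast; ring
  have hyq : 0 ≤ y^q := Real.rpow_nonneg hy q
  have hyq1 : y^(q+1) = y * y^q := by
    rw [Real.rpow_add_one' hy (by linarith)]; ring
  have hpos : 0 ≤ c * N * (2 * c * N)^q := mul_nonneg (by positivity) (Real.rpow_nonneg (by positivity) _)
  rcases le_total (2 * c * N) (η * y) with h | h
  · have : c * η^k * N * y^q ≤ 1/2 * (η^(k+1) * y^(q+1)) := by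
      rw [hyq1, pow_succ]
      have : (2*c*N) * (η^k * y^q) ≤ (η*y) * (η^k * y^q) := by gcongr
      nlinarith
    linarith
  · have h2 : η^k * y^q ≤ (2*c*N)^q := by
      have e1 : η^k ≤ η^q := by
        rcases h0.eq_or_lt with h00 | h00
        · rw [← h00, Real.zero_rpow (by linarith), zero_pow]
          intro hk; rw [hk] at hck; push_cast at hck; linarith
        · rw [← Real.rpow_natCast]
          apply Real.rpow_le_rpow_of_exponent_ge h00 h1; linarith
      calc η^k * y^q ≤ η^q * y^q := by gcongr
        _ = (η*y)^q := (Real.mul_rpow h0 hy).symm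
        _ ≤ _ := Real.rpow_le_rpow (by positivity) h (by linarith)
    have h3 : c * N * (η^k * y^q) ≤ c * N * (2*c*N)^q := by gcongr
    have h4 : 0 ≤ 1/2 * (η^(k+1) * y^(q+1)) := by
      have := Real.rpow_nonneg hy (q+1); positivity
    nlinarith

set_option maxHeartbeats 1600000 in
theorem dol_cacc {q : ℝ} (hq : 1 < q) : ∃ C0, 0 ≤ C0 ∧ ∀ δ, 0 ≤ δ → δ ≤ 1 → ∀ U : DolE → ℝ, ContDiff ℝ 1 U → (∀ x, |U x| ≤ 1) → DolWeak q δ (gradient U) →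
    ∫ x in closedBall (0:DolE) (3/4), ‖gradient U x‖^2 ≤ C0 := by
  obtain ⟨η, hη, hη0, hη1, hηK, hηO⟩ := dol_cutoff (K := closedBall (0:DolE) (3/4)) (O := ball 0 (13/16)) isClosed_closedBall isOpen_ball (closedBall_subset_ball (by norm_num))
  set A : Set DolE := closedBall 0 (13/16) with hA
  have hAc : IsCompact A := isCompact_closedBall _ _
  have hz : ∀ x : DolE, 13/16 < ‖x‖ → η x = 0 := fun x hx => hηO x (by rw [mem_ball_zero_iff]; linarith)
  have hηt : tsupport η ⊆ A := by
    apply closure_minimal _ isClosed_closedBall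
    intro x hx
    by_contra h
    rw [mem_closedBall_zero_iff, not_le] at h
    exact hx (hz x h)
  have hηc : HasCompactSupport η := HasCompactSupport.of_support_subset_isCompact hAc ((subset_tsupport _).trans hηt)
  have hηf := hη.continuous_fderiv (by simp)
  obtain ⟨N, hN⟩ := hηf.bounded_above_of_compact_support (hηc.fderiv ℝ)
  have hN0 : 0 ≤ N := (norm_nonneg _).trans (hN 0)
  obtain ⟨n, hn⟩ := exists_nat_ge (q+1)
  set C : ℝ := n * N * (2*n*N)^q with hC
  have hCpos : 0 ≤ C := mul_nonneg (by positivity) (Real.rpow_nonneg (by positivity) _)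
  refine ⟨π + 2 * ((1+C) * π), by positivity, ?_⟩
  intro δ hδ hδ1 U hU hUb hw
  set F := gradient U with hF
  have hFc : Continuous F := dol_grad_cont hU
  have hn0 : n ≠ 0 := by rintro rfl; simp at hn; linarith
  set φ : DolE → ℝ := fun x => η x^n * U x with hφ
  have hφc : ContDiff ℝ 1 φ := ((hη.of_le (by norm_cast)).pow n).mul hU
  have hφz : ∀ x : DolE, 13/16 < ‖x‖ → φ x = 0 := fun x hx => by simp [hφ, hz x hx, hn0]
  have hφt : tsupport φ ⊆ A := by
    apply closure_minimal _ isClosed_closedBall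
    intro x hx
    by_contra h
    rw [mem_closedBall_zero_iff, not_le] at h
    exact hx (hφz x h)
  have hφcs : HasCompactSupport φ := HasCompactSupport.of_support_subset_isCompact hAc ((subset_tsupport _).trans hφt)
  have h1 := hw φ hφc hφcs (hφt.trans (closedBall_subset_ball (by norm_num)))
  have hder : ∀ x w, fderiv ℝ φ x w = η x^n * fderiv ℝ U x w + (n * η x^(n-1) * U x) * fderiv ℝ η x w := by
    intro x w
    have a := ((hη.differentiable (by simp) x).hasFDerivAt.pow n).mul (hU.differentiable (by simp) x).hasFDerivAt
    rw [show φ = (fun x => η x ^ n) * U from rfl] 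
    rw [HasFDerivAt.fderiv a]
    simp
    ring
  have hAF : ∀ x, fderiv ℝ U x (dolAf q (F x)) = ‖F x‖^(q+1) := by
    intro x
    rw [dol_fderiv_eq, dolAf, inner_smul_right, real_inner_self_eq_norm_sq, ← Real.rpow_natCast, ← Real.rpow_add_of_nonneg (norm_nonneg _) (by linarith) (by norm_num)]
    congr 1; push_cast; ring
  have hpt : ∀ x, 1/2 * (η x^n * ‖F x‖^(q+1)) - C ≤ fderiv ℝ φ x (dolAf q (F x)) := by
    intro x
    rw [hder, hAF]
    have b1 := dol_caccn_pt hq hn (hη0 x) (hη1 x) (norm_nonneg (F x)) hN0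
    have b2 : |(n * η x^(n-1) * U x) * fderiv ℝ η x (dolAf q (F x))| ≤ n * η x^(n-1) * N * ‖F x‖^q := by
      rw [abs_mul, abs_mul, abs_of_nonneg (mul_nonneg (Nat.cast_nonneg n) (pow_nonneg (hη0 x) (n-1)))]
      have b3 : |fderiv ℝ η x (dolAf q (F x))| ≤ N * ‖F x‖^q := by
        rw [← Real.norm_eq_abs, ← dolAf_norm hq]
        exact (ContinuousLinearMap.le_opNorm _ _).trans (by gcongr; exact hN x)
      have hp := hη0 x
      calc _ ≤ (n * η x^(n-1) * 1) * (N * ‖F x‖^q) := by gcongr; exact hUb x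
        _ = _ := by ring
    have b4 := neg_abs_le ((n * η x^(n-1) * U x) * fderiv ℝ η x (dolAf q (F x)))
    linarith
  have hfz : ∀ x, x ∉ A → fderiv ℝ φ x (dolAf q (F x)) = 0 := by
    intro x hx
    have : fderiv ℝ φ x = 0 := image_eq_zero_of_notMem_tsupport fun hh => hx (hφt (tsupport_fderiv_subset ℝ hh))
    rw [this]; rfl
  rw [← setIntegral_eq_integral_of_forall_compl_eq_zero hfz] at h1
  have hz2 : ∀ x, x ∉ A → |φ x| = 0 := by
    intro x hx
    rw [hA, mem_closedBall_zero_iff, not_le] at hx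
    rw [hφz x hx, abs_zero]
  rw [← setIntegral_eq_integral_of_forall_compl_eq_zero hz2] at h1
  have hvol : volume.real A ≤ π := by
    rw [hA, dol_vol_ball (by norm_num)]; nlinarith [pi_pos]
  have hdA := dolAf_cont hq
  have hφf := hφc.continuous_fderiv (by simp)
  have hφcc := hφc.continuous
  have hηcc := hη.continuous
  have hpc : Continuous fun x => ‖F x‖^(q+1) := by
    apply Continuous.rpow_const (by fun_prop); intro x; right; linarith
  have i1 : IntegrableOn (fun x => 1/2 * (η x^n * ‖F x‖^(q+1))) A := (Continuous.continuousOn (by fun_prop)).integrableOn_compact hAc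
  have i1' : IntegrableOn (fun x => η x^n * ‖F x‖^(q+1)) A := (Continuous.continuousOn (by fun_prop)).integrableOn_compact hAc
  have i2 : IntegrableOn (fun _ : DolE => C) A := continuousOn_const.integrableOn_compact hAc
  have i3 : IntegrableOn (fun x => fderiv ℝ φ x (dolAf q (F x))) A := (Continuous.continuousOn (by fun_prop)).integrableOn_compact hAc
  have i4 : IntegrableOn (fun x => |φ x|) A := (Continuous.continuousOn (by fun_prop)).integrableOn_compact hAc
  have i5 : IntegrableOn (fun _ : DolE => (1:ℝ)) A := continuousOn_const.integrableOn_compact hAc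
  have k1 : 1/2 * (∫ x in A, η x^n * ‖F x‖^(q+1)) - C * π ≤ ∫ x in A, fderiv ℝ φ x (dolAf q (F x)) := by
    have : ∫ x in A, (1/2 * (η x^n * ‖F x‖^(q+1)) - C) ≤ ∫ x in A, fderiv ℝ φ x (dolAf q (F x)) := integral_mono (i1.sub i2) i3 hpt
    rw [integral_sub i1 i2, integral_const_mul, setIntegral_const, smul_eq_mul] at this
    nlinarith
  have k2 : ∫ x in A, |φ x| ≤ π := by
    have : ∫ x in A, |φ x| ≤ ∫ x in A, (1:ℝ) := by
      apply integral_mono i4 i5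
      intro x
      show |φ x| ≤ 1
      rw [hφ]; simp only [abs_mul]
      rw [abs_of_nonneg (pow_nonneg (hη0 x) n)]
      exact mul_le_one₀ (pow_le_one₀ (hη0 x) (hη1 x)) (abs_nonneg _) (hUb x)
    rw [setIntegral_const, smul_eq_mul, mul_one] at this
    linarith
  have k3 := (le_abs_self _).trans h1
  have k4 : δ * ∫ x in A, |φ x| ≤ 1 * π := by
    apply mul_le_mul hδ1 k2 (integral_nonneg fun x => abs_nonneg _) zero_le_one
  have hsub : closedBall (0:DolE) (3/4) ⊆ A := closedBall_subset_closedBall (by norm_num)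
  have hBc : IsCompact (closedBall (0:DolE) (3/4)) := isCompact_closedBall _ _
  calc ∫ x in closedBall (0:DolE) (3/4), ‖F x‖^2 ≤ ∫ x in closedBall (0:DolE) (3/4), (1 + η x^n * ‖F x‖^(q+1)) := by
        apply setIntegral_mono_on
        · exact (Continuous.continuousOn (by fun_prop)).integrableOn_compact hBc
        · exact (Continuous.continuousOn (by fun_prop)).integrableOn_compact hBc
        · exact isClosed_closedBall.measurableSet
        · intro x hx
          rw [hηK x hx, one_pow, one_mul]
          rcases le_total ‖F x‖ 1 with h | h
          · have : 0 ≤ ‖F x‖^(q+1) := by positivity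
            nlinarith [norm_nonneg (F x)]
          · have : ‖F x‖^2 ≤ ‖F x‖^(q+1) := by
              rw [← Real.rpow_natCast]
              apply Real.rpow_le_rpow_of_exponent_le h; push_cast; linarith
            linarith
    _ ≤ ∫ x in A, (1 + η x^n * ‖F x‖^(q+1)) := by
        apply setIntegral_mono_set (i5.add i1') _ hsub.eventuallyLE
        refine Filter.Eventually.of_forall fun x => ?_
        have := hη0 x
        show 0 ≤ 1 + η x^n * ‖F x‖^(q+1)
        positivity
    _ = volume.real A + ∫ x in A, η x^n * ‖F x‖^(q+1) := by
        rw [integral_add i5 i1', setIntegral_const, smul_eq_mul, mul_one]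
    _ ≤ _ := by linarith

theorem dol_cacc_mol {U V : DolE → ℝ} (hU : ContDiff ℝ 1 U) (hV : ContDiff ℝ (⊤ : ℕ∞) V) {C0 : ℝ} (h : ∫ x in closedBall (0:DolE) (3/4), ‖gradient U x‖^2 ≤ C0)
    (ha : ∀ x, ‖gradient V x - gradient U x‖ ≤ 1) : dolCum (dolPDof V hV).X (3/4) ≤ 2 * C0 + 2 * π := by
  have hF := dol_grad_cont hU
  have hG : Continuous (gradient V) := dol_grad_cont (hV.of_le (by norm_cast))
  have hBc : IsCompact (closedBall (0:DolE) (3/4)) := isCompact_closedBall _ _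
  have e : dolCum (dolPDof V hV).X (3/4) = ∫ x in ball (0:DolE) (3/4), ‖gradient V x‖^2 := by
    rw [← dol_polar _ (by fun_prop) (by norm_num)]
    congr 1; ext p
    rw [dolE_norm_sq, ← dolE_grad0, ← dolE_grad1]; rfl
  have i1 : IntegrableOn (fun x => 2 * ‖gradient U x‖^2) (closedBall (0:DolE) (3/4)) := (Continuous.continuousOn (by fun_prop)).integrableOn_compact hBc
  have i2 : IntegrableOn (fun _ : DolE => (2:ℝ)) (closedBall (0:DolE) (3/4)) := (Continuous.continuousOn (by fun_prop)).integrableOn_compact hBc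
  have i3 : IntegrableOn (fun x => ‖gradient V x‖^2) (closedBall (0:DolE) (3/4)) := (Continuous.continuousOn (by fun_prop)).integrableOn_compact hBc
  rw [e]
  calc _ ≤ ∫ x in closedBall (0:DolE) (3/4), ‖gradient V x‖^2 := by
        apply setIntegral_mono_set i3 _ ball_subset_closedBall.eventuallyLE
        exact Filter.Eventually.of_forall fun x => by positivity
    _ ≤ ∫ x in closedBall (0:DolE) (3/4), (2 * ‖gradient U x‖^2 + 2) := by
        apply integral_mono i3 (i1.add i2)
        intro x
        show ‖gradient V x‖^2 ≤ 2 * ‖gradient U x‖^2 + 2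
        have h1 := ha x
        have h2 := norm_sub_norm_le (gradient V x) (gradient U x)
        have h3 : ‖gradient V x‖ ≤ ‖gradient U x‖ + 1 := by linarith
        nlinarith [norm_nonneg (gradient V x), norm_nonneg (gradient U x), sq_nonneg (‖gradient U x‖ - 1)]
    _ = 2 * (∫ x in closedBall (0:DolE) (3/4), ‖gradient U x‖^2) + volume.real (closedBall (0:DolE) (3/4)) * 2 := by
        rw [integral_add i1 i2, integral_const_mul, setIntegral_const, smul_eq_mul]
    _ ≤ _ := by
        rw [dol_vol_ball (by norm_num)]; nlinarith [pi_pos]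

theorem dolPD_Fc_norm (v : DolE → ℝ) (hv : ContDiff ℝ (⊤ : ℕ∞) v) (p : ℝ × ℝ) :
    ‖(dolPDof v hv).Fc p - ⟨gradient v 0 0, -gradient v 0 1⟩‖ = ‖gradient v (dolP p) - gradient v 0‖ := by
  have e : (dolPDof v hv).Fc p - ⟨gradient v 0 0, -gradient v 0 1⟩ = (⟨gradient v (dolP p) 0 - gradient v 0 0, -(gradient v (dolP p) 1 - gradient v 0 1)⟩ : ℂ) := by
    have : (dolPDof v hv).Fc p = ⟨gradient v (dolP p) 0, -gradient v (dolP p) 1⟩ := by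
      rw [← dolE_grad0, ← dolE_grad1]; rfl
    rw [this]
    apply Complex.ext <;> simp
    ring
  rw [e]
  have h := dol_mk_norm_sq (gradient v (dolP p) 0 - gradient v 0 0) (gradient v (dolP p) 1 - gradient v 0 1)
  have h2 := dolE_norm_sq (gradient v (dolP p) - gradient v 0)
  simp only [PiLp.sub_apply] at h2
  rw [← h2] at h
  exact (sq_eq_sq₀ (norm_nonneg _) (norm_nonneg _)).1 h

set_option maxHeartbeats 1600000 in
theorem dol_core {q : ℝ} (hq : 1 < q) : ∃ lam δ0 : ℝ, 0 < lam ∧ lam < 1/2 ∧ 0 < δ0 ∧ ∀ U : DolE → ℝ, ContDiff ℝ 1 U → HasCompactSupport U → (∀ x, |U x| ≤ 1) →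
    DolWeak q δ0 (gradient U) → ∀ x, ‖x‖ ≤ lam → |U x - (U 0 + ⟪gradient U 0, x⟫)| ≤ lam^(1+1/q) := by
  have hq0 : 0 < q := by linarith
  obtain ⟨C0, hC0, Hcacc⟩ := dol_cacc hq
  obtain ⟨C, hC, Hfin⟩ := DolPD.final q hq (2 * C0 + 2 * π) (by positivity)
  obtain ⟨M, hM, hex⟩ := dolMol_exists
  set γ := dolGam q with hγ
  have hγ1 : 0 < γ - 1/q := by have := dolGam_gt hq; linarith
  set lam := min (1/4) ((1/(4*C))^(1/(γ-1/q))) with hlam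
  have hlp : 0 < lam := by positivity
  have hl4 : lam ≤ 1/4 := min_le_left _ _
  have hlC : lam^(γ-1/q) ≤ 1/(4*C) := by
    calc lam^(γ-1/q) ≤ ((1/(4*C))^(1/(γ-1/q)))^(γ-1/q) := Real.rpow_le_rpow hlp.le (min_le_right _ _) hγ1.le
      _ = 1/(4*C) := by
        rw [← Real.rpow_mul (by positivity), one_div_mul_cancel hγ1.ne', Real.rpow_one]
  set P := lam^(1/q) with hP
  have hPp : 0 < P := by positivity
  have hlγ : C * lam^γ ≤ P/4 := by
    have : lam^γ = lam^(γ-1/q) * P := by rw [hP, ← Real.rpow_add hlp]; congr 1; ring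
    rw [this]
    calc C * (lam^(γ-1/q) * P) ≤ C * (1/(4*C) * P) := by gcongr
      _ = P/4 := by field_simp
  set s := P / (4*(C+1)) with hs
  have hsp : 0 < s := by positivity
  have hCs : C * s ≤ P/4 := by
    rw [hs]
    have : C * (P / (4*(C+1))) = P/4 * (C/(C+1)) := by field_simp
    rw [this]
    have : C/(C+1) ≤ 1 := by rw [div_le_one (by positivity)]; linarith
    nlinarith
  set c1 := 2 * (q+1) / (s^2)^(q-1) with hc1
  have hc1p : 0 < c1 := by positivity
  set δ0 := min 1 (1/(c1*π)) with hδ0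
  have hδp : 0 < δ0 := by positivity
  have hδ1 : δ0 ≤ 1 := min_le_left _ _
  have hcδ : c1 * δ0^2 * π ≤ 1 := by
    have h1 : δ0^2 ≤ 1/(c1*π) := by
      have : δ0 ≤ 1/(c1*π) := min_le_right _ _
      nlinarith
    calc c1 * δ0^2 * π ≤ c1 * (1/(c1*π)) * π := by gcongr
      _ = 1 := by field_simp
  refine ⟨lam, δ0, hlp, by linarith, hδp, ?_⟩
  intro U hU hUc hUb hw x hx
  have hF := dol_grad_cont hU
  obtain ⟨d, hd, Hd⟩ := dol_unif hF (dol_grad_hcs hUc) (e := s/2) (by positivity)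
  set r0 := min lam d with hr0
  have hr0p : 0 < r0 := by positivity
  have hr0l : r0 ≤ lam := min_le_left _ _
  obtain ⟨ι, m, η, hι, hm, hη, hιK, HD⟩ := Hfin s hsp r0 hr0p (by linarith)
  obtain ⟨ε1, hε1, HT⟩ := dol_Tbound hq hδp.le hsp hm hι hη hιK hM hU hUc hw hcδ
  set e := min (min 1 (s/4)) (lam * P / 6) with he
  have hep : 0 < e := by positivity
  have he1 : e ≤ 1 := (min_le_left _ _).trans (min_le_left _ _)
  have he2 : e ≤ s/4 := (min_le_left _ _).trans (min_le_right _ _)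
  have he3 : e ≤ lam * P / 6 := min_le_right _ _
  obtain ⟨ε2, hε2, HA⟩ := dol_approx M hU hUc hep
  set ε := min ε1 ε2 with hε
  have hεp : 0 < ε := by positivity
  obtain ⟨ρ, hρ⟩ := hex ε hεp
  have hv : ContDiff ℝ (⊤ : ℕ∞) (dolMv ρ U) := dolMv_smooth hρ.smooth hρ.hcs hU.continuous
  have HA := HA ε hεp (min_le_right _ _) ρ hρ
  have HT := HT ε hεp (min_le_left _ _) ρ hρ hv
  set v := dolMv ρ U with hvd
  have hX := dol_cacc_mol hU hv (Hcacc δ0 hδp.le hδ1 U hU hUb hw) (fun x => (HA x).2.trans he1)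
  have hfin := HD (dolPDof v hv) hX HT ⟨gradient v 0 0, -gradient v 0 1⟩ (by
    intro r θ hr hrr _
    rw [dolPD_Fc_norm]
    set y := dolP (r,θ) with hy
    have hyn : ‖y‖ ≤ d := by
      rw [hy, dolP_norm, abs_of_nonneg hr]; exact hrr.trans (min_le_right _ _)
    have a1 := (HA y).2
    have a2 := (HA 0).2
    have a3 := Hd y 0 (by simpa using hyn)
    have e4 : gradient v y - gradient v 0 = (gradient v y - gradient U y) + (gradient U y - gradient U 0) - (gradient v 0 - gradient U 0) := by abel
    rw [e4]
    have n1 := norm_sub_le ((gradient v y - gradient U y) + (gradient U y - gradient U 0)) (gradient v 0 - gradient U 0)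
    have n2 := norm_add_le (gradient v y - gradient U y) (gradient U y - gradient U 0)
    linarith) lam hr0l (by linarith)
  have hT := dolPD_taylor v hv x hx _ hfin
  have b1 := abs_le.1 (HA x).1
  have b2 := abs_le.1 (HA 0).1
  have b3 : |⟪gradient v 0, x⟫ - ⟪gradient U 0, x⟫| ≤ e := by
    rw [← inner_sub_left, ← Real.norm_eq_abs]
    refine (norm_inner_le_norm _ _).trans ?_
    have := (HA 0).2
    nlinarith [norm_nonneg x, norm_nonneg (gradient v 0 - gradient U 0)]
  have b3 := abs_le.1 b3
  have hT := abs_le.1 hT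
  have hfinal : C * lam * (lam^γ + s) ≤ lam * P / 2 := by
    have : C * lam * (lam^γ + s) = lam * (C * lam^γ + C * s) := by ring
    rw [this]
    calc _ ≤ lam * (P/4 + P/4) := by gcongr
      _ = _ := by ring
  have hend : lam^(1+1/q) = lam * P := by
    rw [Real.rpow_add hlp, Real.rpow_one]
  rw [hend, abs_le]
  constructor <;> linarith

theorem dol_sup_bound {u : DolE → ℝ} (hu : ContDiffOn ℝ 1 u (ball (0:DolE) 1)) (h : eLpNorm u ⊤ (volume.restrict (ball (0:DolE) 1)) ≤ 1) :
    ∀ x ∈ ball (0:DolE) 1, |u x| ≤ 1 := by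
  by_contra! hcon
  obtain ⟨x0, hx0, h1⟩ := hcon
  rw [eLpNorm_exponent_top] at h
  have hae : ∀ᵐ x ∂(volume.restrict (ball (0:DolE) 1)), |u x| ≤ 1 := by
    filter_upwards [ae_le_eLpNormEssSup (f := u) (μ := volume.restrict (ball (0:DolE) 1))] with x hx
    have h2 := hx.trans h
    rw [← ofReal_norm_eq_enorm, ENNReal.ofReal_le_one] at h2
    simpa using h2
  rw [ae_restrict_iff' measurableSet_ball, ae_iff] at hae
  have hop : IsOpen (ball (0:DolE) 1 ∩ (fun x => |u x|) ⁻¹' Set.Ioi 1) :=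
    hu.continuousOn.abs.isOpen_inter_preimage isOpen_ball isOpen_Ioi
  have := hop.measure_pos volume ⟨x0, hx0, h1⟩
  have h3 : (ball (0:DolE) 1 ∩ (fun x => |u x|) ⁻¹' Set.Ioi 1) ⊆ {a | ¬(a ∈ ball (0:DolE) 1 → |u a| ≤ 1)} := by
    rintro y ⟨hy1, hy2⟩ hy3
    exact absurd (hy3 hy1) (not_le.2 hy2)
  have h4 := measure_mono_null h3 hae
  rw [h4] at this; exact lt_irrefl _ this

theorem dol_weak_of_sol {p δ : ℝ} (hp : 2 < p) (hδ : 0 ≤ δ) {u f U : EuclideanSpace ℝ (Fin 2) → ℝ}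
    (hf : eLpNorm f ⊤ (volume.restrict (B 2 1)) ≤ ENNReal.ofReal δ) (hw : IsPLaplaceWeakSolution p 1 u f)
    (hU : ContDiff ℝ 1 U) (hUc : HasCompactSupport U) (hg : ∀ x ∈ ball (0:DolE) (15/16), gradient U x = gradient u x) :
    DolWeak (p-1) δ (gradient U) := by
  apply dolWeak_of_smooth (by linarith) hδ (dol_grad_cont hU) (dol_grad_hcs hUc)
  intro φ hφ hφc hs
  have hs1 : tsupport φ ⊆ B 2 1 := hs.trans (ball_subset_ball (by norm_num))
  have h1 := hw φ hφ hφc hs1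
  have e1 : ∫ x, fderiv ℝ φ x (dolAf (p-1) (gradient U x)) = ∫ x in B 2 1, ‖gradient u x‖ ^ (p - 2) * ⟪gradient u x, gradient φ x⟫ := by
    rw [← setIntegral_eq_integral_of_forall_compl_eq_zero (s := B 2 1)]
    · apply setIntegral_congr_fun measurableSet_ball
      intro x _
      show fderiv ℝ φ x (dolAf (p-1) (gradient U x)) = ‖gradient u x‖ ^ (p - 2) * ⟪gradient u x, gradient φ x⟫
      rw [dol_fderiv_eq]
      by_cases hx : x ∈ ball (0:DolE) (15/16)
      · rw [hg x hx, dolAf, inner_smul_right, real_inner_comm, show p - 1 - 1 = p - 2 by ring]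
      · have : gradient φ x = 0 := by
          rw [← norm_eq_zero, dol_norm_grad, norm_eq_zero]
          exact image_eq_zero_of_notMem_tsupport fun hh => hx (hs (tsupport_fderiv_subset ℝ hh))
        rw [this]; simp
    · intro x hx
      have : fderiv ℝ φ x = 0 := image_eq_zero_of_notMem_tsupport fun hh => hx (hs1 (tsupport_fderiv_subset ℝ hh))
      rw [this]; rfl
  rw [e1, h1]
  have iφ : Integrable fun x => |φ x| := (hφ.continuous.integrable_of_hasCompactSupport hφc).abs
  rw [eLpNorm_exponent_top] at hf
  calc |∫ x in B 2 1, f x * φ x| ≤ ∫ x in B 2 1, δ * |φ x| := by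
        rw [← Real.norm_eq_abs]
        apply norm_integral_le_of_norm_le (iφ.integrableOn.const_mul _)
        filter_upwards [ae_le_eLpNormEssSup (f := f) (μ := volume.restrict (B 2 1))] with x hx
        have h2 := hx.trans hf
        rw [← ofReal_norm_eq_enorm, ENNReal.ofReal_le_ofReal_iff hδ] at h2
        rw [norm_mul, Real.norm_eq_abs (φ x)]
        gcongr
    _ ≤ ∫ x, δ * |φ x| := by
        apply setIntegral_le_integral (iφ.const_mul _)
        exact Filter.Eventually.of_forall fun x => by positivity
    _ = δ * ∫ x, |φ x| := integral_const_mul _ _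

theorem dol_extend {u : DolE → ℝ} (hu : ContDiffOn ℝ 1 u (ball (0:DolE) 1)) (hb : ∀ x ∈ ball (0:DolE) 1, |u x| ≤ 1) :
    ∃ U : DolE → ℝ, ContDiff ℝ 1 U ∧ HasCompactSupport U ∧ (∀ x, |U x| ≤ 1) ∧ (∀ x ∈ ball (0:DolE) (15/16), U x = u x) := by
  obtain ⟨χ, h1, h2, h3, h4, h5⟩ := dol_cutoff (K := closedBall (0:DolE) (15/16)) (O := ball 0 (31/32)) isClosed_closedBall isOpen_ball (closedBall_subset_ball (by norm_num))
  have hz : ∀ x : DolE, 31/32 ≤ ‖x‖ → χ x * u x = 0 := by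
    intro x hx
    rw [h5 x (by rw [mem_ball_zero_iff]; linarith), zero_mul]
  refine ⟨fun x => χ x * u x, ?_, ?_, ?_, ?_⟩
  · rw [contDiff_iff_contDiffAt]
    intro x
    rcases lt_or_ge ‖x‖ 1 with hx | hx
    · have hx1 : x ∈ ball (0:DolE) 1 := by rwa [mem_ball_zero_iff]
      exact ((h1.of_le (by norm_cast)).contDiffAt).mul (hu.contDiffAt (isOpen_ball.mem_nhds hx1))
    · have : (fun x => χ x * u x) =ᶠ[nhds x] fun _ => (0:ℝ) := by
        have ho : IsOpen {y : DolE | 31/32 < ‖y‖} := isOpen_lt continuous_const continuous_norm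
        filter_upwards [ho.mem_nhds (show x ∈ {y : DolE | 31/32 < ‖y‖} from by show 31/32 < ‖x‖; linarith)] with y hy
        exact hz y (le_of_lt hy)
      exact contDiffAt_const.congr_of_eventuallyEq this
  · apply HasCompactSupport.of_support_subset_isCompact (isCompact_closedBall (0:DolE) (31/32))
    intro x hx
    by_contra h
    rw [mem_closedBall_zero_iff, not_le] at h
    exact hx (hz x h.le)
  · intro x
    rcases lt_or_ge ‖x‖ (31/32) with hx | hx
    · show |χ x * u x| ≤ 1
      rw [abs_mul, abs_of_nonneg (h2 x)]
      exact mul_le_one₀ (h3 x) (abs_nonneg _) (hb x (by rw [mem_ball_zero_iff]; linarith))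
    · show |χ x * u x| ≤ 1
      rw [hz x hx]; simp
  · intro x hx
    show χ x * u x = u x
    rw [h4 x (ball_subset_closedBall hx), one_mul]

/-- **The discrete oscillation lemma** (Lemma 4.1).
Let `p > 2` and `B_1 ⊂ ℝ²`.  There exist `λ₀ ∈ (0,1/2)` and `δ₀ > 0`, depending
only on `p`, such that if `‖f‖_{L^∞(B_1)} ≤ δ₀` and `u ∈ C¹(B_1)` is a weak
solution of `-Δ_p u = f` in `B_1` with `‖u‖_{L^∞(B_1)} ≤ 1`, then
`sup_{x ∈ B_{λ₀}} |u(x) - [u(0) + ∇u(0)·x]| ≤ λ₀^{p'}`, where `p' = p/(p-1)`. -/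
theorem discrete_oscillation_lemma (p : ℝ) (hp : 2 < p) :
    ∃ lam₀ δ₀ : ℝ, 0 < lam₀ ∧ lam₀ < 1/2 ∧ 0 < δ₀ ∧
      ∀ u f : EuclideanSpace ℝ (Fin 2) → ℝ,
        eLpNorm f ⊤ (volume.restrict (B 2 1)) ≤ ENNReal.ofReal δ₀ →
        ContDiffOn ℝ 1 u (B 2 1) →
        IsPLaplaceWeakSolution p 1 u f →
        eLpNorm u ⊤ (volume.restrict (B 2 1)) ≤ 1 →
        ∀ x ∈ B 2 lam₀,
          |u x - (u 0 + ⟪gradient u 0, x⟫)| ≤ lam₀ ^ (p / (p - 1)) := by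
  obtain ⟨lam, δ0, hl, hl2, hδ, H⟩ := dol_core (q := p - 1) (by linarith)
  refine ⟨lam, δ0, hl, hl2, hδ, ?_⟩
  intro u f hf hu hw hub x hx
  have hb := dol_sup_bound hu hub
  obtain ⟨U, hU, hUc, hUb, hUu⟩ := dol_extend hu hb
  have hg : ∀ x ∈ ball (0:DolE) (15/16), gradient U x = gradient u x := by
    intro x hx
    have : U =ᶠ[nhds x] u := by
      filter_upwards [isOpen_ball.mem_nhds hx] with y hy using hUu y hy
    unfold gradient
    rw [this.fderiv_eq]
  have hweak := dol_weak_of_sol hp hδ.le hf hw hU hUc hg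
  have hxn : ‖x‖ < lam := by rwa [mem_ball_zero_iff] at hx
  have h := H U hU hUc hUb hweak x hxn.le
  have h0 : (0:DolE) ∈ ball (0:DolE) (15/16) := by simp
  rw [hg 0 h0, hUu 0 h0, hUu x (by rw [mem_ball_zero_iff]; linarith)] at h
  have e : p / (p-1) = 1 + 1/(p-1) := by
    have : p - 1 ≠ 0 := by linarith
    field_simp; ring
  rw [e]; exact h
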